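/- arXiv:0905.4932 — 2 statements merged into one kernel-verified Lean document; each statement's English description precedes it below -/
import Mathlib

section
/- Fix an integer n ≥ 1 and a point u ∈ (−1,1), and let ω(u) = (2/π)√(1−u²). For every continuous compactly supported function f : ℝ^n → ℝ, lim_{N→∞} ∫_{ℝ^n} f(t_1,…,t_n) (1/(Nω(u)))^n R^{BT}_{n2}(u+t_1/(Nω(u)),…,u+t_n/(Nω(u))) dt_1⋯dt_n = ∫_{ℝ^n} f(t_1,…,t_n) det[K_sine(t_j,t_k)]_{j,k=1}^n dt_1⋯dt_n. (Sine-kernel universality in the bulk for the bounded trace Gaussian unitary ensemble.) -/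
open MeasureTheory Filter Real Topology

noncomputable section

/-- The β-Vandermonde factor `∏_{j<k} |x_j - x_k|^β`. -/
def vand (β : ℝ) (N : ℕ) (x : Fin N → ℝ) : ℝ :=
  ∏ p ∈ Finset.univ.filter (fun p : Fin N × Fin N => p.1 < p.2), |x p.1 - x p.2| ^ β

/-- `N_β = N + βN(N-1)/2`. -/
def Nbeta (β : ℝ) (N : ℕ) : ℝ := N + β * N * (N - 1) / 2

/-- Surface (Hausdorff) measure on the sphere of radius `r` in Euclidean `ℝ^N`. -/
def sphereMeasure (N : ℕ) (r : ℝ) : Measure (EuclideanSpace ℝ (Fin N)) :=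
  (μH[(N : ℝ) - 1]).restrict (Metric.sphere (0 : EuclideanSpace ℝ (Fin N)) r)

/-- Normalization of the fixed trace ensemble: total `Δ_β`-mass of the sphere of radius `r`. -/
def Zft (β : ℝ) (N : ℕ) (r : ℝ) : ℝ :=
  ∫ x, vand β N x ∂(sphereMeasure N r)

/-- Glue `(x_1,…,x_n)` and `(x_{n+1},…,x_N)` into a vector in `ℝ^N`. -/
def combine (N n : ℕ) (x : Fin n → ℝ) (y : Fin (N - n) → ℝ) : Fin N → ℝ := fun i =>
  if h : (i : ℕ) < n then x ⟨i, h⟩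
  else y ⟨(i : ℕ) - n, by have := i.isLt; omega⟩

/-- `n`-point correlation function of the fixed trace Gaussian β-ensemble of strength `r`. -/
def Rft (β : ℝ) (n N : ℕ) (r : ℝ) (x : Fin n → ℝ) : ℝ :=
  ((N.factorial : ℝ) / ((N - n).factorial : ℝ)) * (Zft β N r)⁻¹ *
    ∫ y, vand β N (combine N n x y)
      ∂(sphereMeasure (N - n) (Real.sqrt (r ^ 2 - ∑ i, x i ^ 2)))

/-- Normalization of the bounded trace ensemble. -/
def Zbt (β : ℝ) (N : ℕ) (r : ℝ) : ℝ :=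
  ∫ x : Fin N → ℝ, Set.indicator {z : Fin N → ℝ | ∑ i, z i ^ 2 ≤ r ^ 2} (vand β N) x

/-- `n`-point correlation function of the bounded trace Gaussian β-ensemble of strength `r`. -/
def Rbt (β : ℝ) (n N : ℕ) (r : ℝ) (x : Fin n → ℝ) : ℝ :=
  ((N.factorial : ℝ) / ((N - n).factorial : ℝ)) * (Zbt β N r)⁻¹ *
    ∫ y : Fin (N - n) → ℝ,
      Set.indicator {z : Fin N → ℝ | ∑ i, z i ^ 2 ≤ r ^ 2} (vand β N) (combine N n x y)

/-- Normalization of the (unconstrained) Gaussian β-ensemble. -/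
def Zg (β : ℝ) (N : ℕ) : ℝ :=
  ∫ x : Fin N → ℝ, vand β N x * ∏ i, Real.exp (-(β * N * x i ^ 2))

/-- `n`-point correlation function of the Gaussian β-ensemble. -/
def Rg (β : ℝ) (n N : ℕ) (x : Fin n → ℝ) : ℝ :=
  ((N.factorial : ℝ) / ((N - n).factorial : ℝ)) * (Zg β N)⁻¹ *
    ∫ y : Fin (N - n) → ℝ,
      vand β N (combine N n x y) * ∏ i, Real.exp (-(β * N * (combine N n x y i) ^ 2))

/-- The sine kernel `sin(π(x-y))/(π(x-y))`, with value `1` on the diagonal. -/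
def Ksine (x y : ℝ) : ℝ :=
  if x = y then 1 else Real.sin (π * (x - y)) / (π * (x - y))

/-- `S(t) = sin(πt)/(πt)` with `S(0) = 1`. -/
def Ssin (t : ℝ) : ℝ := if t = 0 then 1 else Real.sin (π * t) / (π * t)

/-- The 2×2 matrix sine kernel for β = 1. -/
def K1sine (x y : ℝ) : Fin 2 → Fin 2 → ℝ :=
  ![![Ssin (x - y), deriv Ssin (x - y)],
    ![(∫ t in (0:ℝ)..(x - y), Ssin t) - Real.sign (x - y) / 2, Ssin (x - y)]]

/-- The 2×2 matrix sine kernel for β = 4. -/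
def K4sine (x y : ℝ) : Fin 2 → Fin 2 → ℝ :=
  ![![Ssin (2 * (x - y)), deriv (fun z => Ssin (2 * (z - y))) x],
    ![(∫ t in (0:ℝ)..(x - y), Ssin (2 * t)) - Real.sign (2 * (x - y)) / 2,
      Ssin (2 * (x - y))]]

/-- The Airy function `Ai(x) = lim_{T→∞} (1/π) ∫_0^T cos(t³/3 + xt) dt`. -/
def Ai (x : ℝ) : ℝ :=
  limUnder atTop (fun T : ℝ => (1 / π) * ∫ t in (0:ℝ)..T, Real.cos (t ^ 3 / 3 + x * t))

/-- The Airy kernel. -/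
def KAiry (x y : ℝ) : ℝ :=
  if x = y then (deriv Ai x) ^ 2 - x * (Ai x) ^ 2
  else (Ai x * deriv Ai y - deriv Ai x * Ai y) / (x - y)

/-- `C_{Nβ} = Γ(N_β/2)·2^{N_β/2−1}·β^{−N_β/2}`. -/
def Cnb (β : ℝ) (N : ℕ) : ℝ :=
  Real.Gamma (Nbeta β N / 2) * (2 : ℝ) ^ (Nbeta β N / 2 - 1) * β ^ (-(Nbeta β N) / 2)

end

noncomputable section

namespace BTGUE

/-- Monic Hermite polynomials for the weight `exp (-x ^ 2)`. -/
def herm : ℕ → Polynomial ℝ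
  | 0 => 1
  | k + 1 => Polynomial.X * herm k - Polynomial.C (1 / 2) * Polynomial.derivative (herm k)

lemma herm_zero : herm 0 = 1 := rfl

lemma herm_succ (k : ℕ) : herm (k + 1) =
    Polynomial.X * herm k - Polynomial.C (1 / 2) * Polynomial.derivative (herm k) := rfl

lemma derivative_herm_succ (k : ℕ) :
    Polynomial.derivative (herm (k + 1)) = Polynomial.C ((k : ℝ) + 1) * herm k := by
  induction k with
  | zero => simp [herm]
  | succ k ih =>
    rw [herm_succ (k + 1)]
    simp only [Polynomial.derivative_sub, Polynomial.derivative_mul, Polynomial.derivative_X,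
      Polynomial.derivative_C, ih]
    have h2 := herm_succ k
    simp only [map_add, Nat.cast_add, Nat.cast_one, Polynomial.C_1]
    linear_combination (-(Polynomial.C (k : ℝ) + 1)) * h2

lemma herm_monic_natDegree (k : ℕ) : (herm k).Monic ∧ (herm k).natDegree = k := by
  induction k with
  | zero => simp [herm]
  | succ k ih =>
    obtain ⟨hm, hd⟩ := ih
    have hX : (Polynomial.X * herm k).natDegree = k + 1 := by
      rw [Polynomial.natDegree_X_mul hm.ne_zero, hd]
    have hlt : (Polynomial.C (1 / 2 : ℝ) * Polynomial.derivative (herm k)).degree <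
        (Polynomial.X * herm k).degree := by
      rw [Polynomial.degree_C_mul (by norm_num)]
      refine lt_of_le_of_lt (Polynomial.degree_derivative_le) ?_
      rw [Polynomial.degree_mul, Polynomial.degree_X, Polynomial.degree_eq_natDegree hm.ne_zero, hd]
      norm_cast
      omega
    rw [herm_succ]
    constructor
    · exact (Polynomial.monic_X.mul hm).sub_of_left hlt
    · rw [Polynomial.natDegree_sub_eq_left_of_natDegree_lt, hX]
      rw [hX, Polynomial.natDegree_C_mul (by norm_num)]
      exact lt_of_le_of_lt (Polynomial.natDegree_derivative_le _) (by omega)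

/-- Evaluated Hermite differential equation. -/
lemma herm_ode (k : ℕ) (x : ℝ) :
    (Polynomial.derivative (Polynomial.derivative (herm k))).eval x
      - 2 * x * (Polynomial.derivative (herm k)).eval x + 2 * k * (herm k).eval x = 0 := by
  have h := congrArg (Polynomial.eval x) (derivative_herm_succ k)
  rw [herm_succ] at h
  simp only [Polynomial.derivative_sub, Polynomial.derivative_mul, Polynomial.derivative_X,
      Polynomial.derivative_C, Polynomial.eval_sub, Polynomial.eval_add, Polynomial.eval_mul,
      Polynomial.eval_X, Polynomial.eval_C, Polynomial.eval_one, Polynomial.eval_zero] at h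
  linarith

lemma integrable_poly_mul_exp (p : Polynomial ℝ) :
    Integrable (fun x : ℝ => p.eval x * exp (-x ^ 2)) := by
  induction p using Polynomial.induction_on' with
  | add p q hp hq =>
    refine (hp.add hq).congr (ae_of_all _ fun x => ?_)
    simp [add_mul]
  | monomial n a =>
    have h := integrable_rpow_mul_exp_neg_mul_sq (b := 1) one_pos (s := n)
      (by have : (0 : ℝ) ≤ n := n.cast_nonneg
          linarith)
    simpa [mul_assoc] using h.const_mul a

lemma integral_mul_herm_succ (q : Polynomial ℝ) (k : ℕ) :
    ∫ x : ℝ, q.eval x * (herm (k + 1)).eval x * exp (-x ^ 2) =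
      1 / 2 * ∫ x : ℝ, (Polynomial.derivative q).eval x * (herm k).eval x * exp (-x ^ 2) := by
  have hd : ∀ x : ℝ, HasDerivAt (fun x : ℝ => (q * herm k).eval x * exp (-x ^ 2))
      ((Polynomial.derivative q * herm k - 2 * (q * herm (k + 1))).eval x * exp (-x ^ 2)) x := by
    intro x
    have h1 := ((q * herm k).hasDerivAt x).mul (((hasDerivAt_pow 2 x).neg).exp)
    refine h1.congr_deriv ?_
    simp [herm_succ, Polynomial.derivative_mul]
    ring
  have h0 := integral_eq_zero_of_hasDerivAt_of_integrable hd (integrable_poly_mul_exp _)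
    (integrable_poly_mul_exp _)
  have e : ∀ x : ℝ, (Polynomial.derivative q * herm k - 2 * (q * herm (k + 1))).eval x
      * exp (-x ^ 2) = (Polynomial.derivative q * herm k).eval x * exp (-x ^ 2)
        - 2 * ((q * herm (k + 1)).eval x * exp (-x ^ 2)) := by
    intro x; simp; ring
  simp_rw [e] at h0
  rw [integral_sub (integrable_poly_mul_exp _) ((integrable_poly_mul_exp _).const_mul 2),
    integral_const_mul] at h0
  simp only [Polynomial.eval_mul] at h0
  linarith

/-- Squared norms of the monic Hermite polynomials. -/
def hnorm (k : ℕ) : ℝ := √π * k.factorial / 2 ^ k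

lemma hnorm_pos (k : ℕ) : 0 < hnorm k := by
  unfold hnorm; positivity

lemma hnorm_succ (k : ℕ) : hnorm (k + 1) = hnorm k * (k + 1) / 2 := by
  unfold hnorm
  rw [Nat.factorial_succ]; push_cast; field_simp; ring

lemma herm_orthogonal (j k : ℕ) :
    ∫ x : ℝ, (herm j).eval x * (herm k).eval x * exp (-x ^ 2) = if j = k then hnorm k else 0 := by
  induction k generalizing j with
  | zero =>
    cases j with
    | zero =>
      have := integral_gaussian 1
      simp only [neg_mul, one_mul, div_one] at this
      simp [herm, this, hnorm]
    | succ j =>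
      have := integral_mul_herm_succ 1 j
      simp only [Polynomial.derivative_one, Polynomial.eval_zero, zero_mul, integral_zero, mul_zero,
        Polynomial.eval_one, one_mul] at this
      simp only [herm_zero, Polynomial.eval_one, mul_one, this]
      simp
  | succ k ih =>
    rw [integral_mul_herm_succ]
    cases j with
    | zero => simp [herm]
    | succ j =>
      simp only [derivative_herm_succ, Polynomial.eval_mul, Polynomial.eval_C, mul_assoc]
      rw [integral_const_mul]
      have := ih j
      simp only [mul_assoc] at this
      rw [this, hnorm_succ]
      by_cases h : j = k
      · subst h; simp; ring
      · simp [h]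

/-- Orthonormal Hermite functions. -/
def psi (k : ℕ) (x : ℝ) : ℝ := (herm k).eval x * exp (-x ^ 2 / 2) / √(hnorm k)

/-- Derivatives of the orthonormal Hermite functions. -/
def psiD (k : ℕ) (x : ℝ) : ℝ :=
  ((Polynomial.derivative (herm k)).eval x - x * (herm k).eval x) * exp (-x ^ 2 / 2) / √(hnorm k)

lemma psi_mul_psi (j k : ℕ) (x : ℝ) : psi j x * psi k x =
    ((herm j).eval x * (herm k).eval x * exp (-x ^ 2)) * (1 / (√(hnorm j) * √(hnorm k))) := by
  have : exp (-x ^ 2) = exp (-x ^ 2 / 2) * exp (-x ^ 2 / 2) := by rw [← exp_add]; ring_nf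
  rw [psi, psi, this]; ring

lemma integrable_psi_mul_psi (j k : ℕ) : Integrable (fun x => psi j x * psi k x) := by
  simp_rw [psi_mul_psi]
  refine Integrable.mul_const ?_ _
  simpa using integrable_poly_mul_exp (herm j * herm k)

lemma integral_psi_mul_psi (j k : ℕ) : ∫ x, psi j x * psi k x = if j = k then 1 else 0 := by
  simp_rw [psi_mul_psi]
  rw [integral_mul_const, herm_orthogonal]
  split_ifs with h
  · subst h
    rw [Real.mul_self_sqrt (hnorm_pos _).le]
    have := (hnorm_pos j).ne'
    field_simp
  · simp

lemma hasDerivAt_gauss (x : ℝ) :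
    HasDerivAt (fun x : ℝ => exp (-x ^ 2 / 2)) (exp (-x ^ 2 / 2) * (-x)) x := by
  have h := (((hasDerivAt_pow 2 x).neg).div_const 2).exp
  refine h.congr_deriv ?_
  simp; ring

lemma hasDerivAt_psi (k : ℕ) (x : ℝ) : HasDerivAt (psi k) (psiD k x) x := by
  have h := (((herm k).hasDerivAt x).mul (hasDerivAt_gauss x)).div_const (√(hnorm k))
  refine h.congr_deriv ?_
  rw [psiD]; ring

lemma hasDerivAt_psiD (k : ℕ) (x : ℝ) :
    HasDerivAt (psiD k) (-(2 * k + 1 - x ^ 2) * psi k x) x := by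
  have h := ((((Polynomial.derivative (herm k)).hasDerivAt x).sub
    ((hasDerivAt_id x).mul ((herm k).hasDerivAt x))).mul
      (hasDerivAt_gauss x)).div_const (√(hnorm k))
  refine h.congr_deriv ?_
  have := herm_ode k x
  rw [psi]
  simp only [id, Pi.sub_apply, Pi.mul_apply]
  linear_combination (exp (-x ^ 2 / 2) / √(hnorm k)) * this

lemma continuous_psi (k : ℕ) : Continuous (psi k) :=
  continuous_iff_continuousAt.2 fun x => (hasDerivAt_psi k x).continuousAt

/-- The Christoffel–Darboux kernel of the Hermite functions. -/
def kern (N : ℕ) (x y : ℝ) : ℝ := ∑ k ∈ Finset.range N, psi k x * psi k y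

lemma psi_wronskian (N : ℕ) (x y : ℝ) :
    psi N x * psiD N y - psiD N x * psi N y - (x - y) * (psi N x * psi N y) =
      ((herm N).eval x * (Polynomial.derivative (herm N)).eval y
        - (Polynomial.derivative (herm N)).eval x * (herm N).eval y)
        * (exp (-x ^ 2 / 2) * exp (-y ^ 2 / 2)) / hnorm N := by
  have hs : √(hnorm N) ^ 2 = hnorm N := Real.sq_sqrt (hnorm_pos N).le
  have hp : √(hnorm N) ≠ 0 := (Real.sqrt_pos.2 (hnorm_pos N)).ne'
  rw [← hs]
  simp only [psi, psiD]
  field_simp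
  ring

/-- Christoffel–Darboux formula. -/
lemma christoffel_darboux (N : ℕ) (x y : ℝ) : (x - y) * kern N x y =
    (psi N x * psiD N y - psiD N x * psi N y - (x - y) * (psi N x * psi N y)) / 2 := by
  rw [psi_wronskian]
  induction N with
  | zero => simp [kern, herm]
  | succ N ih =>
    have hs : √(hnorm N) ^ 2 = hnorm N := Real.sq_sqrt (hnorm_pos N).le
    have hp : √(hnorm N) ≠ 0 := (Real.sqrt_pos.2 (hnorm_pos N)).ne'
    have hh := (hnorm_pos N).ne'
    have hN : (N : ℝ) + 1 ≠ 0 := by positivity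
    rw [kern, Finset.sum_range_succ, mul_add, ← kern, ih, derivative_herm_succ, hnorm_succ]
    have e : psi N x * psi N y = (herm N).eval x * (herm N).eval y *
        (exp (-x ^ 2 / 2) * exp (-y ^ 2 / 2)) / hnorm N := by
      rw [← hs, psi, psi]; field_simp
    rw [e, herm_succ]
    simp only [Polynomial.eval_sub, Polynomial.eval_mul, Polynomial.eval_X, Polynomial.eval_C]
    field_simp
    ring

lemma tendsto_of_even_odd {α : Type*} {l : Filter α} {a : ℕ → α}
    (h0 : Tendsto (fun m => a (2 * m)) atTop l) (h1 : Tendsto (fun m => a (2 * m + 1)) atTop l) :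
    Tendsto a atTop l := by
  intro s hs
  obtain ⟨M0, hM0⟩ := eventually_atTop.1 (h0.eventually_mem hs)
  obtain ⟨M1, hM1⟩ := eventually_atTop.1 (h1.eventually_mem hs)
  refine mem_map.2 (mem_atTop_sets.2 ⟨2 * (M0 + M1) + 1, fun N hN => ?_⟩)
  obtain ⟨m, rfl | rfl⟩ := N.even_or_odd'
  · exact hM0 m (by omega)
  · exact hM1 m (by omega)

lemma psi_zero_sq (k : ℕ) : psi k 0 ^ 2 = (herm k).eval 0 ^ 2 / hnorm k := by
  rw [psi, div_pow, Real.sq_sqrt (hnorm_pos k).le]; simp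

lemma psi_zero_sq_add_two (k : ℕ) : psi (k + 2) 0 ^ 2 = (k + 1) / (k + 2) * psi k 0 ^ 2 := by
  have h1 : (herm (k + 2)).eval 0 = -(1 / 2) * ((k : ℝ) + 1) * (herm k).eval 0 := by
    rw [show k + 2 = (k + 1) + 1 from rfl, herm_succ (k + 1), derivative_herm_succ]
    simp; ring
  rw [psi_zero_sq, psi_zero_sq, h1, hnorm_succ (k + 1), hnorm_succ k]
  have := (hnorm_pos k).ne'
  push_cast
  have h2 : (k : ℝ) + 1 ≠ 0 := by positivity
  have h3 : (k : ℝ) + 2 ≠ 0 := by positivity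
  have h4 : (k : ℝ) + 1 + 1 ≠ 0 := by positivity
  field_simp
  ring

lemma psiD_zero_sq_succ (k : ℕ) : psiD (k + 1) 0 ^ 2 = 2 * (k + 1) * psi k 0 ^ 2 := by
  rw [psi_zero_sq, psiD, div_pow, Real.sq_sqrt (hnorm_pos _).le, derivative_herm_succ, hnorm_succ]
  have := (hnorm_pos k).ne'
  have h2 : (k : ℝ) + 1 ≠ 0 := by positivity
  simp
  field_simp

lemma psi_odd_zero (m : ℕ) : psi (2 * m + 1) 0 ^ 2 = 0 := by
  induction m with
  | zero => simp [psi, herm]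
  | succ m ih =>
    rw [show 2 * (m + 1) + 1 = (2 * m + 1) + 2 by ring, psi_zero_sq_add_two, ih, mul_zero]

lemma psi_even_zero (m : ℕ) : (psi (2 * m) 0 ^ 2) ^ 2 * (2 * m + 1) = 1 / (π * Wallis.W m) := by
  induction m with
  | zero =>
    simp [psi, herm, hnorm, Wallis.W, Real.sq_sqrt pi_pos.le]
  | succ m ih =>
    have hW := (Wallis.W_pos m).ne'
    have hp := psi_zero_sq_add_two (2 * m)
    rw [Wallis.W_succ, show 2 * (m + 1) = 2 * m + 2 by ring, hp]
    have e : (psi (2 * m) 0 ^ 2) ^ 2 = 1 / (π * Wallis.W m) / (2 * m + 1) := by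
      rw [← ih]; field_simp
    rw [mul_pow, e]
    push_cast
    field_simp
    ring

lemma psiD_even_zero (m : ℕ) : psiD (2 * m) 0 ^ 2 = 0 := by
  cases m with
  | zero => simp [psiD, herm]
  | succ m => rw [show 2 * (m + 1) = (2 * m + 1) + 1 by ring, psiD_zero_sq_succ, psi_odd_zero,
      mul_zero]

/-- WKB amplitude of a solution of `ψ'' = -(q - x²) ψ`. -/
def wkb (q : ℝ) (ψ ψd : ℝ → ℝ) (x : ℝ) : ℝ :=
  √(q - x ^ 2) * ψ x ^ 2 + ψd x ^ 2 / √(q - x ^ 2)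

lemma tendsto_wkb_zero :
    Tendsto (fun N : ℕ => wkb (2 * N + 1) (psi N) (psiD N) 0) atTop (𝓝 (2 / π)) := by
  have hW : Tendsto (fun m => 1 / (π * Wallis.W m)) atTop (𝓝 (1 / (π * (π / 2)))) :=
    tendsto_const_nhds.div (tendsto_const_nhds.mul Wallis.tendsto_W_nhds_pi_div_two) (by positivity)
  have hi : Tendsto (fun m : ℕ => 1 / ((m : ℝ))) atTop (𝓝 0) := tendsto_one_div_atTop_nhds_zero_nat
  have hlim : √(2 * (1 / (π * (π / 2)))) = 2 / π := by
    rw [show 2 * (1 / (π * (π / 2))) = (2 / π) ^ 2 by field_simp]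
    exact Real.sqrt_sq (by positivity)
  have hrat : Tendsto (fun m : ℕ => (4 * (m : ℝ) + 1) / (2 * m + 1)) atTop (𝓝 2) := by
    have h : Tendsto (fun m : ℕ => (4 + 1 / (m : ℝ)) / (2 + 1 / m)) atTop
        (𝓝 ((4 + 0) / (2 + 0))) :=
      (tendsto_const_nhds.add hi).div (tendsto_const_nhds.add hi) (by norm_num)
    rw [show ((4 : ℝ) + 0) / (2 + 0) = 2 by norm_num] at h
    refine h.congr' ?_
    filter_upwards [eventually_gt_atTop 0] with m hm
    have : (m : ℝ) ≠ 0 := by positivity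
    field_simp
  have hrat' : Tendsto (fun m : ℕ => 4 * (2 * (m : ℝ) + 1) / (4 * m + 3)) atTop (𝓝 2) := by
    have h : Tendsto (fun m : ℕ => 4 * (2 + 1 / (m : ℝ)) / (4 + 3 * (1 / m))) atTop
        (𝓝 (4 * (2 + 0) / (4 + 3 * 0))) :=
      (tendsto_const_nhds.mul (tendsto_const_nhds.add hi)).div
        (tendsto_const_nhds.add (tendsto_const_nhds.mul hi)) (by norm_num)
    rw [show (4 : ℝ) * (2 + 0) / (4 + 3 * 0) = 2 by norm_num] at h
    refine h.congr' ?_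
    filter_upwards [eventually_gt_atTop 0] with m hm
    have : (m : ℝ) ≠ 0 := by positivity
    field_simp
  apply tendsto_of_even_odd
  · have h := (hrat.mul hW).sqrt
    rw [hlim] at h
    refine h.congr fun m => ?_
    rw [wkb, psiD_even_zero, ← psi_even_zero]
    rw [show (4 * (m : ℝ) + 1) / (2 * m + 1) * ((psi (2 * m) 0 ^ 2) ^ 2 * (2 * m + 1)) =
      (4 * m + 1) * (psi (2 * m) 0 ^ 2) ^ 2 by field_simp, Real.sqrt_mul (by positivity),
      Real.sqrt_sq (by positivity)]
    push_cast
    ring_nf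
  · have h := (hrat'.mul hW).sqrt
    rw [hlim] at h
    refine h.congr fun m => ?_
    rw [wkb, psi_odd_zero, psiD_zero_sq_succ, ← psi_even_zero]
    have e : 4 * (2 * (m : ℝ) + 1) / (4 * m + 3) * ((psi (2 * m) 0 ^ 2) ^ 2 * (2 * m + 1)) =
      ((2 * (2 * m + 1) * psi (2 * m) 0 ^ 2)) ^ 2 / (4 * m + 3) := by field_simp; ring
    rw [e, Real.sqrt_div (by positivity), Real.sqrt_sq (by positivity)]
    push_cast
    rw [show 2 * (2 * (m : ℝ) + 1) + 1 - 0 ^ 2 = 4 * m + 3 by ring]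
    ring

section ODE

variable {q : ℝ} {ψ ψd : ℝ → ℝ}

lemma abs_mul_le_wkb {x : ℝ} (hx : 0 < q - x ^ 2) : |ψ x * ψd x| ≤ wkb q ψ ψd x / 2 := by
  have hS : 0 < √(q - x ^ 2) := Real.sqrt_pos.2 hx
  have h := sq_nonneg (√(q - x ^ 2) * |ψ x| - |ψd x|)
  rw [wkb, abs_mul, ← sq_abs (ψ x), ← sq_abs (ψd x)]
  have e : √(q - x ^ 2) * |ψ x| ^ 2 + |ψd x| ^ 2 / √(q - x ^ 2) - 2 * (|ψ x| * |ψd x|) =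
      (√(q - x ^ 2) * |ψ x| - |ψd x|) ^ 2 / √(q - x ^ 2) := by field_simp; ring
  have := div_nonneg h hS.le
  linarith

/-- The corrected amplitude, whose derivative is of lower order. -/
lemma hasDerivAt_corrected (h1 : ∀ x, HasDerivAt ψ (ψd x) x)
    (h2 : ∀ x, HasDerivAt ψd (-(q - x ^ 2) * ψ x) x) {x : ℝ} (hx : 0 < q - x ^ 2) :
    HasDerivAt (fun x => wkb q ψ ψd x - x * (ψ x * ψd x) / √(q - x ^ 2) ^ 3)
      (-(1 / √(q - x ^ 2) ^ 3 + 3 * x ^ 2 / √(q - x ^ 2) ^ 5) * (ψ x * ψd x)) x := by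
  have hS : 0 < √(q - x ^ 2) := Real.sqrt_pos.2 hx
  have hSq : √(q - x ^ 2) ^ 2 = q - x ^ 2 := Real.sq_sqrt hx.le
  have dS : HasDerivAt (fun x => √(q - x ^ 2)) (-x / √(q - x ^ 2)) x := by
    have := (((hasDerivAt_pow 2 x).const_sub q)).sqrt hx.ne'
    refine this.congr_deriv ?_
    simp; field_simp
  have d1 := (dS.mul ((h1 x).pow 2)).add (((h2 x).pow 2).div dS hS.ne')
  have d2 := (((hasDerivAt_id x).mul ((h1 x).mul (h2 x))).div (dS.pow 3) (pow_pos hS 3).ne')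
  refine (d1.sub d2).congr_deriv ?_
  have hS0 := hS.ne'
  simp only [id, Pi.mul_apply, Pi.pow_apply]
  generalize √(q - x ^ 2) = S at *
  rw [← hSq]
  simp
  field_simp
  ring

lemma wkb_nonneg (x : ℝ) : 0 ≤ wkb q ψ ψd x := by
  unfold wkb; positivity

/-- The WKB amplitude is almost constant in the bulk (right half). -/
lemma wkb_sub_le_of_nonneg (h1 : ∀ x, HasDerivAt ψ (ψd x) x)
    (h2 : ∀ x, HasDerivAt ψd (-(q - x ^ 2) * ψ x) x) {κ : ℝ} (hκ : 0 < κ) (hκ1 : κ ≤ 1)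
    (hq : 8 / κ ^ 5 ≤ q) {x : ℝ} (hx0 : 0 ≤ x) (hx : κ ^ 2 * q ≤ q - x ^ 2) :
    |wkb q ψ ψd x - wkb q ψ ψd 0| ≤ 10 / (κ ^ 5 * q) * wkb q ψ ψd 0 := by
  have hq0 : 0 < q := lt_of_lt_of_le (by positivity) hq
  obtain ⟨r, hr, rfl⟩ : ∃ r : ℝ, 0 < r ∧ r ^ 2 = q :=
    ⟨√q, Real.sqrt_pos.2 hq0, Real.sq_sqrt hq0.le⟩
  set J : ℝ → ℝ := fun y => wkb (r ^ 2) ψ ψd y - y * (ψ y * ψd y) / √(r ^ 2 - y ^ 2) ^ 3 with hJ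
  set e : ℝ := 1 / (κ ^ 5 * r ^ 2) with he
  have he0 : 0 < e := by positivity
  have he8 : e ≤ 1 / 8 := by
    rw [he, div_le_div_iff₀ (by positivity) (by norm_num)]
    rw [div_le_iff₀ (by positivity)] at hq
    linarith
  have hS : ∀ y ∈ Set.Icc 0 x, 0 < r ^ 2 - y ^ 2 ∧ κ * r ≤ √(r ^ 2 - y ^ 2) ∧ y ≤ r := by
    intro y hy
    have hyx : y ^ 2 ≤ x ^ 2 := pow_le_pow_left₀ hy.1 hy.2 2
    have hpos : 0 < κ ^ 2 * r ^ 2 := by positivity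
    refine ⟨by linarith, Real.le_sqrt_of_sq_le (by rw [mul_pow]; linarith), ?_⟩
    exact le_of_sq_le_sq (by linarith) hr.le |> fun h => h
  have hS3 : ∀ y ∈ Set.Icc 0 x, y / √(r ^ 2 - y ^ 2) ^ 3 ≤ e := by
    intro y hy
    obtain ⟨-, hb, hc⟩ := hS y hy
    have : (κ * r) ^ 3 ≤ √(r ^ 2 - y ^ 2) ^ 3 := pow_le_pow_left₀ (by positivity) hb 3
    calc y / √(r ^ 2 - y ^ 2) ^ 3 ≤ r / (κ * r) ^ 3 := by gcongr
      _ = 1 / (κ ^ 3 * r ^ 2) := by field_simp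
      _ ≤ e := by
        rw [he]
        have : κ ^ 5 ≤ κ ^ 3 := pow_le_pow_of_le_one hκ.le hκ1 (by norm_num)
        gcongr
  have hJI : ∀ y ∈ Set.Icc 0 x, |wkb (r ^ 2) ψ ψd y - J y| ≤ e / 2 * wkb (r ^ 2) ψ ψd y := by
    intro y hy
    obtain ⟨ha, hb, hc⟩ := hS y hy
    have hm := abs_mul_le_wkb (ψ := ψ) (ψd := ψd) ha
    have : wkb (r ^ 2) ψ ψd y - J y = y / √(r ^ 2 - y ^ 2) ^ 3 * (ψ y * ψd y) := by
      simp only [hJ]; ring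
    rw [this, abs_mul, abs_of_nonneg (div_nonneg hy.1 (by positivity))]
    calc _ ≤ e * (wkb (r ^ 2) ψ ψd y / 2) := mul_le_mul (hS3 y hy) hm (abs_nonneg _) he0.le
      _ = _ := by ring
  have hIJ : ∀ y ∈ Set.Icc 0 x, wkb (r ^ 2) ψ ψd y ≤ 2 * J y := by
    intro y hy
    have h := (abs_le.1 (hJI y hy)).2
    have := wkb_nonneg (q := r ^ 2) (ψ := ψ) (ψd := ψd) y
    nlinarith
  have hJ0 : J 0 = wkb (r ^ 2) ψ ψd 0 := by simp [hJ]
  have hI0 := wkb_nonneg (q := r ^ 2) (ψ := ψ) (ψd := ψd) 0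
  have hJd : ∀ y ∈ Set.Icc 0 x, HasDerivAt J
      (-(1 / √(r ^ 2 - y ^ 2) ^ 3 + 3 * y ^ 2 / √(r ^ 2 - y ^ 2) ^ 5) * (ψ y * ψd y)) y :=
    fun y hy => hasDerivAt_corrected h1 h2 (hS y hy).1
  have hJnn : ∀ y ∈ Set.Icc 0 x, 0 ≤ J y := fun y hy => by
    have := hIJ y hy
    have := wkb_nonneg (q := r ^ 2) (ψ := ψ) (ψd := ψd) y
    linarith
  have hbound : ∀ y ∈ Set.Icc 0 x,
      |-(1 / √(r ^ 2 - y ^ 2) ^ 3 + 3 * y ^ 2 / √(r ^ 2 - y ^ 2) ^ 5) * (ψ y * ψd y)| ≤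
        4 * e / r * J y := by
    intro y hy
    obtain ⟨ha, hb, hc⟩ := hS y hy
    have hm := abs_mul_le_wkb (ψ := ψ) (ψd := ψd) ha
    have h3 : (κ * r) ^ 3 ≤ √(r ^ 2 - y ^ 2) ^ 3 := pow_le_pow_left₀ (by positivity) hb 3
    have h5 : (κ * r) ^ 5 ≤ √(r ^ 2 - y ^ 2) ^ 5 := pow_le_pow_left₀ (by positivity) hb 5
    have hc2 : y ^ 2 ≤ r ^ 2 := pow_le_pow_left₀ hy.1 hc 2
    have hk : κ ^ 5 ≤ κ ^ 3 := pow_le_pow_of_le_one hκ.le hκ1 (by norm_num)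
    rw [abs_mul, abs_neg, abs_of_nonneg (by positivity)]
    have hc1 : 1 / √(r ^ 2 - y ^ 2) ^ 3 + 3 * y ^ 2 / √(r ^ 2 - y ^ 2) ^ 5 ≤ 4 * e / r := by
      calc _ ≤ 1 / (κ * r) ^ 3 + 3 * r ^ 2 / (κ * r) ^ 5 := by gcongr
        _ = 1 / (κ ^ 3 * r ^ 3) + 3 / (κ ^ 5 * r ^ 3) := by field_simp
        _ ≤ 1 / (κ ^ 5 * r ^ 3) + 3 / (κ ^ 5 * r ^ 3) := by gcongr
        _ = 4 * e / r := by rw [he]; field_simp; norm_num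
    refine mul_le_mul hc1 (hm.trans ?_) (abs_nonneg _) (by positivity)
    have := hIJ y hy
    linarith
  have hcont : ContinuousOn J (Set.Icc 0 x) :=
    fun y hy => (hJd y hy).continuousAt.continuousWithinAt
  have hx1 : x ≤ r := (hS x ⟨hx0, le_rfl⟩).2.2
  have hgron : ∀ y ∈ Set.Icc 0 x, J y ≤ 2 * J 0 := by
    intro y hy
    have := norm_le_gronwallBound_of_norm_deriv_right_le (f := J) (δ := J 0) (K := 4 * e / r)
      (ε := 0) hcont (fun z hz => (hJd z ⟨hz.1, hz.2.le⟩).hasDerivWithinAt)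
      (by rw [Real.norm_eq_abs, abs_of_nonneg (hJ0 ▸ hI0)])
      (fun z hz => by
        rw [Real.norm_eq_abs, Real.norm_eq_abs, add_zero,
          abs_of_nonneg (hJnn z ⟨hz.1, hz.2.le⟩)]
        exact hbound z ⟨hz.1, hz.2.le⟩) y hy
    rw [gronwallBound_ε0, Real.norm_eq_abs, abs_of_nonneg (hJnn y hy), sub_zero] at this
    have hle : 4 * e / r * y ≤ 1 / 2 := by
      calc 4 * e / r * y ≤ 4 * e / r * r := by gcongr; exact hy.2.trans hx1
        _ = 4 * e := by field_simp
        _ ≤ 1 / 2 := by linarith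
    have hexp : exp (4 * e / r * y) ≤ 2 := by
      calc _ ≤ exp (1 / 2) := exp_le_exp.2 hle
        _ ≤ 2 := by
          have h1 : exp (1 / 2) ^ 2 = exp 1 := by rw [← exp_nat_mul]; norm_num
          have h2 := exp_one_lt_d9
          nlinarith [exp_pos (1 / 2)]
    calc J y ≤ _ := this
      _ ≤ J 0 * 2 := by gcongr; rw [hJ0]; exact hI0
      _ = _ := by ring
  have hmv : |J x - J 0| ≤ 8 * e * J 0 := by
    have := (convex_Icc 0 x).norm_image_sub_le_of_norm_hasDerivWithin_le (f := J)
      (C := 4 * e / r * (2 * J 0)) (fun z hz => (hJd z hz).hasDerivWithinAt)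
      (fun z hz => (hbound z hz).trans (by gcongr; exact hgron z hz))
      (Set.left_mem_Icc.2 hx0) (Set.right_mem_Icc.2 hx0)
    simp only [Real.norm_eq_abs, sub_zero, abs_of_nonneg hx0] at this
    calc _ ≤ _ := this
      _ ≤ 4 * e / r * (2 * J 0) * r := by
        gcongr
        rw [hJ0]; positivity
      _ = _ := by field_simp; ring
  have hxI := Set.right_mem_Icc.2 hx0
  have e1 := hJI x hxI
  have e2 := hIJ x hxI
  have e3 := hgron x hxI
  rw [hJ0] at hmv e3
  calc _ = |(wkb (r ^ 2) ψ ψd x - J x) + (J x - wkb (r ^ 2) ψ ψd 0)| := by ring_nf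
    _ ≤ _ := abs_add_le _ _
    _ ≤ e / 2 * (4 * wkb (r ^ 2) ψ ψd 0) + 8 * e * wkb (r ^ 2) ψ ψd 0 := by
      refine add_le_add (e1.trans ?_) hmv
      gcongr
      linarith
    _ = _ := by rw [he]; field_simp; ring

/-- The WKB amplitude is almost constant in the bulk. -/
lemma wkb_sub_le (h1 : ∀ x, HasDerivAt ψ (ψd x) x)
    (h2 : ∀ x, HasDerivAt ψd (-(q - x ^ 2) * ψ x) x) {κ : ℝ} (hκ : 0 < κ) (hκ1 : κ ≤ 1)
    (hq : 8 / κ ^ 5 ≤ q) {x : ℝ} (hx : κ ^ 2 * q ≤ q - x ^ 2) :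
    |wkb q ψ ψd x - wkb q ψ ψd 0| ≤ 10 / (κ ^ 5 * q) * wkb q ψ ψd 0 := by
  rcases le_total 0 x with h0 | h0
  · exact wkb_sub_le_of_nonneg h1 h2 hκ hκ1 hq h0 hx
  · have d1 : ∀ x, HasDerivAt (fun x => ψ (-x)) (-ψd (-x)) x := fun x => by
      have := HasDerivAt.scomp x (h1 (-x)) (hasDerivAt_neg x)
      simpa [Function.comp_def] using this
    have d2 : ∀ x, HasDerivAt (fun x => -ψd (-x)) (-(q - x ^ 2) * ψ (-x)) x := fun x => by
      have := (HasDerivAt.scomp x (h2 (-x)) (hasDerivAt_neg x)).neg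
      refine this.congr_deriv ?_
      simp
    have := wkb_sub_le_of_nonneg d1 d2 hκ hκ1 hq (x := -x) (by linarith) (by simpa using hx)
    simpa [wkb] using this

/-- Comparison of the Wronskian kernel of a solution with a sine. -/
lemma wronskian_sub_sin_le (h1 : ∀ x, HasDerivAt ψ (ψd x) x)
    (h2 : ∀ x, HasDerivAt ψd (-(q - x ^ 2) * ψ x) x) {κ M : ℝ} (hκ : 0 < κ) (hκ1 : κ ≤ 1)
    (hq : 0 < q) (hM : ∀ x, κ ^ 2 * q ≤ q - x ^ 2 → wkb q ψ ψd x ≤ M)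
    {x y : ℝ} (hx : κ ^ 2 * q ≤ q - x ^ 2) (hy : κ ^ 2 * q ≤ q - y ^ 2) :
    |ψ x * ψd y - ψd x * ψ y - wkb q ψ ψd y * sin (√(q - y ^ 2) * (x - y))| ≤
        4 * M / κ ^ 2 * |x - y| ^ 2 + 2 * M / (κ ^ 2 * √q) * |x - y| ∧
    |ψ x * ψd y - ψd x * ψ y| ≤ 2 * M / κ * √q * |x - y| := by
  obtain ⟨r, hr, rfl⟩ : ∃ r : ℝ, 0 < r ∧ r ^ 2 = q :=
    ⟨√q, Real.sqrt_pos.2 hq, Real.sq_sqrt hq.le⟩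
  rw [Real.sqrt_sq hr.le]
  have hb : ∀ s, κ ^ 2 * r ^ 2 ≤ r ^ 2 - s ^ 2 → 0 < r ^ 2 - s ^ 2 ∧ κ * r ≤ √(r ^ 2 - s ^ 2) ∧
      √(r ^ 2 - s ^ 2) ≤ r ∧ |s| ≤ r := by
    intro s hs
    have hpos : 0 < κ ^ 2 * r ^ 2 := by positivity
    refine ⟨by linarith, Real.le_sqrt_of_sq_le (by rw [mul_pow]; linarith), ?_, ?_⟩
    · rw [Real.sqrt_le_left hr.le]; nlinarith [sq_nonneg s]
    · exact abs_le_of_sq_le_sq (by linarith) hr.le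
  have hM0 : 0 ≤ M := (wkb_nonneg x).trans (hM x hx)
  have hψ : ∀ s, κ ^ 2 * r ^ 2 ≤ r ^ 2 - s ^ 2 → ψ s ^ 2 ≤ M / (κ * r) ∧ ψd s ^ 2 ≤ M * r := by
    intro s hs
    obtain ⟨ha, hb, hc, -⟩ := hb s hs
    have hSp : 0 < √(r ^ 2 - s ^ 2) := Real.sqrt_pos.2 ha
    have hm := hM s hs
    rw [wkb] at hm
    have p1 : 0 ≤ √(r ^ 2 - s ^ 2) * ψ s ^ 2 := by positivity
    have p2 : 0 ≤ ψd s ^ 2 / √(r ^ 2 - s ^ 2) := by positivity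
    constructor
    · rw [le_div_iff₀ (by positivity)]
      nlinarith [sq_nonneg (ψ s)]
    · have : ψd s ^ 2 / √(r ^ 2 - s ^ 2) ≤ M := by linarith
      rw [div_le_iff₀ hSp] at this
      nlinarith
  have hseg : ∀ s ∈ Set.uIcc y x, κ ^ 2 * r ^ 2 ≤ r ^ 2 - s ^ 2 := by
    intro s hs
    have : s ^ 2 ≤ max (x ^ 2) (y ^ 2) := by
      rcases Set.mem_uIcc.1 hs with h | h
      · rcases le_total 0 s with h0 | h0
        · exact le_max_of_le_left (by nlinarith)
        · exact le_max_of_le_right (by nlinarith)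
      · rcases le_total 0 s with h0 | h0
        · exact le_max_of_le_right (by nlinarith)
        · exact le_max_of_le_left (by nlinarith)
    rcases le_max_iff.1 this with h | h <;> linarith
  set g : ℝ → ℝ := fun s => ψ s * ψd y - ψd s * ψ y with hg
  set g' : ℝ → ℝ := fun s => ψd s * ψd y + (r ^ 2 - s ^ 2) * ψ s * ψ y with hg'
  have dg : ∀ s, HasDerivAt g (g' s) s := fun s => by
    refine (((h1 s).mul_const (ψd y)).sub ((h2 s).mul_const (ψ y))).congr_deriv ?_
    simp only [hg']; ring
  have hyI : y ∈ Set.uIcc y x := Set.left_mem_uIcc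
  have hxI : x ∈ Set.uIcc y x := Set.right_mem_uIcc
  have hsy : ∀ s ∈ Set.uIcc y x, |s - y| ≤ |x - y| := fun s hs => by
    simpa [abs_sub_comm] using Set.abs_sub_left_of_mem_uIcc hs
  have hgb : ∀ s ∈ Set.uIcc y x, |g s| ≤ 2 * M / κ := by
    intro s hs
    obtain ⟨a1, a2⟩ := hψ s (hseg s hs)
    obtain ⟨b1, b2⟩ := hψ y hy
    have key : ∀ a b : ℝ, a ^ 2 ≤ M / (κ * r) → b ^ 2 ≤ M * r → |a * b| ≤ M / κ := by
      intro a b ha hb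
      have : (a * b) ^ 2 ≤ (M / κ) ^ 2 := by
        calc (a * b) ^ 2 = a ^ 2 * b ^ 2 := by ring
          _ ≤ M / (κ * r) * (M * r) := by gcongr
          _ = M ^ 2 / κ := by field_simp
          _ ≤ M ^ 2 / κ ^ 2 := by
            have : κ ^ 2 ≤ κ := by nlinarith
            gcongr
          _ = _ := by ring
      exact abs_le_of_sq_le_sq this (by positivity)
    have k1 := key _ _ a1 b2
    have k2 := key _ _ b1 a2
    calc |g s| ≤ |ψ s * ψd y| + |ψd s * ψ y| := abs_sub _ _
      _ ≤ M / κ + M / κ := add_le_add k1 (by rwa [mul_comm])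
      _ = _ := by ring
  have hg'b : ∀ s ∈ Set.uIcc y x, |g' s| ≤ 2 * M / κ * r := by
    intro s hs
    obtain ⟨a1, a2⟩ := hψ s (hseg s hs)
    obtain ⟨b1, b2⟩ := hψ y hy
    have c1 := (hb s (hseg s hs)).1
    have k1 : |ψd s * ψd y| ≤ M * r := by
      apply abs_le_of_sq_le_sq _ (by positivity)
      calc (ψd s * ψd y) ^ 2 = ψd s ^ 2 * ψd y ^ 2 := by ring
        _ ≤ (M * r) * (M * r) := by gcongr
        _ = _ := by ring
    have k2 : |ψ s * ψ y| ≤ M / (κ * r) := by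
      apply abs_le_of_sq_le_sq _ (by positivity)
      calc (ψ s * ψ y) ^ 2 = ψ s ^ 2 * ψ y ^ 2 := by ring
        _ ≤ (M / (κ * r)) * (M / (κ * r)) := by gcongr
        _ = _ := by ring
    calc |g' s| ≤ |ψd s * ψd y| + |(r ^ 2 - s ^ 2) * ψ s * ψ y| := abs_add_le _ _
      _ = |ψd s * ψd y| + (r ^ 2 - s ^ 2) * |ψ s * ψ y| := by
        rw [mul_assoc, abs_mul (r ^ 2 - s ^ 2), abs_of_pos c1]
      _ ≤ M * r + r ^ 2 * (M / (κ * r)) := by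
        gcongr
        nlinarith [sq_nonneg s]
      _ = M * r + M * r / κ := by field_simp
      _ ≤ M * r / κ + M * r / κ := by
        gcongr
        rw [le_div_iff₀ hκ]
        have : 0 ≤ M * r := by positivity
        nlinarith
      _ = _ := by ring
  have hgy : g y = 0 := by simp only [hg]; ring
  obtain ⟨hy0, hσl, hσu, -⟩ := hb y hy
  set σ := √(r ^ 2 - y ^ 2) with hσ
  have hσp : 0 < σ := Real.sqrt_pos.2 hy0
  have hσ2 : σ ^ 2 = r ^ 2 - y ^ 2 := Real.sq_sqrt hy0.le
  constructor
  · set F : ℝ → ℝ := fun s => g' s * (sin (σ * (x - s)) / σ) + g s * cos (σ * (x - s)) with hF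
    have dlin : ∀ s, HasDerivAt (fun s => σ * (x - s)) (-σ) s := fun s => by
      simpa using ((hasDerivAt_id s).const_sub x).const_mul σ
    have dg2 : ∀ s, HasDerivAt g' (-(r ^ 2 - s ^ 2) * g s - 2 * s * ψ s * ψ y) s := fun s => by
      refine (((h2 s).mul_const (ψd y)).add
        (((((hasDerivAt_pow 2 s).const_sub (r ^ 2)).mul (h1 s))).mul_const (ψ y))).congr_deriv ?_
      simp only [hg]
      simp
      ring
    have dF : ∀ s, HasDerivAt F
        (((s ^ 2 - y ^ 2) * g s - 2 * s * (ψ s * ψ y)) * (sin (σ * (x - s)) / σ)) s := fun s => by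
      refine (((dg2 s).mul ((dlin s).sin.div_const σ)).add ((dg s).mul (dlin s).cos)).congr_deriv ?_
      rw [show r ^ 2 - s ^ 2 = σ ^ 2 - (s ^ 2 - y ^ 2) by rw [hσ2]; ring]
      field_simp
      ring
    have hFb : ∀ s ∈ Set.uIcc y x,
        ‖((s ^ 2 - y ^ 2) * g s - 2 * s * (ψ s * ψ y)) * (sin (σ * (x - s)) / σ)‖ ≤
          4 * M / κ ^ 2 * |x - y| + 2 * M / (κ ^ 2 * r) := by
      intro s hs
      have hsr := (hb s (hseg s hs)).2.2.2
      have hyr := (hb y hy).2.2.2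
      obtain ⟨a1, a2⟩ := hψ s (hseg s hs)
      obtain ⟨b1, b2⟩ := hψ y hy
      have k2 : |ψ s * ψ y| ≤ M / (κ * r) := by
        apply abs_le_of_sq_le_sq _ (by positivity)
        calc (ψ s * ψ y) ^ 2 = ψ s ^ 2 * ψ y ^ 2 := by ring
          _ ≤ (M / (κ * r)) * (M / (κ * r)) := by gcongr
          _ = _ := by ring
      have c1 : |s ^ 2 - y ^ 2| ≤ 2 * r * |x - y| := by
        rw [show s ^ 2 - y ^ 2 = (s + y) * (s - y) by ring, abs_mul]
        have := abs_add_le s y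
        exact mul_le_mul (by linarith) (hsy s hs) (abs_nonneg _) (by positivity)
      have c2 : |(s ^ 2 - y ^ 2) * g s - 2 * s * (ψ s * ψ y)| ≤
          2 * r * |x - y| * (2 * M / κ) + 2 * r * (M / (κ * r)) := by
        refine (abs_sub _ _).trans (add_le_add ?_ ?_)
        · rw [abs_mul]
          exact mul_le_mul c1 (hgb s hs) (abs_nonneg _) (by positivity)
        · rw [abs_mul, abs_mul, abs_two]
          gcongr
      have c3 : |sin (σ * (x - s)) / σ| ≤ 1 / (κ * r) := by
        rw [abs_div, abs_of_pos hσp]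
        exact div_le_div₀ zero_le_one (abs_sin_le_one _) (by positivity) hσl
      rw [Real.norm_eq_abs, abs_mul]
      calc _ ≤ (2 * r * |x - y| * (2 * M / κ) + 2 * r * (M / (κ * r))) * (1 / (κ * r)) :=
            mul_le_mul c2 c3 (abs_nonneg _) (by positivity)
        _ = _ := by field_simp; ring
    have := (convex_uIcc y x).norm_image_sub_le_of_norm_hasDerivWithin_le (f := F)
      (fun z hz => (dF z).hasDerivWithinAt) hFb hyI hxI
    have hFx : F x = g x := by simp [hF]
    have hFy : F y = wkb (r ^ 2) ψ ψd y * sin (σ * (x - y)) := by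
      simp only [hF, hgy, hg', wkb, ← hσ]
      rw [← hσ2]
      field_simp
      ring
    rw [hFx, hFy] at this
    refine this.trans (le_of_eq ?_)
    rw [Real.norm_eq_abs]
    ring
  · have := (convex_uIcc y x).norm_image_sub_le_of_norm_hasDerivWithin_le (f := g)
      (C := 2 * M / κ * r) (fun z hz => (dg z).hasDerivWithinAt) hg'b hyI hxI
    rw [hgy, sub_zero] at this
    exact this

end ODE

/-- Confluent Christoffel–Darboux formula. -/
lemma kern_self (N : ℕ) (y : ℝ) : kern N y y =
    (psiD N y ^ 2 + (2 * N + 1 - y ^ 2) * psi N y ^ 2 - psi N y ^ 2) / 2 := by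
  have hk : HasDerivAt (fun x => (x - y) * kern N x y) (kern N y y) y := by
    have h1 : HasDerivAt (fun x => kern N x y)
        (∑ k ∈ Finset.range N, psiD k y * psi k y) y :=
      HasDerivAt.fun_sum fun k _ => (hasDerivAt_psi k y).mul_const _
    refine (((hasDerivAt_id y).sub_const y).mul h1).congr_deriv ?_
    simp
  have hw : HasDerivAt (fun x => (psi N x * psiD N y - psiD N x * psi N y
      - (x - y) * (psi N x * psi N y)) / 2)
      ((psiD N y ^ 2 + (2 * N + 1 - y ^ 2) * psi N y ^ 2 - psi N y ^ 2) / 2) y := by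
    refine (((((hasDerivAt_psi N y).mul_const (psiD N y)).sub
      ((hasDerivAt_psiD N y).mul_const (psi N y))).sub
      (((hasDerivAt_id y).sub_const y).mul
        ((hasDerivAt_psi N y).mul_const (psi N y)))).div_const 2).congr_deriv ?_
    simp
    ring
  exact hk.unique (hw.congr_of_eventuallyEq
    (Eventually.of_forall fun x => christoffel_darboux N x y))

lemma kern_self_eq_wkb (N : ℕ) {y : ℝ} (hy : 0 < 2 * (N : ℝ) + 1 - y ^ 2) : kern N y y =
    (√(2 * N + 1 - y ^ 2) * wkb (2 * N + 1) (psi N) (psiD N) y - psi N y ^ 2) / 2 := by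
  have hS : 0 < √(2 * (N : ℝ) + 1 - y ^ 2) := Real.sqrt_pos.2 hy
  rw [kern_self, wkb]
  have := Real.sq_sqrt hy.le
  congr 2
  field_simp
  rw [← this]
  simp only [Real.sq_sqrt hy.le]
  ring

lemma kern_self_nonneg (N : ℕ) (x : ℝ) : 0 ≤ kern N x x :=
  Finset.sum_nonneg fun _ _ => mul_self_nonneg _

lemma kern_sq_le (N : ℕ) (x y : ℝ) : kern N x y ^ 2 ≤ kern N x x * kern N y y := by
  have := Finset.sum_mul_sq_le_sq_mul_sq (Finset.range N) (fun k => psi k x) (fun k => psi k y)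
  simpa [kern, sq] using this

lemma continuous_kern (N : ℕ) : Continuous fun p : ℝ × ℝ => kern N p.1 p.2 :=
  continuous_finsetSum _ fun k _ =>
    ((continuous_psi k).comp continuous_fst).mul ((continuous_psi k).comp continuous_snd)

lemma eventually_wkb_sub_le {κ : ℝ} (hκ : 0 < κ) (hκ1 : κ ≤ 1) {ε : ℝ} (hε : 0 < ε) :
    ∀ᶠ N : ℕ in atTop, ∀ x : ℝ, κ ^ 2 * (2 * N + 1) ≤ 2 * N + 1 - x ^ 2 →
      |wkb (2 * N + 1) (psi N) (psiD N) x - 2 / π| ≤ ε := by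
  have hq : Tendsto (fun N : ℕ => 2 * (N : ℝ) + 1) atTop atTop :=
    tendsto_atTop_add_const_right _ _ (tendsto_natCast_atTop_atTop.const_mul_atTop two_pos)
  have h0 : Tendsto (fun N : ℕ => 10 / (κ ^ 5 * (2 * N + 1)) *
      wkb (2 * N + 1) (psi N) (psiD N) 0 + |wkb (2 * N + 1) (psi N) (psiD N) 0 - 2 / π|) atTop
      (𝓝 (0 * (2 / π) + |2 / π - 2 / π|)) :=
    ((tendsto_const_nhds.div_atTop (hq.const_mul_atTop (by positivity))).mul
      tendsto_wkb_zero).add (tendsto_wkb_zero.sub_const _).abs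
  simp only [zero_mul, sub_self, abs_zero, add_zero] at h0
  filter_upwards [h0.eventually_le_const hε, hq.eventually_ge_atTop (8 / κ ^ 5)] with N h1 h2 x hx
  have := wkb_sub_le (hasDerivAt_psi N) (hasDerivAt_psiD N) hκ hκ1 h2 hx
  calc _ = |(wkb (2 * N + 1) (psi N) (psiD N) x - wkb (2 * N + 1) (psi N) (psiD N) 0)
      + (wkb (2 * N + 1) (psi N) (psiD N) 0 - 2 / π)| := by ring_nf
    _ ≤ _ := abs_add_le _ _
    _ ≤ _ := by linarith

lemma tendsto_two_mul_add_one : Tendsto (fun N : ℕ => 2 * (N : ℝ) + 1) atTop atTop :=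
  tendsto_atTop_add_const_right _ _ (tendsto_natCast_atTop_atTop.const_mul_atTop two_pos)

section Limit

variable {κ : ℝ} {a y : ℕ → ℝ}

lemma tendsto_wkb (hκ : 0 < κ) (hκ1 : κ ≤ 1)
    (hy : ∀ᶠ N : ℕ in atTop, κ ^ 2 * (2 * N + 1) ≤ 2 * N + 1 - y N ^ 2) :
    Tendsto (fun N : ℕ => wkb (2 * N + 1) (psi N) (psiD N) (y N)) atTop (𝓝 (2 / π)) := by
  rw [Metric.tendsto_nhds]
  intro ε hε
  filter_upwards [hy, eventually_wkb_sub_le hκ hκ1 (half_pos hε)] with N h1 h2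
  rw [Real.dist_eq]
  linarith [h2 _ h1]

lemma tendsto_bulk_atTop (hκ : 0 < κ)
    (hy : ∀ᶠ N : ℕ in atTop, κ ^ 2 * (2 * N + 1) ≤ 2 * N + 1 - y N ^ 2) :
    Tendsto (fun N : ℕ => 2 * (N : ℝ) + 1 - y N ^ 2) atTop atTop :=
  tendsto_atTop_mono' _ hy (tendsto_two_mul_add_one.const_mul_atTop (by positivity))

lemma tendsto_scale_zero (hκ : 0 < κ)
    (hy : ∀ᶠ N : ℕ in atTop, κ ^ 2 * (2 * N + 1) ≤ 2 * N + 1 - y N ^ 2)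
    (ha : Tendsto (fun N => a N * √(2 * N + 1 - y N ^ 2)) atTop (𝓝 π)) :
    Tendsto a atTop (𝓝 0) := by
  have hb := tendsto_bulk_atTop hκ hy
  have := ha.div_atTop (tendsto_sqrt_atTop.comp hb)
  refine this.congr' ?_
  filter_upwards [hb.eventually_gt_atTop 0] with N hN
  have : 0 < √(2 * (N : ℝ) + 1 - y N ^ 2) := Real.sqrt_pos.2 hN
  simp only [Function.comp_apply]
  field_simp

lemma tendsto_scale_mul_psi_sq (hκ : 0 < κ) (hκ1 : κ ≤ 1)
    (hy : ∀ᶠ N : ℕ in atTop, κ ^ 2 * (2 * N + 1) ≤ 2 * N + 1 - y N ^ 2) :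
    Tendsto (fun N => psi N (y N) ^ 2) atTop (𝓝 0) := by
  have hb := tendsto_bulk_atTop hκ hy
  have := (tendsto_wkb hκ hκ1 hy).div_atTop (tendsto_sqrt_atTop.comp hb)
  refine squeeze_zero' (Eventually.of_forall fun N => by positivity) ?_ this
  filter_upwards [hb.eventually_gt_atTop 0] with N hN
  have : 0 < √(2 * (N : ℝ) + 1 - y N ^ 2) := Real.sqrt_pos.2 hN
  simp only [Function.comp_apply]
  rw [le_div_iff₀ this, wkb, mul_comm]
  have : 0 ≤ psiD N (y N) ^ 2 / √(2 * (N : ℝ) + 1 - y N ^ 2) := by positivity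
  linarith

lemma tendsto_kern_self (hκ : 0 < κ) (hκ1 : κ ≤ 1)
    (hy : ∀ᶠ N : ℕ in atTop, κ ^ 2 * (2 * N + 1) ≤ 2 * N + 1 - y N ^ 2)
    (ha : Tendsto (fun N => a N * √(2 * N + 1 - y N ^ 2)) atTop (𝓝 π)) :
    Tendsto (fun N => a N * kern N (y N) (y N)) atTop (𝓝 1) := by
  have hb := tendsto_bulk_atTop hκ hy
  have := ((ha.mul (tendsto_wkb hκ hκ1 hy)).sub
    ((tendsto_scale_zero hκ hy ha).mul (tendsto_scale_mul_psi_sq hκ hκ1 hy))).div_const 2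
  rw [show (π * (2 / π) - 0 * 0) / 2 = 1 by field_simp; norm_num] at this
  refine this.congr' ?_
  filter_upwards [hb.eventually_gt_atTop 0] with N hN
  rw [kern_self_eq_wkb N hN]
  ring

lemma tendsto_kern_ne (hκ : 0 < κ) (hκ1 : κ ≤ 1) {d : ℝ} (hd : d ≠ 0)
    (hy : ∀ᶠ N : ℕ in atTop, κ ^ 2 * (2 * N + 1) ≤ 2 * N + 1 - y N ^ 2)
    (hx : ∀ᶠ N : ℕ in atTop, κ ^ 2 * (2 * N + 1) ≤ 2 * N + 1 - (y N + a N * d) ^ 2)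
    (ha : Tendsto (fun N => a N * √(2 * N + 1 - y N ^ 2)) atTop (𝓝 π)) :
    Tendsto (fun N => a N * kern N (y N + a N * d) (y N)) atTop
      (𝓝 (sin (π * d) / (π * d))) := by
  have ha0 := tendsto_scale_zero hκ hy ha
  set x : ℕ → ℝ := fun N => y N + a N * d with hxdef
  set W : ℕ → ℝ := fun N => psi N (x N) * psiD N (y N) - psiD N (x N) * psi N (y N) with hW
  set E : ℕ → ℝ := fun N => wkb (2 * N + 1) (psi N) (psiD N) (y N) *
      sin (√(2 * N + 1 - y N ^ 2) * (x N - y N)) with hE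
  have hEl : Tendsto E atTop (𝓝 (2 / π * sin (π * d))) := by
    refine (tendsto_wkb hκ hκ1 hy).mul ?_
    refine (Real.continuous_sin.tendsto _).comp ?_
    refine (ha.mul_const d).congr fun N => ?_
    simp only [hxdef]
    ring
  have hWE : Tendsto (fun N => W N - E N) atTop (𝓝 0) := by
    have hlim : Tendsto (fun N : ℕ => 4 * 2 / κ ^ 2 * |a N * d| ^ 2
        + 2 * 2 / (κ ^ 2 * √(2 * N + 1)) * |a N * d|) atTop
        (𝓝 (4 * 2 / κ ^ 2 * |0 * d| ^ 2 + 0 * |0 * d|)) := by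
      refine ((((ha0.mul_const d).abs.pow 2).const_mul _).add
        (Tendsto.mul ?_ (ha0.mul_const d).abs))
      exact tendsto_const_nhds.div_atTop
        ((tendsto_sqrt_atTop.comp tendsto_two_mul_add_one).const_mul_atTop (by positivity))
    simp only [zero_mul, abs_zero, ne_eq, OfNat.ofNat_ne_zero, not_false_eq_true, zero_pow,
      mul_zero, add_zero] at hlim
    refine squeeze_zero_norm' ?_ hlim
    filter_upwards [hy, hx, eventually_wkb_sub_le hκ hκ1 one_pos] with N h1 h2 h3
    have hM : ∀ x : ℝ, κ ^ 2 * (2 * N + 1) ≤ 2 * N + 1 - x ^ 2 →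
        wkb (2 * N + 1) (psi N) (psiD N) x ≤ 2 := fun x hx => by
      have e1 := (abs_le.1 (h3 x hx)).2
      have e2 : 2 / π ≤ 1 := by
        rw [div_le_one pi_pos]; linarith [pi_gt_three]
      linarith
    have := (wronskian_sub_sin_le (hasDerivAt_psi N) (hasDerivAt_psiD N) hκ hκ1
      (by positivity) hM h2 h1).1
    have hxy : x N - y N = a N * d := by simp [hxdef]
    rw [Real.norm_eq_abs]
    simp only [hW, hE, hxy]
    simp only [hxdef, add_sub_cancel_left] at this ⊢
    exact this
  have hWl : Tendsto W atTop (𝓝 (2 / π * sin (π * d))) := by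
    simpa using hWE.add hEl
  have hpp : Tendsto (fun N => psi N (x N) * psi N (y N)) atTop (𝓝 0) := by
    have := ((tendsto_scale_mul_psi_sq hκ hκ1 hx).add (tendsto_scale_mul_psi_sq hκ hκ1 hy))
    rw [add_zero] at this
    refine squeeze_zero_norm (fun N => ?_) this
    rw [Real.norm_eq_abs, abs_mul]
    simp only [hxdef]
    nlinarith [sq_abs (psi N (y N + a N * d)), sq_abs (psi N (y N)),
      sq_nonneg (|psi N (y N + a N * d)| - |psi N (y N)|), abs_nonneg (psi N (y N)),
      abs_nonneg (psi N (y N + a N * d))]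
  have hfin := (hWl.div_const (2 * d)).sub ((ha0.mul hpp).div_const 2)
  rw [show 2 / π * sin (π * d) / (2 * d) - 0 * 0 / 2 = sin (π * d) / (π * d) by
    field_simp; ring] at hfin
  refine hfin.congr fun N => ?_
  have hcd := christoffel_darboux N (x N) (y N)
  have hxy : x N - y N = a N * d := by simp [hxdef]
  rw [hxy] at hcd
  change _ = a N * kern N (x N) (y N)
  have : a N * kern N (x N) (y N) = (a N * d * kern N (x N) (y N)) / d := by field_simp
  rw [this, hcd]
  simp only [hW]
  field_simp

end Limit

/-- Spacing of the rescaled points at inverse temperature `2N - 2θ`. -/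
def scl (u θ : ℝ) (N : ℕ) : ℝ := √(2 * N - 2 * θ) / (N * ((2 / π) * √(1 - u ^ 2)))

/-- Rescaled point near `u`. -/
def pt (u θ : ℝ) (N : ℕ) (t : ℝ) : ℝ :=
  √(2 * N - 2 * θ) * (u + t / (N * ((2 / π) * √(1 - u ^ 2))))

lemma pt_eq (u θ : ℝ) (N : ℕ) (t t' : ℝ) : pt u θ N t = pt u θ N t' + scl u θ N * (t - t') := by
  simp only [pt, scl]; ring

section Bulk

variable {u : ℝ}

lemma bulk_pt (hu : u ∈ Set.Ioo (-1 : ℝ) 1) (θ A : ℝ) :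
    ∀ᶠ N : ℕ in atTop, ∀ t : ℝ, |t| ≤ A →
      √((1 - u ^ 2) / 2) ^ 2 * (2 * N + 1) ≤ 2 * N + 1 - pt u θ N t ^ 2 := by
  have hu2 : 0 < 1 - u ^ 2 := by nlinarith [hu.1, hu.2]
  set ω := (2 / π) * √(1 - u ^ 2) with hω
  have hω0 : 0 < ω := by have := Real.sqrt_pos.2 hu2; positivity
  have hc : Continuous fun h : ℝ => 2 + h - (2 - 2 * θ * h) * (|u| + A * h / ω) ^ 2
      - (1 - u ^ 2) / 2 * (2 + h) := by fun_prop
  have hG := (hc.tendsto 0).comp (tendsto_one_div_atTop_nhds_zero_nat (𝕜 := ℝ))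
  have hpos : 0 < 2 + 0 - (2 - 2 * θ * 0) * (|u| + A * 0 / ω) ^ 2 - (1 - u ^ 2) / 2 * (2 + 0) := by
    simp only [mul_zero, zero_div, add_zero, sub_zero, sq_abs]; linarith
  filter_upwards [hG.eventually_const_lt hpos, eventually_gt_atTop 0,
    tendsto_natCast_atTop_atTop.eventually_ge_atTop θ] with N hN hN0 hNθ t ht
  have hN1 : (0 : ℝ) < N := by exact_mod_cast hN0
  rw [Real.sq_sqrt (by linarith), pt, mul_pow, Real.sq_sqrt (by linarith), ← hω]
  have h1 : (u + t / (N * ω)) ^ 2 ≤ (|u| + A * (1 / N) / ω) ^ 2 := by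
    rw [← sq_abs (u + _)]
    refine pow_le_pow_left₀ (abs_nonneg _) ((abs_add_le _ _).trans ?_) 2
    rw [abs_div, abs_of_pos (by positivity : (0 : ℝ) < N * ω)]
    rw [show A * (1 / (N : ℝ)) / ω = A / (N * ω) by field_simp]
    gcongr
  have h2 : (2 * (N : ℝ) - 2 * θ) * (u + t / (N * ω)) ^ 2 ≤
      (2 * (N : ℝ) - 2 * θ) * (|u| + A * (1 / N) / ω) ^ 2 :=
    mul_le_mul_of_nonneg_left h1 (by linarith)
  have h3 : 0 < (N : ℝ) * (2 + 1 / N - (2 - 2 * θ * (1 / N)) * (|u| + A * (1 / N) / ω) ^ 2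
      - (1 - u ^ 2) / 2 * (2 + 1 / N)) := mul_pos hN1 hN
  have h4 : (N : ℝ) * (2 + 1 / N - (2 - 2 * θ * (1 / N)) * (|u| + A * (1 / N) / ω) ^ 2
      - (1 - u ^ 2) / 2 * (2 + 1 / N)) = 2 * N + 1 - (2 * (N : ℝ) - 2 * θ) *
        (|u| + A * (1 / N) / ω) ^ 2 - (1 - u ^ 2) / 2 * (2 * N + 1) := by
    field_simp
  linarith

lemma tendsto_scl_mul_sqrt (hu : u ∈ Set.Ioo (-1 : ℝ) 1) (θ t : ℝ) :
    Tendsto (fun N : ℕ => scl u θ N * √(2 * N + 1 - pt u θ N t ^ 2)) atTop (𝓝 π) := by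
  have hu2 : 0 < 1 - u ^ 2 := by nlinarith [hu.1, hu.2]
  have hS := Real.sqrt_pos.2 hu2
  set ω := (2 / π) * √(1 - u ^ 2) with hω
  have hω0 : 0 < ω := by positivity
  have hc : Continuous fun h : ℝ => √((2 - 2 * θ * h) / ω ^ 2 *
      (2 + h - (2 - 2 * θ * h) * (u + t * h / ω) ^ 2)) := by fun_prop
  have hG := (hc.tendsto 0).comp (tendsto_one_div_atTop_nhds_zero_nat (𝕜 := ℝ))
  have hlim : √((2 - 2 * θ * 0) / ω ^ 2 * (2 + 0 - (2 - 2 * θ * 0) * (u + t * 0 / ω) ^ 2)) = π := by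
    rw [Real.sqrt_eq_iff_mul_self_eq_of_pos pi_pos, hω]
    simp only [mul_zero, zero_div, add_zero, sub_zero, mul_pow, Real.sq_sqrt hu2.le]
    field_simp
  rw [hlim] at hG
  refine hG.congr' ?_
  filter_upwards [eventually_gt_atTop 0,
    tendsto_natCast_atTop_atTop.eventually_ge_atTop θ] with N hN0 hNθ
  have hN1 : (0 : ℝ) < N := by exact_mod_cast hN0
  have hs : 0 ≤ 2 * (N : ℝ) - 2 * θ := by linarith
  have e1 : scl u θ N = √((2 * N - 2 * θ) / (N * ω) ^ 2) := by
    rw [Real.sqrt_div hs, Real.sqrt_sq (by positivity), scl]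
  rw [e1, ← Real.sqrt_mul (by positivity), pt, mul_pow (√(2 * (N : ℝ) - 2 * θ)), Real.sq_sqrt hs,
    ← hω, Function.comp_apply]
  congr 1
  field_simp

lemma tendsto_scaled_kern (hu : u ∈ Set.Ioo (-1 : ℝ) 1) (θ t t' : ℝ) :
    Tendsto (fun N : ℕ => scl u θ N * kern N (pt u θ N t) (pt u θ N t')) atTop
      (𝓝 (Ksine t t')) := by
  have hu2 : 0 < 1 - u ^ 2 := by nlinarith [hu.1, hu.2]
  have hκ : 0 < √((1 - u ^ 2) / 2) := Real.sqrt_pos.2 (by linarith)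
  have hκ1 : √((1 - u ^ 2) / 2) ≤ 1 := by rw [Real.sqrt_le_one]; nlinarith [sq_nonneg u]
  have hb : ∀ t, ∀ᶠ N : ℕ in atTop,
      √((1 - u ^ 2) / 2) ^ 2 * (2 * N + 1) ≤ 2 * N + 1 - pt u θ N t ^ 2 := fun t =>
    (bulk_pt hu θ |t|).mono fun N h => h t le_rfl
  have ha := tendsto_scl_mul_sqrt hu θ t'
  rw [Ksine]
  split_ifs with h
  · subst h
    exact tendsto_kern_self hκ hκ1 (hb t) ha
  · have := tendsto_kern_ne hκ hκ1 (sub_ne_zero.2 h) (hb t')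
      (by simpa only [← pt_eq] using hb t) ha
    simpa only [← pt_eq] using this

lemma eventually_scaled_kern_le (hu : u ∈ Set.Ioo (-1 : ℝ) 1) (θ A : ℝ) :
    ∃ C : ℝ, ∀ᶠ N : ℕ in atTop, ∀ t t' : ℝ, |t| ≤ A → |t'| ≤ A →
      |scl u θ N * kern N (pt u θ N t) (pt u θ N t')| ≤ C := by
  have hu2 : 0 < 1 - u ^ 2 := by nlinarith [hu.1, hu.2]
  have hκ : 0 < √((1 - u ^ 2) / 2) := Real.sqrt_pos.2 (by linarith)
  have hκ1 : √((1 - u ^ 2) / 2) ≤ 1 := by rw [Real.sqrt_le_one]; nlinarith [sq_nonneg u]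
  set ω := (2 / π) * √(1 - u ^ 2) with hω
  have hS := Real.sqrt_pos.2 hu2
  have hω0 : 0 < ω := by positivity
  refine ⟨√(2 + 2 * |θ|) * √3 / ω, ?_⟩
  filter_upwards [bulk_pt hu θ A, eventually_wkb_sub_le hκ hκ1 one_pos,
    eventually_gt_atTop 0] with N h1 h2 hN0 t t' ht ht'
  have hN1 : (1 : ℝ) ≤ N := by exact_mod_cast hN0
  have hd : ∀ t, |t| ≤ A → kern N (pt u θ N t) (pt u θ N t) ≤ √(3 * N) := by
    intro t ht
    have hb := h1 t ht
    have e1 := (abs_le.1 (h2 _ hb)).2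
    have e2 : 2 / π ≤ 1 := by
      rw [div_le_one pi_pos]; linarith [pi_gt_three]
    have hpos : 0 < 2 * (N : ℝ) + 1 - pt u θ N t ^ 2 := lt_of_lt_of_le (by positivity) hb
    rw [kern_self_eq_wkb N hpos]
    have e3 : √(2 * (N : ℝ) + 1 - pt u θ N t ^ 2) ≤ √(3 * N) := by
      apply Real.sqrt_le_sqrt; nlinarith [sq_nonneg (pt u θ N t)]
    have e4 : wkb (2 * N + 1) (psi N) (psiD N) (pt u θ N t) ≤ 2 := by linarith
    have e5 : √(2 * (N : ℝ) + 1 - pt u θ N t ^ 2) *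
        wkb (2 * N + 1) (psi N) (psiD N) (pt u θ N t) ≤ √(3 * N) * 2 :=
      mul_le_mul e3 e4 (wkb_nonneg _) (by positivity)
    nlinarith [sq_nonneg (psi N (pt u θ N t))]
  have hk : |kern N (pt u θ N t) (pt u θ N t')| ≤ √(3 * N) := by
    refine abs_le_of_sq_le_sq ((kern_sq_le _ _ _).trans ?_) (by positivity)
    rw [sq]
    exact mul_le_mul (hd t ht) (hd t' ht') (kern_self_nonneg _ _) (by positivity)
  have hs : |scl u θ N| ≤ √((2 + 2 * |θ|) * N) / (N * ω) := by
    rw [scl, abs_of_nonneg (by positivity)]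
    gcongr
    nlinarith [neg_abs_le θ, abs_nonneg θ]
  rw [abs_mul]
  calc _ ≤ √((2 + 2 * |θ|) * N) / (N * ω) * √(3 * N) := by gcongr
    _ = _ := by
      rw [Real.sqrt_mul (by positivity), Real.sqrt_mul (by norm_num)]
      have := Real.mul_self_sqrt (show (0 : ℝ) ≤ N by linarith)
      field_simp
      rw [sq, this]

end Bulk

section Det

variable {ι κ : Type} [Fintype ι] [DecidableEq ι] [Fintype κ] [DecidableEq κ]

lemma det_bordered_of_ne_zero {A : Matrix ι ι ℝ} (hA : A.det ≠ 0) (b c : ι → ℝ) (d : ℝ) :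
    (Matrix.fromBlocks A (Matrix.replicateCol Unit b) (Matrix.replicateRow Unit c)
      (Matrix.of fun _ _ => d)).det = d * A.det - c ⬝ᵥ (A.adjugate.mulVec b) := by
  have hmul : Matrix.fromBlocks A (Matrix.replicateCol Unit b) (Matrix.replicateRow Unit c)
      (Matrix.of fun _ _ => d) * Matrix.fromBlocks 1
        (Matrix.replicateCol Unit (-(A.adjugate.mulVec b))) 0 (Matrix.of fun _ _ => A.det) =
      Matrix.fromBlocks A 0 (Matrix.replicateRow Unit c)
        (Matrix.of fun _ _ => d * A.det - c ⬝ᵥ (A.adjugate.mulVec b)) := by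
    rw [Matrix.fromBlocks_multiply]
    congr 1
    · simp
    · rw [← Matrix.replicateCol_mulVec, Matrix.mulVec_neg, Matrix.mulVec_mulVec,
        Matrix.mul_adjugate]
      ext i j
      simp [Matrix.mul_apply, Matrix.smul_mulVec, mul_comm]
    · simp
    · ext i j
      simp [Matrix.mul_apply, dotProduct, Finset.sum_neg_distrib]
      ring
  have := congrArg Matrix.det hmul
  rw [Matrix.det_mul, Matrix.det_fromBlocks_zero₂₁, Matrix.det_fromBlocks_zero₁₂,
    Matrix.det_one, one_mul, Matrix.det_unique (n := Unit), Matrix.det_unique (n := Unit),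
    mul_comm] at this
  exact mul_left_cancel₀ hA this

/-- Determinant of a matrix bordered by one row and one column. -/
lemma det_bordered (A : Matrix ι ι ℝ) (b c : ι → ℝ) (d : ℝ) :
    (Matrix.fromBlocks A (Matrix.replicateCol Unit b) (Matrix.replicateRow Unit c)
      (Matrix.of fun _ _ => d)).det = d * A.det - c ⬝ᵥ (A.adjugate.mulVec b) := by
  have hev : ∀ᶠ ε : ℝ in 𝓝[≠] 0, (A + Matrix.scalar ι ε).det ≠ 0 := by
    have hne : (-A).charpoly ≠ 0 := (Matrix.charpoly_monic _).ne_zero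
    have hfin : {ε : ℝ | (-A).charpoly.IsRoot ε}.Finite := Polynomial.finite_setOfPred_isRoot hne
    have : ∀ᶠ ε : ℝ in 𝓝[≠] 0, ε ∉ {ε : ℝ | (-A).charpoly.IsRoot ε} := by
      have := (hfin.subset Set.sdiff_subset : ({ε : ℝ | (-A).charpoly.IsRoot ε} \ {0}).Finite)
      filter_upwards [nhdsWithin_le_nhds (this.isClosed.isOpen_compl.mem_nhds (by simp)),
        self_mem_nhdsWithin] with ε h1 h2 h3
      exact h1 ⟨h3, h2⟩
    refine this.mono fun ε h h0 => h ?_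
    rw [Set.mem_ofPred_eq, Polynomial.IsRoot, Matrix.eval_charpoly, sub_neg_eq_add, add_comm, h0]
  have hA : Continuous fun ε : ℝ => A + Matrix.scalar ι ε := by
    refine continuous_const.add (continuous_matrix fun i j => ?_)
    simp only [Matrix.scalar_apply, Matrix.diagonal_apply]
    split_ifs <;> fun_prop
  have hL : Continuous fun ε : ℝ => (Matrix.fromBlocks (A + Matrix.scalar ι ε)
      (Matrix.replicateCol Unit b) (Matrix.replicateRow Unit c) (Matrix.of fun _ _ => d)).det :=
    (hA.matrix_fromBlocks continuous_const continuous_const continuous_const).matrix_det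
  have hR : Continuous fun ε : ℝ => d * (A + Matrix.scalar ι ε).det -
      c ⬝ᵥ ((A + Matrix.scalar ι ε).adjugate.mulVec b) :=
    (continuous_const.mul hA.matrix_det).sub
      (continuous_const.dotProduct (hA.matrix_adjugate.matrix_mulVec continuous_const))
  have h1 := (hL.tendsto 0).mono_left (nhdsWithin_le_nhds (s := {0}ᶜ))
  have h2 := (hR.tendsto 0).mono_left (nhdsWithin_le_nhds (s := {0}ᶜ))
  have := tendsto_nhds_unique h1 (h2.congr' (hev.mono fun ε h =>
    (det_bordered_of_ne_zero h b c d).symm))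
  simpa using this

/-- Determinant of the kernel matrix at the points `x`. -/
def kdet (N : ℕ) (x : ι → ℝ) : ℝ := (Matrix.of fun i j => kern N (x i) (x j)).det

lemma kdet_comp_equiv (N : ℕ) (e : κ ≃ ι) (x : ι → ℝ) : kdet N (x ∘ e) = kdet N x :=
  Matrix.det_submatrix_equiv_self e (Matrix.of fun i j => kern N (x i) (x j))

lemma integrable_kern_self (N : ℕ) : Integrable fun z => kern N z z :=
  integrable_finsetSum _ fun k _ => integrable_psi_mul_psi k k

lemma integral_kern_self (N : ℕ) : ∫ z, kern N z z = N := by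
  simp only [kern]
  rw [integral_finsetSum _ fun k _ => integrable_psi_mul_psi k k]
  simp [integral_psi_mul_psi]

lemma kern_mul_kern (N : ℕ) (x y z : ℝ) : kern N z y * kern N x z =
    ∑ j ∈ Finset.range N, ∑ k ∈ Finset.range N,
      (psi j y * psi k x) * (psi j z * psi k z) := by
  simp only [kern]
  rw [Finset.sum_mul_sum]
  exact Finset.sum_congr rfl fun j _ => Finset.sum_congr rfl fun k _ => by ring

lemma integrable_kern_mul_kern (N : ℕ) (x y : ℝ) :
    Integrable fun z => kern N z y * kern N x z := by
  simp only [kern_mul_kern]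
  exact integrable_finsetSum _ fun j _ => integrable_finsetSum _ fun k _ =>
    (integrable_psi_mul_psi j k).const_mul _

/-- Reproducing property. -/
lemma integral_kern_mul_kern (N : ℕ) (x y : ℝ) :
    ∫ z, kern N z y * kern N x z = kern N x y := by
  simp only [kern_mul_kern]
  rw [integral_finsetSum _ fun j _ => integrable_finsetSum _ fun k _ =>
    (integrable_psi_mul_psi j k).const_mul _]
  rw [kern]
  refine Finset.sum_congr rfl fun j hj => ?_
  rw [integral_finsetSum _ fun k _ => (integrable_psi_mul_psi j k).const_mul _]
  simp only [integral_const_mul, integral_psi_mul_psi]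
  simp [Finset.mem_range.1 hj]
  ring

lemma kdet_sumElim_unit (N : ℕ) (x : ι → ℝ) (z : ℝ) :
    kdet N (Sum.elim x fun _ : Unit => z) = kern N z z * kdet N x -
      ∑ i, ∑ j, (Matrix.of fun i j => kern N (x i) (x j)).adjugate i j *
        (kern N z (x i) * kern N (x j) z) := by
  have h := det_bordered (Matrix.of fun i j => kern N (x i) (x j)) (fun i => kern N (x i) z)
    (fun j => kern N z (x j)) (kern N z z)
  have e : (Matrix.of fun i j => kern N (Sum.elim x (fun _ : Unit => z) i)
      (Sum.elim x (fun _ : Unit => z) j)) = Matrix.fromBlocks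
      (Matrix.of fun i j => kern N (x i) (x j)) (Matrix.replicateCol Unit fun i => kern N (x i) z)
      (Matrix.replicateRow Unit fun j => kern N z (x j)) (Matrix.of fun _ _ => kern N z z) := by
    ext (i | i) (j | j) <;> rfl
  rw [kdet, e, h]
  simp only [dotProduct, Matrix.mulVec, Finset.mul_sum, kdet]
  congr 1
  exact Finset.sum_congr rfl fun i _ => Finset.sum_congr rfl fun j _ => by ring

/-- Integrating out one point. -/
lemma integral_kdet_sumElim_unit (N : ℕ) (x : ι → ℝ) :
    ∫ z, kdet N (Sum.elim x fun _ : Unit => z) = (N - Fintype.card ι) * kdet N x := by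
  simp only [kdet_sumElim_unit]
  have hi : ∀ i j : ι, Integrable fun z =>
      (Matrix.of fun i j => kern N (x i) (x j)).adjugate i j *
        (kern N z (x i) * kern N (x j) z) := fun i j =>
    (integrable_kern_mul_kern N _ _).const_mul _
  rw [integral_sub ((integrable_kern_self N).mul_const _)
    (integrable_finsetSum _ fun i _ => integrable_finsetSum _ fun j _ => hi i j),
    integral_mul_const, integral_kern_self,
    integral_finsetSum _ fun i _ => integrable_finsetSum _ fun j _ => hi i j]
  have : ∀ i, ∫ z, ∑ j, (Matrix.of fun i j => kern N (x i) (x j)).adjugate i j *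
        (kern N z (x i) * kern N (x j) z) = kdet N x := fun i => by
    rw [integral_finsetSum _ fun j _ => hi i j]
    simp only [integral_const_mul, integral_kern_mul_kern]
    have := congrFun (congrFun
      (Matrix.adjugate_mul (Matrix.of fun i j => kern N (x i) (x j))) i) i
    rw [Matrix.mul_apply] at this
    simpa [kdet] using this
  simp [this]
  ring

/-- Expansion of the kernel determinant into products of one-variable functions. -/
lemma kdet_eq_sum (N : ℕ) (x : ι → ℝ) : kdet N x = ∑ σ : Equiv.Perm ι,
    ∑ k ∈ Fintype.piFinset fun _ : ι => Finset.range N, (Equiv.Perm.sign σ : ℝ) *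
      ∏ i, psi (k (σ⁻¹ i)) (x i) * psi (k i) (x i) := by
  rw [kdet, Matrix.det_apply']
  refine Finset.sum_congr rfl fun σ _ => ?_
  rw [← Finset.mul_sum]
  congr 1
  simp only [Matrix.of_apply, kern]
  rw [Finset.prod_univ_sum]
  refine Finset.sum_congr rfl fun k _ => ?_
  rw [Finset.prod_mul_distrib, Finset.prod_mul_distrib]
  congr 1
  exact Fintype.prod_equiv σ _ _ fun i => by simp

lemma integrable_kdet_sumElim (N : ℕ) (x : ι → ℝ) :
    Integrable fun y : κ → ℝ => kdet N (Sum.elim x y) := by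
  simp only [kdet_eq_sum, Fintype.prod_sum_type, Sum.elim_inl, Sum.elim_inr]
  refine integrable_finsetSum _ fun σ _ => integrable_finsetSum _ fun k _ => ?_
  exact ((Integrable.fintype_prod fun i => integrable_psi_mul_psi _ _).const_mul _).const_mul _

/-- Integrating out all but `card ι` of the `N` points. -/
lemma integral_kdet_sumElim (N k : ℕ) : ∀ {ι : Type} [Fintype ι] [DecidableEq ι] (x : ι → ℝ),
    Fintype.card ι + k = N →
    ∫ y : Fin k → ℝ, kdet N (Sum.elim x y) = k.factorial * kdet N x := by
  induction k with
  | zero =>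
    intro ι _ _ x h
    have : ∀ y : Fin 0 → ℝ, kdet N (Sum.elim x y) = kdet N x := fun y => by
      rw [← kdet_comp_equiv N (Equiv.sumEmpty ι (Fin 0)) x]
      congr 1
      ext (i | i)
      · rfl
      · exact i.elim0
    simp only [this]
    rw [volume_pi, Measure.pi_of_empty]
    simp
  | succ k ih =>
    intro ι _ _ x h
    have hmp := volume_preserving_piFinSuccAbove (fun _ : Fin (k + 1) => ℝ) 0
    have hre : ∀ p : ℝ × (Fin k → ℝ), kdet N (Sum.elim x
        ((MeasurableEquiv.piFinSuccAbove (fun _ : Fin (k + 1) => ℝ) 0).symm p)) =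
        kdet N (Sum.elim (Sum.elim x fun _ : Unit => p.1) p.2) := by
      intro p
      let e : (ι ⊕ Unit) ⊕ Fin k ≃ ι ⊕ Fin (k + 1) :=
        (Equiv.sumAssoc ι Unit (Fin k)).trans (Equiv.sumCongr (Equiv.refl ι)
          ((Equiv.sumComm Unit (Fin k)).trans
            ((Equiv.optionEquivSumPUnit (Fin k)).symm.trans (finSuccEquiv k).symm)))
      rw [← kdet_comp_equiv N e]
      congr 1
      ext ((i | i) | i)
      · simp [e]
      · simp [e, MeasurableEquiv.piFinSuccAbove]
      · simp [e, MeasurableEquiv.piFinSuccAbove]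
    have hint : Integrable fun p : ℝ × (Fin k → ℝ) =>
        kdet N (Sum.elim (Sum.elim x fun _ : Unit => p.1) p.2) := by
      have := (hmp.symm.integrable_comp_emb
        (MeasurableEquiv.measurableEmbedding _)).2 (integrable_kdet_sumElim (κ := Fin (k + 1)) N x)
      exact this.congr (ae_of_all _ fun p => hre p)
    rw [← hmp.symm.integral_comp (MeasurableEquiv.measurableEmbedding _)]
    simp only [hre]
    rw [Measure.volume_eq_prod, integral_prod _ hint]
    have : ∀ z : ℝ, ∫ y : Fin k → ℝ, kdet N (Sum.elim (Sum.elim x fun _ : Unit => z) y) =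
        k.factorial * kdet N (Sum.elim x fun _ : Unit => z) := fun z =>
      ih _ (by rw [Fintype.card_sum, Fintype.card_unit]; omega)
    simp only [this]
    rw [integral_const_mul, integral_kdet_sumElim_unit, Nat.factorial_succ, ← h]
    push_cast
    ring

end Det

lemma vand_two_eq (N : ℕ) (x : Fin N → ℝ) :
    vand 2 N x = (Matrix.vandermonde x).det ^ 2 := by
  rw [vand, Matrix.det_vandermonde, Finset.prod_filter, Fintype.prod_prod_type, ← Finset.prod_pow]
  refine Finset.prod_congr rfl fun i _ => ?_
  rw [← Finset.prod_pow, ← Finset.filter_lt_eq_Ioi, Finset.prod_filter]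
  refine Finset.prod_congr rfl fun j _ => ?_
  congr 1
  rw [show (2 : ℝ) = ((2 : ℕ) : ℝ) by norm_num, Real.rpow_natCast, sq_abs]
  ring

lemma vand_nonneg (N : ℕ) (x : Fin N → ℝ) : 0 ≤ vand 2 N x := by
  rw [vand_two_eq]; positivity

lemma continuous_vand (N : ℕ) : Continuous (vand 2 N) := by
  have : vand 2 N = fun x => (Matrix.vandermonde x).det ^ 2 := funext (vand_two_eq N)
  rw [this]
  refine (Continuous.matrix_det (continuous_matrix fun i j => ?_)).pow 2
  simp only [Matrix.vandermonde_apply]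
  exact (continuous_apply i).pow _

lemma vand_smul (N : ℕ) {c : ℝ} (hc : 0 ≤ c) (x : Fin N → ℝ) :
    vand 2 N (c • x) = c ^ (N * (N - 1)) * vand 2 N x := by
  simp only [vand, Pi.smul_apply, smul_eq_mul, ← mul_sub, abs_mul, abs_of_nonneg hc]
  simp only [show (2 : ℝ) = ((2 : ℕ) : ℝ) by norm_num, Real.rpow_natCast, mul_pow]
  rw [Finset.prod_mul_distrib, Finset.prod_const, ← pow_mul]
  congr 2
  have h : (Finset.univ.filter fun p : Fin N × Fin N => p.1 < p.2).card =
      ∑ i ∈ Finset.range N, i := by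
    rw [Finset.card_filter, Fintype.sum_prod_type, ← Finset.sum_range_reflect, Finset.sum_range]
    refine Finset.sum_congr rfl fun i _ => ?_
    rw [← Finset.card_filter, Finset.filter_lt_eq_Ioi, Fin.card_Ioi]
  rw [h, mul_comm, Finset.sum_range_id_mul_two]

lemma kdet_univ_eq (N : ℕ) (x : Fin N → ℝ) :
    kdet N x = (Matrix.of fun i j : Fin N => psi j (x i)).det ^ 2 := by
  have : (Matrix.of fun i j => kern N (x i) (x j)) =
      (Matrix.of fun i j : Fin N => psi j (x i)) *
        (Matrix.of fun i j : Fin N => psi j (x i)).transpose := by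
    ext i j
    simp [Matrix.mul_apply, kern, Finset.sum_range]
  rw [kdet, this, Matrix.det_mul, Matrix.det_transpose, sq]

lemma det_psi (N : ℕ) (x : Fin N → ℝ) : (Matrix.of fun i j : Fin N => psi j (x i)).det =
    (∏ i, exp (-x i ^ 2 / 2)) * ((∏ j : Fin N, (√(hnorm j))⁻¹) * (Matrix.vandermonde x).det) := by
  rw [Matrix.det_eval_matrixOfPolynomials_eq_det_vandermonde x (fun j : Fin N => herm j)
    (fun j => (herm_monic_natDegree j).2) (fun j => (herm_monic_natDegree j).1),
    ← Matrix.det_mul_row, ← Matrix.det_mul_column]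
  congr 1
  ext i j
  simp only [Matrix.of_apply, psi]
  ring

/-- The squared Vandermonde determinant with Gaussian weights is determinantal. -/
lemma vand_mul_exp (N : ℕ) (x : Fin N → ℝ) :
    vand 2 N x * exp (-∑ i, x i ^ 2) = (∏ j : Fin N, hnorm j) * kdet N x := by
  rw [kdet_univ_eq, det_psi, vand_two_eq, mul_pow, mul_pow, ← Finset.prod_pow, ← Finset.prod_pow]
  have h1 : ∏ i, exp (-x i ^ 2 / 2) ^ 2 = exp (-∑ i, x i ^ 2) := by
    rw [← Finset.sum_neg_distrib, exp_sum]
    refine Finset.prod_congr rfl fun i _ => ?_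
    rw [← exp_nat_mul]; congr 1; push_cast; ring
  have h2 : (∏ j : Fin N, hnorm j) * ∏ j : Fin N, (√(hnorm j))⁻¹ ^ 2 = 1 := by
    rw [← Finset.prod_mul_distrib]
    refine Finset.prod_eq_one fun j _ => ?_
    rw [inv_pow, Real.sq_sqrt (hnorm_pos _).le, mul_inv_cancel₀ (hnorm_pos _).ne']
  rw [h1]
  linear_combination (-(Matrix.vandermonde x).det ^ 2 * exp (-∑ i, x i ^ 2)) * h2

section Split

variable {n N : ℕ}

/-- The measurable equivalence gluing the first `n` and the last `N - n` coordinates. -/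
def combineEquiv (h : n ≤ N) : (Fin n → ℝ) × (Fin (N - n) → ℝ) ≃ᵐ (Fin N → ℝ) :=
  (MeasurableEquiv.sumPiEquivProdPi fun _ : Fin n ⊕ Fin (N - n) => ℝ).symm.trans
    (MeasurableEquiv.piCongrLeft (fun _ => ℝ)
      (finSumFinEquiv.trans (finCongr (Nat.add_sub_of_le h))))

lemma combine_comp (h : n ≤ N) (x : Fin n → ℝ) (y : Fin (N - n) → ℝ) :
    combine N n x y ∘ (finSumFinEquiv.trans (finCongr (Nat.add_sub_of_le h))) = Sum.elim x y := by
  ext (i | i) <;> simp [combine]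

lemma combineEquiv_apply (h : n ≤ N) (p : (Fin n → ℝ) × (Fin (N - n) → ℝ)) :
    combineEquiv h p = combine N n p.1 p.2 := by
  have : combine N n p.1 p.2 = Sum.elim p.1 p.2 ∘
      (finSumFinEquiv.trans (finCongr (Nat.add_sub_of_le h))).symm := by
    rw [← combine_comp h]
    ext i
    simp
  rw [this]
  ext i
  obtain ⟨j, rfl⟩ := (finSumFinEquiv.trans (finCongr (Nat.add_sub_of_le h))).surjective i
  simp only [combineEquiv, MeasurableEquiv.trans_apply, MeasurableEquiv.coe_piCongrLeft,
    Function.comp_apply, Equiv.symm_apply_apply]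
  rw [Equiv.piCongrLeft_apply_apply]
  rcases j with j | j <;> rfl

lemma measurePreserving_combineEquiv (h : n ≤ N) :
    MeasurePreserving (combineEquiv h) volume volume :=
  (volume_measurePreserving_piCongrLeft (fun _ => ℝ) _).comp
    (volume_measurePreserving_sumPiEquivProdPi_symm _)

/-- The first `n` coordinates. -/
def head (h : n ≤ N) (x : Fin N → ℝ) : Fin n → ℝ := fun i => x (Fin.castLE h i)

lemma continuous_head (h : n ≤ N) : Continuous (head h) :=
  continuous_pi fun _ => continuous_apply _

lemma head_combine (h : n ≤ N) (x : Fin n → ℝ) (y : Fin (N - n) → ℝ) :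
    head h (combine N n x y) = x := by
  ext i; simp [head, combine]

lemma integral_head_mul (h : n ≤ N) {F : (Fin n → ℝ) → ℝ} {G : (Fin N → ℝ) → ℝ}
    (hFG : Integrable fun x => F (head h x) * G x) :
    ∫ x, F (head h x) * G x = ∫ x, F x * ∫ y, G (combine N n x y) := by
  have hmp := measurePreserving_combineEquiv h
  have hi := (hmp.integrable_comp_emb (MeasurableEquiv.measurableEmbedding _)).2 hFG
  rw [← hmp.integral_comp (MeasurableEquiv.measurableEmbedding _), Measure.volume_eq_prod,
    integral_prod _ (by rw [← Measure.volume_eq_prod]; exact hi)]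
  simp only [combineEquiv_apply, head_combine, integral_const_mul]

end Split

lemma integrable_kdet_univ (N : ℕ) : Integrable fun x : Fin N → ℝ => kdet N x := by
  refine (integrable_kdet_sumElim (ι := Empty) (κ := Fin N) N Empty.elim).congr
    (ae_of_all _ fun x => ?_)
  simp only
  rw [← kdet_comp_equiv N (Equiv.emptySum Empty (Fin N)) x]
  congr 1
  ext (i | i)
  · exact i.elim
  · rfl

lemma integral_kdet_univ (N : ℕ) : ∫ x : Fin N → ℝ, kdet N x = N.factorial := by
  have := integral_kdet_sumElim N N (ι := Empty) Empty.elim (by simp)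
  rw [show kdet N (Empty.elim : Empty → ℝ) = 1 from Matrix.det_isEmpty, mul_one] at this
  rw [← this]
  refine integral_congr_ae (ae_of_all _ fun x => ?_)
  simp only
  rw [← kdet_comp_equiv N (Equiv.emptySum Empty (Fin N)) x]
  congr 1
  ext (i | i)
  · exact i.elim
  · rfl

lemma integral_head_mul_kdet {n N : ℕ} (h : n ≤ N) {F : (Fin n → ℝ) → ℝ} (hF : Continuous F)
    {B : ℝ} (hB : ∀ x, |F x| ≤ B) :
    ∫ x, F (head h x) * kdet N x = (N - n).factorial * ∫ x, F x * kdet N x := by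
  rw [integral_head_mul h ((integrable_kdet_univ N).bdd_mul
    (hF.comp (continuous_head h)).aestronglyMeasurable (ae_of_all _ fun x => hB _)),
    ← integral_const_mul]
  refine integral_congr_ae (ae_of_all _ fun x => ?_)
  simp only
  have := integral_kdet_sumElim N (N - n) x (by simp; omega)
  rw [mul_left_comm, ← this]
  congr 2
  ext y
  rw [← combine_comp h, kdet_comp_equiv]

/-- Weighted squared Vandermonde. -/
def gw (s : ℝ) (N : ℕ) (x : Fin N → ℝ) : ℝ := vand 2 N x * exp (-(s * ∑ i, x i ^ 2))

lemma gw_eq {s : ℝ} (hs : 0 < s) (N : ℕ) (x : Fin N → ℝ) :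
    gw s N x = (√s)⁻¹ ^ (N * (N - 1)) * (∏ j : Fin N, hnorm j) * kdet N (√s • x) := by
  have h0 := Real.sqrt_pos.2 hs
  rw [mul_assoc, ← vand_mul_exp, vand_smul N h0.le, gw]
  simp only [Pi.smul_apply, smul_eq_mul, mul_pow, Real.sq_sqrt hs.le, ← Finset.mul_sum]
  rw [inv_pow]
  field_simp

lemma integrable_gw {s : ℝ} (hs : 0 < s) (N : ℕ) : Integrable (gw s N) := by
  have : gw s N = fun x => (√s)⁻¹ ^ (N * (N - 1)) * (∏ j : Fin N, hnorm j) * kdet N (√s • x) :=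
    funext (gw_eq hs N)
  rw [this]
  exact ((integrable_kdet_univ N).comp_smul (Real.sqrt_pos.2 hs).ne').const_mul _

/-- Correlation averages of the Gaussian ensemble are determinantal. -/
lemma gue_ratio {n N : ℕ} (h : n ≤ N) {s : ℝ} (hs : 0 < s) {F : (Fin n → ℝ) → ℝ}
    (hF : Continuous F) {B : ℝ} (hB : ∀ x, |F x| ≤ B) :
    (N.factorial : ℝ) / (N - n).factorial * ((∫ x, F (head h x) * gw s N x) / ∫ x, gw s N x) =
      ∫ x, F ((√s)⁻¹ • x) * kdet N x := by
  have h0 := Real.sqrt_pos.2 hs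
  set c := (√s)⁻¹ ^ (N * (N - 1)) * (∏ j : Fin N, hnorm j) with hc
  have hc0 : 0 < c := by
    have := Finset.prod_pos fun j (_ : j ∈ (Finset.univ : Finset (Fin N))) => hnorm_pos (j : ℕ)
    positivity
  set v := |(√s ^ (Module.finrank ℝ (Fin N → ℝ)))⁻¹| with hv
  have hv0 : 0 < v := by positivity
  have e1 : ∫ x, gw s N x = c * (v * N.factorial) := by
    simp only [gw_eq hs, ← hc]
    rw [integral_const_mul, Measure.integral_comp_smul volume (fun x => kdet N x),
      integral_kdet_univ, smul_eq_mul]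
  have e2 : ∫ x, F (head h x) * gw s N x =
      c * (v * ((N - n).factorial * ∫ x, F ((√s)⁻¹ • x) * kdet N x)) := by
    have e3 := integral_head_mul_kdet h (F := fun x => F ((√s)⁻¹ • x))
      (hF.comp (continuous_const_smul _)) (fun x => hB _)
    rw [← e3, hv, ← smul_eq_mul |((√s ^ (Module.finrank ℝ (Fin N → ℝ)))⁻¹)|,
      ← Measure.integral_comp_smul volume
      (fun x : Fin N → ℝ => F ((√s)⁻¹ • head h x) * kdet N x), ← integral_const_mul]
    refine integral_congr_ae (ae_of_all _ fun x => ?_)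
    simp only
    rw [gw_eq hs, ← hc]
    have : (√s)⁻¹ • head h (√s • x) = head h x := by
      ext i
      simp [head, inv_mul_cancel_left₀ h0.ne']
    rw [this]
    ring
  rw [e1, e2]
  have : ((N - n).factorial : ℝ) ≠ 0 := by positivity
  have : (N.factorial : ℝ) ≠ 0 := by positivity
  field_simp

section Localization

variable {n : ℕ} {u : ℝ}

/-- Test function localized around `u` on the scale of the mean spacing. -/
def loc (u : ℝ) (N : ℕ) (f : (Fin n → ℝ) → ℝ) (x : Fin n → ℝ) : ℝ :=
  f fun i => (N * ((2 / π) * √(1 - u ^ 2))) * (x i - u)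

lemma continuous_loc {f : (Fin n → ℝ) → ℝ} (hf : Continuous f) (N : ℕ) :
    Continuous (loc u N f) :=
  hf.comp (by fun_prop)

lemma dens_pos (hu : u ∈ Set.Ioo (-1 : ℝ) 1) : 0 < (2 / π) * √(1 - u ^ 2) := by
  have := Real.sqrt_pos.2 (show 0 < 1 - u ^ 2 by nlinarith [hu.1, hu.2])
  positivity

lemma integral_loc_mul_kdet (hu : u ∈ Set.Ioo (-1 : ℝ) 1) {θ : ℝ} {N : ℕ} (hN : 0 < N)
    (hθ : θ < N) (f : (Fin n → ℝ) → ℝ) :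
    ∫ x, loc u N f ((√(2 * N - 2 * θ))⁻¹ • x) * kdet N x =
      ∫ t : Fin n → ℝ, f t * Matrix.det (Matrix.of fun j k : Fin n =>
        scl u θ N * kern N (pt u θ N (t j)) (pt u θ N (t k))) := by
  have hω := dens_pos hu
  have hN1 : (0 : ℝ) < N := by exact_mod_cast hN
  have hs : 0 < √(2 * N - 2 * θ) := Real.sqrt_pos.2 (by linarith)
  have hscl : 0 < scl u θ N := by rw [scl]; positivity
  set g : (Fin n → ℝ) → ℝ := fun x => loc u N f ((√(2 * N - 2 * θ))⁻¹ • x) * kdet N x with hg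
  have e1 : ∫ x, g x = ∫ x, g ((fun _ => √(2 * N - 2 * θ) * u) + x) :=
    (integral_add_left_eq_self g _).symm
  have e2 := Measure.integral_comp_smul volume
    (fun x => g ((fun _ => √(2 * N - 2 * θ) * u) + x)) (scl u θ N)
  rw [Module.finrank_fin_fun, abs_of_pos (by positivity), smul_eq_mul, ← e1] at e2
  have e3 : ∫ x, g x = scl u θ N ^ n *
      ∫ t, g ((fun _ => √(2 * N - 2 * θ) * u) + scl u θ N • t) := by
    rw [e2]; field_simp
  rw [e3, ← integral_const_mul]
  refine integral_congr_ae (ae_of_all _ fun t => ?_)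
  have hp : ((fun _ => √(2 * N - 2 * θ) * u) + scl u θ N • t) = fun i => pt u θ N (t i) := by
    ext i; simp [pt, scl]; ring
  have hl : loc u N f ((√(2 * N - 2 * θ))⁻¹ • fun i => pt u θ N (t i)) = f t := by
    rw [loc]
    congr 1
    ext i
    simp only [Pi.smul_apply, smul_eq_mul, pt]
    rw [inv_mul_cancel_left₀ hs.ne', add_sub_cancel_left, mul_div_cancel₀ _ (by positivity)]
  simp only [hp, hg, hl]
  have hd : (Matrix.of fun j k : Fin n =>
      scl u θ N * kern N (pt u θ N (t j)) (pt u θ N (t k))) =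
      scl u θ N • Matrix.of fun j k : Fin n => kern N (pt u θ N (t j)) (pt u θ N (t k)) := by
    ext j k; simp
  rw [hd, Matrix.det_smul, Fintype.card_fin, kdet]
  ring

lemma tendsto_integral_det (hu : u ∈ Set.Ioo (-1 : ℝ) 1) (θ : ℝ) {f : (Fin n → ℝ) → ℝ}
    (hf : Continuous f) (hsupp : HasCompactSupport f) :
    Tendsto (fun N : ℕ => ∫ t : Fin n → ℝ, f t * Matrix.det (Matrix.of fun j k : Fin n =>
        scl u θ N * kern N (pt u θ N (t j)) (pt u θ N (t k)))) atTop
      (𝓝 (∫ t : Fin n → ℝ, f t * Matrix.det (Matrix.of fun j k : Fin n =>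
        Ksine (t j) (t k)))) := by
  obtain ⟨A, hA⟩ := hsupp.isBounded.subset_closedBall 0
  obtain ⟨C, hC⟩ := eventually_scaled_kern_le hu θ A
  refine tendsto_integral_filter_of_dominated_convergence
    (fun t => |f t| * (n.factorial * C ^ n)) ?_ ?_ ?_ ?_
  · refine Eventually.of_forall fun N => Continuous.aestronglyMeasurable ?_
    refine hf.mul (Continuous.matrix_det (continuous_matrix fun j k => ?_))
    refine continuous_const.mul ((continuous_kern N).comp
      (f := fun t : Fin n → ℝ => (pt u θ N (t j), pt u θ N (t k))) ?_)
    simp only [pt]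
    fun_prop
  · filter_upwards [hC] with N hN
    refine ae_of_all _ fun t => ?_
    rw [norm_mul, Real.norm_eq_abs]
    by_cases ht : f t = 0
    · simp [ht]
    · have hmem : t ∈ Metric.closedBall (0 : Fin n → ℝ) A := hA (subset_tsupport f ht)
      have hti : ∀ i, |t i| ≤ A := fun i =>
        (norm_le_pi_norm t i).trans (mem_closedBall_zero_iff.1 hmem)
      gcongr
      have := Matrix.det_le (abv := AbsoluteValue.abs) (x := C)
        (A := Matrix.of fun j k : Fin n => scl u θ N * kern N (pt u θ N (t j)) (pt u θ N (t k)))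
        (fun i j => hN _ _ (hti i) (hti j))
      simpa using this
  · exact ((hf.integrable_of_hasCompactSupport hsupp).abs).mul_const _
  · refine ae_of_all _ fun t => Tendsto.const_mul _ ?_
    have hM : Tendsto (fun N : ℕ => Matrix.of fun j k : Fin n =>
        scl u θ N * kern N (pt u θ N (t j)) (pt u θ N (t k))) atTop
        (𝓝 (Matrix.of fun j k : Fin n => Ksine (t j) (t k))) :=
      tendsto_pi_nhds.2 fun j => tendsto_pi_nhds.2 fun k => tendsto_scaled_kern hu θ _ _
    exact ((continuous_id.matrix_det).tendsto _).comp hM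

/-- Sine-kernel limit for the Gaussian ensemble at inverse temperature `2N - 2θ`. -/
lemma tendsto_gue (hu : u ∈ Set.Ioo (-1 : ℝ) 1) (θ : ℝ) {f : (Fin n → ℝ) → ℝ}
    (hf : Continuous f) (hsupp : HasCompactSupport f) :
    Tendsto (fun N : ℕ => ∫ x, loc u N f ((√(2 * N - 2 * θ))⁻¹ • x) * kdet N x) atTop
      (𝓝 (∫ t : Fin n → ℝ, f t * Matrix.det (Matrix.of fun j k : Fin n =>
        Ksine (t j) (t k)))) := by
  refine (tendsto_integral_det hu θ hf hsupp).congr' ?_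
  filter_upwards [eventually_gt_atTop 0,
    tendsto_natCast_atTop_atTop.eventually_gt_atTop θ] with N h1 h2
  exact (integral_loc_mul_kdet hu h1 h2 f).symm

end Localization

open ProbabilityTheory in
/-- A limit of probability measures whose moment generating functions converge everywhere to
those of `ν` has finite exponential moments. -/
lemma integrable_exp_of_tendsto {P : ℕ → ProbabilityMeasure ℝ} {μ : ProbabilityMeasure ℝ}
    (hP : Tendsto P atTop (𝓝 μ)) {m θ : ℝ}
    (hi : ∀ᶠ N in atTop, Integrable (fun x => exp (θ * x)) (P N : Measure ℝ))
    (hm : Tendsto (fun N => ∫ x, exp (θ * x) ∂(P N : Measure ℝ)) atTop (𝓝 m)) :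
    Integrable (fun x => exp (θ * x)) (μ : Measure ℝ) := by
  have hcont : Continuous fun x : ℝ => exp (θ * x) := by fun_prop
  refine ⟨hcont.aestronglyMeasurable, ?_⟩
  rw [hasFiniteIntegral_iff_ofReal (ae_of_all _ fun x => (exp_pos _).le)]
  have h1 := lintegral_le_liminf_lintegral_of_forall_isOpen_measure_le_liminf_measure
    (μ := (μ : Measure ℝ)) (μs := fun N => (P N : Measure ℝ)) hcont
    (fun x => (exp_pos _).le)
    (fun G hG => ProbabilityMeasure.le_liminf_measure_open_of_tendsto hP hG)
  have h2 : Tendsto (fun N => ∫⁻ x, ENNReal.ofReal (exp (θ * x)) ∂(P N : Measure ℝ)) atTop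
      (𝓝 (ENNReal.ofReal m)) := by
    refine ((ENNReal.continuous_ofReal.tendsto m).comp hm).congr' ?_
    filter_upwards [hi] with N hN
    exact ofReal_integral_eq_lintegral_ofReal hN (ae_of_all _ fun x => (exp_pos _).le)
  rw [h2.liminf_eq] at h1
  exact h1.trans_lt ENNReal.ofReal_lt_top

lemma abs_integral_exp_sub_min_le {μ : Measure ℝ} [IsFiniteMeasure μ] {θ R : ℝ} (hR : 0 < R)
    (h1 : Integrable (fun x => exp (θ * x)) μ)
    (h2 : Integrable (fun x => exp (2 * θ * x)) μ) :
    |(∫ x, exp (θ * x) ∂μ) - ∫ x, min (exp (θ * x)) R ∂μ| ≤ (∫ x, exp (2 * θ * x) ∂μ) / R := by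
  have hmin : Integrable (fun x => min (exp (θ * x)) R) μ :=
    h1.inf (integrable_const R)
  rw [← integral_sub h1 hmin, ← integral_div]
  refine (abs_integral_le_integral_abs).trans (integral_mono (h1.sub hmin).abs (h2.div_const R) ?_)
  intro x
  simp only
  have h3 : exp (2 * θ * x) = exp (θ * x) * exp (θ * x) := by rw [← exp_add]; ring_nf
  have h4 := exp_pos (θ * x)
  rw [h3, le_div_iff₀ hR]
  rcases le_total (exp (θ * x)) R with h | h
  · rw [min_eq_left h]; simp; positivity
  · rw [min_eq_right h, abs_of_nonneg (by linarith)]; nlinarith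

open ProbabilityTheory in
/-- Pointwise convergence of moment generating functions on the whole line implies weak
convergence. -/
lemma tendsto_of_tendsto_mgf {P : ℕ → ProbabilityMeasure ℝ} {ν : ProbabilityMeasure ℝ}
    (hν : ∀ θ, Integrable (fun x => exp (θ * x)) (ν : Measure ℝ))
    (h : ∀ θ, Tendsto (fun N => ∫ x, exp (θ * x) ∂(P N : Measure ℝ)) atTop
      (𝓝 (∫ x, exp (θ * x) ∂(ν : Measure ℝ)))) :
    Tendsto P atTop (𝓝 ν) := by
  have hpos : ∀ θ, 0 < ∫ x, exp (θ * x) ∂(ν : Measure ℝ) := fun θ => integral_exp_pos (hν θ)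
  have hi : ∀ θ, ∀ᶠ N in atTop, Integrable (fun x => exp (θ * x)) (P N : Measure ℝ) := by
    intro θ
    filter_upwards [(h θ).eventually_const_lt (hpos θ)] with N hN
    by_contra hc
    rw [integral_undef hc] at hN
    exact lt_irrefl _ hN
  have htight : IsTightMeasureSet (Set.range fun N => (P N : Measure ℝ)) := by
    apply isTightMeasureSet_range_of_tendsto_limsup_measure_norm_gt
    set C : ℝ := (∫ x, exp (1 * x) ∂(ν : Measure ℝ)) + (∫ x, exp (-1 * x) ∂(ν : Measure ℝ)) + 1
    have hC : ∀ᶠ N in atTop, (∫ x, exp (1 * x) ∂(P N : Measure ℝ)) +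
        (∫ x, exp (-1 * x) ∂(P N : Measure ℝ)) < C :=
      ((h 1).add (h (-1))).eventually_lt_const (by simp [C])
    have hb : ∀ r : ℝ, limsup (fun N => (P N : Measure ℝ) {x | r < ‖x‖}) atTop
        ≤ ENNReal.ofReal (C * exp (-r)) := by
      intro r
      refine limsup_le_of_le (by isBoundedDefault) ?_
      filter_upwards [hC, hi 1, hi (-1)] with N hN h1 h2
      have hs : MeasurableSet {x : ℝ | r < ‖x‖} :=
        measurableSet_lt measurable_const measurable_norm
      rw [← ofReal_measureReal]
      refine ENNReal.ofReal_le_ofReal ?_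
      have h3 : (P N : Measure ℝ).real {x | r < ‖x‖} = ∫ x, Set.indicator {x | r < ‖x‖} 1 x
          ∂(P N : Measure ℝ) := by rw [integral_indicator_one hs]
      rw [h3]
      calc _ ≤ ∫ x, (exp (1 * x) + exp (-1 * x)) * exp (-r) ∂(P N : Measure ℝ) := by
            refine integral_mono ((integrable_const (1:ℝ)).indicator hs)
              ((h1.add h2).mul_const _) ?_
            intro x
            by_cases hx : x ∈ {x : ℝ | r < ‖x‖}
            · simp only [Set.indicator_of_mem hx, Pi.one_apply]
              have hx' : r < |x| := hx
              rcases abs_cases x with ⟨h5, -⟩ | ⟨h5, -⟩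
              · have : 1 ≤ exp (1 * x) * exp (-r) := by
                  rw [← exp_add]; exact one_le_exp (by linarith)
                have := exp_pos (-1 * x); have := exp_pos (-r)
                nlinarith [mul_pos ‹0 < exp (-1 * x)› this]
              · have : 1 ≤ exp (-1 * x) * exp (-r) := by
                  rw [← exp_add]; exact one_le_exp (by linarith)
                have := exp_pos (1 * x); have := exp_pos (-r)
                nlinarith [mul_pos ‹0 < exp (1 * x)› this]
            · simp only [Set.indicator_of_notMem hx]; positivity
        _ = ((∫ x, exp (1 * x) ∂(P N : Measure ℝ)) + ∫ x, exp (-1 * x) ∂(P N : Measure ℝ))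
              * exp (-r) := by rw [integral_mul_const, integral_add h1 h2]
        _ ≤ _ := by gcongr
    refine tendsto_of_tendsto_of_tendsto_of_le_of_le tendsto_const_nhds ?_ (fun _ => zero_le) hb
    have : Tendsto (fun r : ℝ => C * exp (-r)) atTop (𝓝 0) := by
      simpa using tendsto_exp_neg_atTop_nhds_zero.const_mul C
    simpa [Function.comp_def] using (ENNReal.continuous_ofReal.tendsto 0).comp this
  have hcomp : IsCompact (closure (Set.range P)) := by
    refine isCompact_closure_of_isTightMeasureSet ?_
    convert htight using 1
    ext; simp
  refine tendsto_of_subseq_tendsto fun ns hns => ?_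
  obtain ⟨μ, -, φ, hφ, hμ⟩ := hcomp.isSeqCompact (x := fun k => P (ns k))
    (fun k => subset_closure ⟨_, rfl⟩)
  refine ⟨φ, ?_⟩
  have hsub : Tendsto (fun k => ns (φ k)) atTop atTop := hns.comp hφ.tendsto_atTop
  have hμi : ∀ θ, Integrable (fun x => exp (θ * x)) (μ : Measure ℝ) := fun θ =>
    integrable_exp_of_tendsto hμ (hsub.eventually (hi θ)) ((h θ).comp hsub)
  have hmgf : ∀ θ, ∫ x, exp (θ * x) ∂(μ : Measure ℝ) = ∫ x, exp (θ * x) ∂(ν : Measure ℝ) := by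
    intro θ
    set a := ∫ x, exp (2 * θ * x) ∂(μ : Measure ℝ)
    set b := ∫ x, exp (2 * θ * x) ∂(ν : Measure ℝ)
    have key : ∀ R : ℝ, 0 < R → |(∫ x, exp (θ * x) ∂(μ : Measure ℝ)) -
        ∫ x, exp (θ * x) ∂(ν : Measure ℝ)| ≤ (a + b) / R := by
      intro R hR
      have e1 := abs_integral_exp_sub_min_le hR (hμi θ) (hμi (2 * θ))
      let g : BoundedContinuousFunction ℝ ℝ :=
        BoundedContinuousFunction.ofNormedAddCommGroup (fun x => min (exp (θ * x)) R)
          (by fun_prop) R (fun x => by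
            rw [norm_eq_abs, abs_of_nonneg (le_min (exp_pos _).le hR.le)]
            exact min_le_right _ _)
      have e2 : Tendsto (fun k => ∫ x, min (exp (θ * x)) R ∂(P (ns (φ k)) : Measure ℝ)) atTop
          (𝓝 (∫ x, min (exp (θ * x)) R ∂(μ : Measure ℝ))) :=
        ProbabilityMeasure.tendsto_iff_forall_integral_tendsto.1 hμ g
      have e3 : |(∫ x, exp (θ * x) ∂(ν : Measure ℝ)) - ∫ x, min (exp (θ * x)) R ∂(μ : Measure ℝ)|
          ≤ b / R := by
        refine le_of_tendsto_of_tendsto ((((h θ).comp hsub).sub e2).abs)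
          (((h (2 * θ)).comp hsub).div_const R) ?_
        filter_upwards [hsub.eventually (hi θ), hsub.eventually (hi (2 * θ))] with k h1 h2
        exact abs_integral_exp_sub_min_le hR h1 h2
      rw [add_div]
      rw [abs_le] at *
      constructor <;> linarith [e1.1, e1.2, e3.1, e3.2]
    have hlim : Tendsto (fun R : ℝ => (a + b) / R) atTop (𝓝 0) :=
      tendsto_const_nhds.div_atTop tendsto_id
    have : |(∫ x, exp (θ * x) ∂(μ : Measure ℝ)) - ∫ x, exp (θ * x) ∂(ν : Measure ℝ)| ≤ 0 :=
      ge_of_tendsto hlim (by filter_upwards [eventually_gt_atTop 0] with R hR using key R hR)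
    exact sub_eq_zero.1 (abs_nonpos_iff.1 this)
  have heq : (μ : Measure ℝ) = ν := by
    apply Measure.ext_of_complexMGF_id_eq
    have h1 := eqOn_complexMGF_of_mgf (X := id) (Y := id) (μ := (μ : Measure ℝ))
      (μ' := (ν : Measure ℝ)) (by ext θ; exact hmgf θ)
    have h2 : integrableExpSet id (μ : Measure ℝ) = Set.univ := by
      ext θ; simpa [integrableExpSet] using hμi θ
    ext z
    exact h1 (by simp [h2])
  have : μ = ν := Subtype.ext heq
  rw [← this]
  exact hμ

section Gaussian

open ProbabilityTheory

/-- The centred Gaussian law with variance `1 / 2`. -/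
def halfGaussian : ProbabilityMeasure ℝ := ⟨gaussianReal 0 (1 / 2), inferInstance⟩

lemma integrable_exp_halfGaussian (θ : ℝ) :
    Integrable (fun x => exp (θ * x)) (halfGaussian : Measure ℝ) :=
  integrable_exp_mul_gaussianReal θ

lemma integral_exp_halfGaussian (θ : ℝ) :
    ∫ x, exp (θ * x) ∂(halfGaussian : Measure ℝ) = exp (θ ^ 2 / 4) := by
  have := congrFun (mgf_id_gaussianReal (μ := 0) (v := 1 / 2)) θ
  simp only [mgf, id] at this
  refine this.trans ?_
  congr 1
  push_cast
  ring

lemma integral_halfGaussian_pos {φ : ℝ → ℝ} (hφ : Continuous φ) (hc : HasCompactSupport φ)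
    (h0 : ∀ x, 0 ≤ φ x) (h1 : φ 0 ≠ 0) : 0 < ∫ x, φ x ∂(halfGaussian : Measure ℝ) := by
  have : (halfGaussian : Measure ℝ).IsOpenPosMeasure :=
    (gaussianReal_absolutelyContinuous' 0 (v := 1 / 2) (by norm_num)).isOpenPosMeasure
  exact hφ.integral_pos_of_hasCompactSupport_nonneg_nonzero hc h0 h1

/-- The probability measure with density proportional to `q`. -/
lemma exists_probabilityMeasure_density {q : ℝ → ℝ} (hq : ∀ w, 0 ≤ q w) (h0 : 0 < ∫ w, q w) :
    ∃ P : ProbabilityMeasure ℝ, ∀ φ : ℝ → ℝ,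
      ∫ w, φ w ∂(P : Measure ℝ) = (∫ w, φ w * q w) / ∫ w, q w := by
  have hi : Integrable q := by
    by_contra hc
    rw [integral_undef hc] at h0
    exact lt_irrefl _ h0
  set I := ∫ w, q w
  have hm : AEMeasurable (fun w => ENNReal.ofReal (q w / I)) :=
    (hi.aemeasurable.div_const I).ennreal_ofReal
  have hprob : IsProbabilityMeasure (volume.withDensity fun w => ENNReal.ofReal (q w / I)) := by
    refine ⟨?_⟩
    rw [withDensity_apply _ MeasurableSet.univ, Measure.restrict_univ,
      ← ofReal_integral_eq_lintegral_ofReal (hi.div_const I)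
        (ae_of_all _ fun w => div_nonneg (hq w) h0.le), integral_div, div_self h0.ne',
      ENNReal.ofReal_one]
  refine ⟨⟨_, hprob⟩, fun φ => ?_⟩
  change ∫ w, φ w ∂(volume.withDensity fun w => ENNReal.ofReal (q w / I)) = _
  rw [integral_withDensity_eq_integral_toReal_smul₀ hm
    (ae_of_all _ fun w => ENNReal.ofReal_lt_top), ← integral_div]
  refine integral_congr_ae (ae_of_all _ fun w => ?_)
  simp only [smul_eq_mul]
  rw [ENNReal.toReal_ofReal (div_nonneg (hq w) h0.le)]
  ring

lemma tendsto_integral_density {q : ℕ → ℝ → ℝ} (hq : ∀ N w, 0 ≤ q N w)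
    (h0 : ∀ᶠ N in atTop, 0 < ∫ w, q N w)
    (h : ∀ θ, Tendsto (fun N => (∫ w, exp (θ * w) * q N w) / ∫ w, q N w) atTop
      (𝓝 (exp (θ ^ 2 / 4))))
    (φ : BoundedContinuousFunction ℝ ℝ) :
    Tendsto (fun N => (∫ w, φ w * q N w) / ∫ w, q N w) atTop
      (𝓝 (∫ x, φ x ∂(halfGaussian : Measure ℝ))) := by
  have hex : ∀ N, ∃ P : ProbabilityMeasure ℝ, 0 < ∫ w, q N w → ∀ φ : ℝ → ℝ,
      ∫ w, φ w ∂(P : Measure ℝ) = (∫ w, φ w * q N w) / ∫ w, q N w := by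
    intro N
    by_cases hN : 0 < ∫ w, q N w
    · obtain ⟨P, hP⟩ := exists_probabilityMeasure_density (hq N) hN
      exact ⟨P, fun _ => hP⟩
    · exact ⟨halfGaussian, fun h => absurd h hN⟩
  choose P hP using hex
  have hconv : Tendsto P atTop (𝓝 halfGaussian) := by
    refine tendsto_of_tendsto_mgf integrable_exp_halfGaussian fun θ => ?_
    rw [integral_exp_halfGaussian]
    refine (h θ).congr' ?_
    filter_upwards [h0] with N hN using (hP N hN _).symm
  refine (ProbabilityMeasure.tendsto_iff_forall_integral_tendsto.1 hconv φ).congr' ?_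
  filter_upwards [h0] with N hN using hP N hN _

lemma tendsto_integral_test {a k : ℕ → ℝ → ℝ} {c : ℝ}
    (ha : ∀ N w, 0 ≤ a N w) (hk : ∀ N w, 0 ≤ k N w)
    (h0 : ∀ θ, ∀ᶠ N in atTop, 0 < ∫ w, exp (θ * w) * k N w)
    (hi : ∀ θ, ∀ᶠ N in atTop, Integrable fun w => exp (θ * w) * a N w)
    (hkl : ∀ θ, Tendsto (fun N => (∫ w, exp (θ * w) * k N w) / ∫ w, k N w) atTop
      (𝓝 (exp (θ ^ 2 / 4))))
    (hal : ∀ θ, Tendsto (fun N => (∫ w, exp (θ * w) * a N w) / ∫ w, exp (θ * w) * k N w) atTop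
      (𝓝 c))
    (φ : BoundedContinuousFunction ℝ ℝ) :
    Tendsto (fun N => (∫ w, φ w * a N w) / ∫ w, k N w) atTop
      (𝓝 (c * ∫ x, φ x ∂(halfGaussian : Measure ℝ))) := by
  have hki : ∀ θ, ∀ᶠ N in atTop, Integrable fun w => exp (θ * w) * k N w := by
    intro θ
    filter_upwards [h0 θ] with N hN
    by_contra hc
    rw [integral_undef hc] at hN
    exact lt_irrefl _ hN
  have h00 : ∀ᶠ N in atTop, 0 < ∫ w, k N w := by simpa using h0 0
  have hi0 : ∀ᶠ N in atTop, Integrable (a N) := by simpa using hi 0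
  have hki0 : ∀ᶠ N in atTop, Integrable (k N) := by simpa using hki 0
  have hal0 : Tendsto (fun N => (∫ w, a N w) / ∫ w, k N w) atTop (𝓝 c) := by simpa using hal 0
  have hc : 0 ≤ c := ge_of_tendsto' hal0 fun N =>
    div_nonneg (integral_nonneg (ha N)) (integral_nonneg (hk N))
  have hsum : ∀ᶠ N in atTop, ∫ w, k N w + a N w = (∫ w, k N w) + ∫ w, a N w := by
    filter_upwards [hi0, hki0] with N h1 h2 using integral_add h2 h1
  have hpos : ∀ᶠ N in atTop, 0 < ∫ w, k N w + a N w := by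
    filter_upwards [hsum, h00] with N h1 h2
    rw [h1]
    have h6 : 0 ≤ ∫ w, a N w := integral_nonneg (ha N)
    linarith
  have t1 := tendsto_integral_density hk h00 hkl φ
  have t2 := tendsto_integral_density (q := fun N w => k N w + a N w)
    (fun N w => add_nonneg (hk N w) (ha N w)) hpos (fun θ => by
      have e : Tendsto (fun N => ((∫ w, exp (θ * w) * k N w) / ∫ w, k N w) *
          ((1 + (∫ w, exp (θ * w) * a N w) / ∫ w, exp (θ * w) * k N w) /
            (1 + (∫ w, a N w) / ∫ w, k N w))) atTop (𝓝 (exp (θ ^ 2 / 4) * ((1 + c) / (1 + c)))) :=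
        (hkl θ).mul (((hal θ).const_add 1).div (hal0.const_add 1) (by linarith))
      rw [div_self (by linarith), mul_one] at e
      refine e.congr' ?_
      filter_upwards [hsum, h00, h0 θ, hi θ, hki θ] with N h1 h2 h3 h4 h5
      have h6 : 0 ≤ ∫ w, a N w := integral_nonneg (ha N)
      rw [h1]
      simp only [mul_add]
      rw [integral_add h5 h4]
      field_simp) φ
  have t3 : Tendsto (fun N => ((∫ w, φ w * (k N w + a N w)) / ∫ w, k N w + a N w) *
      (1 + (∫ w, a N w) / ∫ w, k N w) - (∫ w, φ w * k N w) / ∫ w, k N w) atTop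
      (𝓝 ((∫ x, φ x ∂(halfGaussian : Measure ℝ)) * (1 + c) -
        ∫ x, φ x ∂(halfGaussian : Measure ℝ))) := (t2.mul (hal0.const_add 1)).sub t1
  have e4 : (∫ x, φ x ∂(halfGaussian : Measure ℝ)) * (1 + c) -
        ∫ x, φ x ∂(halfGaussian : Measure ℝ) = c * ∫ x, φ x ∂(halfGaussian : Measure ℝ) := by ring
  rw [e4] at t3
  refine t3.congr' ?_
  filter_upwards [hsum, h00, hpos, hi0, hki0] with N h1 h2 h3 h4 h5
  have b1 : Integrable fun w => φ w * k N w :=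
    h5.bdd_mul φ.continuous.aestronglyMeasurable (ae_of_all _ φ.norm_coe_le_norm)
  have b2 : Integrable fun w => φ w * a N w :=
    h4.bdd_mul φ.continuous.aestronglyMeasurable (ae_of_all _ φ.norm_coe_le_norm)
  rw [h1] at h3 ⊢
  simp only [mul_add]
  rw [integral_add b1 b2]
  field_simp
  ring

/-- The tent `max 0 (min 1 (R + 1 - ‖t‖))`, equal to one on the ball of radius `R`. -/
def tent {E : Type*} [NormedAddCommGroup E] (R : ℝ) (t : E) : ℝ := max 0 (min 1 (R + 1 - ‖t‖))

section tent

variable {E : Type*} [NormedAddCommGroup E]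

lemma continuous_tent (R : ℝ) : Continuous (tent R : E → ℝ) := by unfold tent; fun_prop

lemma tent_nonneg (R : ℝ) (t : E) : 0 ≤ tent R t := le_max_left _ _

lemma tent_le_one (R : ℝ) (t : E) : tent R t ≤ 1 := max_le zero_le_one (min_le_left _ _)

lemma tent_eq_one {R : ℝ} {t : E} (h : ‖t‖ ≤ R) : tent R t = 1 := by
  unfold tent
  rw [min_eq_left (by linarith), max_eq_right zero_le_one]

lemma tent_eq_zero {R : ℝ} {t : E} (h : R + 1 ≤ ‖t‖) : tent R t = 0 := by
  unfold tent
  rw [max_eq_left]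
  exact (min_le_right _ _).trans (by linarith)

lemma hasCompactSupport_tent [ProperSpace E] (R : ℝ) : HasCompactSupport (tent R : E → ℝ) := by
  refine HasCompactSupport.intro (isCompact_closedBall (0 : E) (R + 1)) fun t ht => ?_
  refine tent_eq_zero ?_
  rw [mem_closedBall_zero_iff, not_le] at ht
  exact ht.le

end tent

end Gaussian

/-- The integral of `F` against the squared Vandermonde weight over the ball `∑ x_i ^ 2 ≤ v`. -/
def ballInt (N : ℕ) (F : (Fin N → ℝ) → ℝ) (v : ℝ) : ℝ :=
  ∫ x, Set.indicator {x : Fin N → ℝ | ∑ i, x i ^ 2 ≤ v} (fun x => F x * vand 2 N x) x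

section ballInt

variable {N : ℕ} {F G : (Fin N → ℝ) → ℝ} {B : ℝ}

lemma measurableSet_ball (N : ℕ) (v : ℝ) :
    MeasurableSet {x : Fin N → ℝ | ∑ i, x i ^ 2 ≤ v} :=
  measurableSet_le (by fun_prop) measurable_const

lemma integrable_mul_gw (hF : Continuous F) (hB : ∀ x, |F x| ≤ B) {s : ℝ} (hs : 0 < s) :
    Integrable fun x => F x * gw s N x :=
  (integrable_gw hs N).bdd_mul hF.aestronglyMeasurable (ae_of_all _ hB)

lemma integrable_ballInt (hF : Continuous F) (hB : ∀ x, |F x| ≤ B) (v : ℝ) :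
    Integrable (Set.indicator {x : Fin N → ℝ | ∑ i, x i ^ 2 ≤ v}
      fun x => F x * vand 2 N x) := by
  refine ((integrable_mul_gw hF hB one_pos).norm.const_mul (exp v)).mono'
    ((hF.mul (continuous_vand N)).aestronglyMeasurable.indicator (measurableSet_ball N v))
    (ae_of_all _ fun x => ?_)
  by_cases hx : x ∈ {x : Fin N → ℝ | ∑ i, x i ^ 2 ≤ v}
  · rw [Set.indicator_of_mem hx]
    have hx' : ∑ i, x i ^ 2 ≤ v := hx
    have h1 : 1 ≤ exp v * exp (-(1 * ∑ i, x i ^ 2)) := by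
      rw [← exp_add]; exact one_le_exp (by linarith)
    rw [gw, norm_mul, norm_mul, norm_mul, norm_of_nonneg (exp_pos _).le]
    nlinarith [mul_le_mul_of_nonneg_left h1 (mul_nonneg (norm_nonneg (F x))
      (norm_nonneg (vand 2 N x)))]
  · rw [Set.indicator_of_notMem hx, norm_zero]
    positivity

lemma ballInt_mono (hF : Continuous F) (hB : ∀ x, |F x| ≤ B) (hG : Continuous G) {B' : ℝ}
    (hB' : ∀ x, |G x| ≤ B') (h : ∀ x, F x ≤ G x) (v : ℝ) : ballInt N F v ≤ ballInt N G v :=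
  integral_mono (integrable_ballInt hF hB v) (integrable_ballInt hG hB' v) fun x =>
    Set.indicator_le_indicator (mul_le_mul_of_nonneg_right (h x) (vand_nonneg N x))

lemma ballInt_nonneg (h : ∀ x, 0 ≤ F x) (v : ℝ) : 0 ≤ ballInt N F v :=
  integral_nonneg fun x => Set.indicator_nonneg (fun y _ => mul_nonneg (h y) (vand_nonneg N y)) x

lemma ballInt_sub (hF : Continuous F) (hB : ∀ x, |F x| ≤ B) (hG : Continuous G) {B' : ℝ}
    (hB' : ∀ x, |G x| ≤ B') (v : ℝ) :
    ballInt N (fun x => F x - G x) v = ballInt N F v - ballInt N G v := by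
  unfold ballInt
  rw [← integral_sub (integrable_ballInt hF hB v) (integrable_ballInt hG hB' v)]
  refine integral_congr_ae (ae_of_all _ fun x => ?_)
  by_cases hx : x ∈ {x : Fin N → ℝ | ∑ i, x i ^ 2 ≤ v}
  · simp only [Set.indicator_of_mem hx]; ring
  · simp only [Set.indicator_of_notMem hx]; ring

lemma ballInt_const_mul (c v : ℝ) :
    ballInt N (fun x => c * F x) v = c * ballInt N F v := by
  unfold ballInt
  rw [← integral_const_mul]
  refine integral_congr_ae (ae_of_all _ fun x => ?_)
  by_cases hx : x ∈ {x : Fin N → ℝ | ∑ i, x i ^ 2 ≤ v}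
  · simp only [Set.indicator_of_mem hx]; ring
  · simp only [Set.indicator_of_notMem hx]; ring

lemma abs_ballInt_le (hF : Continuous F) (hB : ∀ x, |F x| ≤ B) (v : ℝ) :
    |ballInt N F v| ≤ B * ballInt N (fun _ => 1) v := by
  have hc : ∀ c : ℝ, ∀ _ : Fin N → ℝ, |c| ≤ |c| := fun _ _ => le_rfl
  have h1 := ballInt_mono hF hB continuous_const (hc B) (fun x => (abs_le.1 (hB x)).2) v
  have h2 := ballInt_mono continuous_const (hc (-B)) hF hB (fun x => (abs_le.1 (hB x)).1) v
  have h3 : ∀ c : ℝ, ballInt N (fun _ => c) v = c * ballInt N (fun _ => 1) v := fun c => by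
    rw [← ballInt_const_mul]; simp
  rw [h3] at h1 h2
  rw [abs_le]
  constructor <;> linarith

lemma ballInt_div_mul (hF : Continuous F) (hB : ∀ x, |F x| ≤ B) (v : ℝ) :
    ballInt N F v / ballInt N (fun _ => 1) v * ballInt N (fun _ => 1) v = ballInt N F v := by
  rcases eq_or_ne (ballInt N (fun _ => 1) v) 0 with h | h
  · have := abs_ballInt_le hF hB v
    rw [h, mul_zero] at this
    rw [h, mul_zero, abs_nonpos_iff.1 this]
  · exact div_mul_cancel₀ _ h

lemma ballInt_scale {l : ℝ} (hl : 0 < l) (F : (Fin N → ℝ) → ℝ) (v : ℝ) :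
    ballInt N F (l ^ 2 * v) = l ^ (N * (N - 1) + N) * ballInt N (fun x => F (l • x)) v := by
  unfold ballInt
  have h := Measure.integral_comp_smul (volume : Measure (Fin N → ℝ))
    (Set.indicator {x : Fin N → ℝ | ∑ i, x i ^ 2 ≤ l ^ 2 * v} fun x => F x * vand 2 N x) l
  rw [Module.finrank_fin_fun, abs_of_pos (by positivity), smul_eq_mul] at h
  have h2 : ∀ x : Fin N → ℝ, Set.indicator {x : Fin N → ℝ | ∑ i, x i ^ 2 ≤ l ^ 2 * v}
      (fun x => F x * vand 2 N x) (l • x) = l ^ (N * (N - 1)) *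
      Set.indicator {x : Fin N → ℝ | ∑ i, x i ^ 2 ≤ v} (fun x => F (l • x) * vand 2 N x) x := by
    intro x
    have h3 : (l • x ∈ {x : Fin N → ℝ | ∑ i, x i ^ 2 ≤ l ^ 2 * v}) ↔
        x ∈ {x : Fin N → ℝ | ∑ i, x i ^ 2 ≤ v} := by
      simp only [Set.mem_ofPred_eq, Pi.smul_apply, smul_eq_mul, mul_pow, ← Finset.mul_sum]
      exact mul_le_mul_iff_right₀ (by positivity)
    by_cases hx : x ∈ {x : Fin N → ℝ | ∑ i, x i ^ 2 ≤ v}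
    · rw [Set.indicator_of_mem hx, Set.indicator_of_mem (h3.2 hx), vand_smul N hl.le]; ring
    · rw [Set.indicator_of_notMem hx, Set.indicator_of_notMem (fun h => hx (h3.1 h)), mul_zero]
  simp only [h2] at h
  rw [integral_const_mul] at h
  rw [pow_add, mul_right_comm, h]
  field_simp

end ballInt

lemma integral_gw_pos {s : ℝ} (hs : 0 < s) (N : ℕ) : 0 < ∫ x, gw s N x := by
  have h0 := Real.sqrt_pos.2 hs
  simp only [gw_eq hs]
  rw [integral_const_mul, Measure.integral_comp_smul volume (fun x => kdet N x),
    integral_kdet_univ, smul_eq_mul]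
  have := Finset.prod_pos fun j (_ : j ∈ (Finset.univ : Finset (Fin N))) => hnorm_pos (j : ℕ)
  positivity

lemma integral_gw_eq {s : ℝ} (hs : 0 < s) (N : ℕ) :
    ∫ x, gw s N x = (√s)⁻¹ ^ (N * (N - 1) + N) * ∫ x, gw 1 N x := by
  have h0 := Real.sqrt_pos.2 hs
  have h := Measure.integral_comp_smul (volume : Measure (Fin N → ℝ)) (gw s N) (√s)⁻¹
  rw [Module.finrank_fin_fun, abs_of_pos (by positivity), smul_eq_mul] at h
  have h2 : ∀ x : Fin N → ℝ, gw s N ((√s)⁻¹ • x) = (√s)⁻¹ ^ (N * (N - 1)) * gw 1 N x := by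
    intro x
    unfold gw
    rw [vand_smul N (by positivity)]
    have : s * ∑ i, ((√s)⁻¹ • x) i ^ 2 = 1 * ∑ i, x i ^ 2 := by
      simp only [Pi.smul_apply, smul_eq_mul, mul_pow, ← Finset.mul_sum, inv_pow, sq_sqrt hs.le]
      field_simp
    rw [this]; ring
  simp only [h2] at h
  rw [integral_const_mul] at h
  rw [pow_add, mul_right_comm, h]
  field_simp

lemma integrable_exp_indicator {s : ℝ} (hs : 0 < s) (q : ℝ) :
    Integrable fun v => Set.indicator (Set.Ici q) (fun v => exp (-s * v)) v := by
  rw [integrable_indicator_iff measurableSet_Ici, integrableOn_Ici_iff_integrableOn_Ioi]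
  exact integrableOn_exp_mul_Ioi (by linarith) q

lemma integral_exp_indicator {s : ℝ} (hs : 0 < s) (q : ℝ) :
    ∫ v, Set.indicator (Set.Ici q) (fun v => exp (-s * v)) v = exp (-(s * q)) / s := by
  rw [integral_indicator measurableSet_Ici, integral_Ici_eq_integral_Ioi,
    integral_exp_mul_Ioi (by linarith) q]
  rw [neg_div_neg_eq, neg_mul]

/-- The Gaussian weight is an exponential mixture of the uniform weights on balls. -/
lemma integral_exp_mul_ballInt {N : ℕ} {F : (Fin N → ℝ) → ℝ} {B : ℝ} (hF : Continuous F)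
    (hB : ∀ x, |F x| ≤ B) {s : ℝ} (hs : 0 < s) :
    Integrable (fun v => exp (-s * v) * ballInt N F v) ∧
      ∫ v, exp (-s * v) * ballInt N F v = (∫ x, F x * gw s N x) / s := by
  let K : ℝ × (Fin N → ℝ) → ℝ := fun p =>
    Set.indicator (Set.Ici (∑ i, p.2 i ^ 2)) (fun v => exp (-s * v)) p.1 * (F p.2 * vand 2 N p.2)
  have hset : MeasurableSet {p : ℝ × (Fin N → ℝ) | ∑ i, p.2 i ^ 2 ≤ p.1} :=
    measurableSet_le (by fun_prop) measurable_fst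
  have hKeq : K = Set.indicator {p : ℝ × (Fin N → ℝ) | ∑ i, p.2 i ^ 2 ≤ p.1}
      fun p => exp (-s * p.1) * (F p.2 * vand 2 N p.2) := by
    ext p
    by_cases hp : ∑ i, p.2 i ^ 2 ≤ p.1
    · simp only [K]
      rw [Set.indicator_of_mem (show p.1 ∈ Set.Ici (∑ i, p.2 i ^ 2) from hp),
        Set.indicator_of_mem (show p ∈ {p : ℝ × (Fin N → ℝ) | ∑ i, p.2 i ^ 2 ≤ p.1} from hp)]
    · simp only [K]
      rw [Set.indicator_of_notMem (show p.1 ∉ Set.Ici (∑ i, p.2 i ^ 2) from hp),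
        Set.indicator_of_notMem (show p ∉ {p : ℝ × (Fin N → ℝ) | ∑ i, p.2 i ^ 2 ≤ p.1} from hp),
        zero_mul]
  have hKm : AEStronglyMeasurable K (volume.prod volume) := by
    rw [hKeq]
    refine AEStronglyMeasurable.indicator ?_ hset
    have := continuous_vand N
    exact Continuous.aestronglyMeasurable (by fun_prop)
  have hin : ∀ x, ∫ v, K (v, x) = F x * gw s N x / s := by
    intro x
    simp only [K]
    rw [integral_mul_const, integral_exp_indicator hs, gw]
    ring
  have hKi : Integrable K (volume.prod volume) := by
    rw [integrable_prod_iff' hKm]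
    refine ⟨ae_of_all _ fun x => ?_, ?_⟩
    · change Integrable fun v => Set.indicator (Set.Ici (∑ i, x i ^ 2)) (fun v => exp (-s * v)) v *
        (F x * vand 2 N x)
      exact (integrable_exp_indicator hs (∑ i, x i ^ 2)).mul_const (F x * vand 2 N x)
    refine ((integrable_mul_gw hF hB hs).norm.div_const s).congr (ae_of_all _ fun x => ?_)
    have h1 : ∀ v, ‖K (v, x)‖ = Set.indicator (Set.Ici (∑ i, x i ^ 2)) (fun v => exp (-s * v)) v *
        ‖F x * vand 2 N x‖ := fun v => by
      simp only [K]
      rw [norm_mul, norm_of_nonneg]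
      exact Set.indicator_nonneg (fun _ _ => (exp_pos _).le) _
    change ‖F x * gw s N x‖ / s = ∫ v, ‖K (v, x)‖
    simp only [h1]
    rw [integral_mul_const, integral_exp_indicator hs, gw, ← mul_assoc, norm_mul _ (exp _),
      norm_of_nonneg (exp_pos _).le]
    ring
  have hrow : ∀ v, ∫ x, K (v, x) = exp (-s * v) * ballInt N F v := by
    intro v
    unfold ballInt
    rw [← integral_const_mul]
    refine integral_congr_ae (ae_of_all _ fun x => ?_)
    simp only [hKeq, Set.indicator_apply, Set.mem_ofPred_eq]
    split_ifs <;> simp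
  constructor
  · exact hKi.integral_prod_left.congr (ae_of_all _ hrow)
  · have := integral_integral_swap (f := fun v x => K (v, x)) hKi
    simp only [hrow, hin] at this
    rw [this, integral_div]

/-- The ball integral in the variable `w`, where `v = N / 4 + w / 2`, with exponential tilt. -/
def tilt (N : ℕ) (F : (Fin N → ℝ) → ℝ) (w : ℝ) : ℝ :=
  ballInt N F (N / 4 + w / 2) * exp (-(N * w))

lemma integral_exp_mul_tilt {N : ℕ} {F : (Fin N → ℝ) → ℝ} {B : ℝ} (hF : Continuous F)
    (hB : ∀ x, |F x| ≤ B) {θ : ℝ} (hs : 0 < 2 * N - 2 * θ) :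
    Integrable (fun w => exp (θ * w) * tilt N F w) ∧
      ∫ w, exp (θ * w) * tilt N F w = 2 / (2 * N - 2 * θ) * exp ((2 * N - 2 * θ) * N / 4) *
        ∫ x, F x * gw (2 * N - 2 * θ) N x := by
  obtain ⟨h1, h2⟩ := integral_exp_mul_ballInt hF hB hs
  set s := 2 * N - 2 * θ with hsd
  have e : ∀ w, exp (θ * w) * tilt N F w = exp (s * N / 4) *
      (fun v => exp (-s * v) * ballInt N F v) (N / 4 + (1 / 2) * w) := by
    intro w
    have : exp (s * N / 4) * exp (-s * (N / 4 + (1 / 2) * w)) = exp (θ * w) * exp (-(N * w)) := by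
      rw [← exp_add, ← exp_add, hsd]; ring_nf
    simp only [tilt]
    rw [← mul_assoc (exp (s * N / 4)), this, show (N / 4 + w / 2 : ℝ) = N / 4 + (1 / 2) * w by ring]
    ring
  simp only [e]
  constructor
  · exact ((h1.comp_add_left (N / 4 : ℝ)).comp_mul_left'
      (by norm_num : (1 / 2 : ℝ) ≠ 0)).const_mul _
  · rw [integral_const_mul, Measure.integral_comp_mul_left
      (fun v => (fun v => exp (-s * v) * ballInt N F v) (N / 4 + v)),
      integral_add_left_eq_self (fun v => exp (-s * v) * ballInt N F v), h2]
    norm_num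
    ring

lemma tendsto_sq_mul_log (θ : ℝ) :
    Tendsto (fun N : ℕ => -((N : ℝ) ^ 2 / 2) * log (1 - θ / N) - θ * N / 2) atTop
      (𝓝 (θ ^ 2 / 4)) := by
  rw [tendsto_iff_norm_sub_tendsto_zero]
  have hlim : Tendsto (fun N : ℕ => |θ| ^ 3 / (N : ℝ)) atTop (𝓝 0) :=
    tendsto_const_nhds.div_atTop tendsto_natCast_atTop_atTop
  refine squeeze_zero' (Eventually.of_forall fun _ => norm_nonneg _) ?_ hlim
  filter_upwards [tendsto_natCast_atTop_atTop.eventually_gt_atTop (2 * |θ|)] with N hN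
  have hN0 : (0 : ℝ) < N := by linarith [abs_nonneg θ]
  have hx : |θ / N| < 1 / 2 := by
    rw [abs_div, abs_of_pos hN0, div_lt_iff₀ hN0]; linarith
  have h := abs_log_sub_add_sum_range_le (x := θ / N) (by linarith) 2
  simp only [Finset.sum_range_succ, Finset.sum_range_zero] at h
  norm_num at h
  have e : -((N : ℝ) ^ 2 / 2) * log (1 - θ / N) - θ * N / 2 - θ ^ 2 / 4 =
      -((N : ℝ) ^ 2 / 2) * (θ / N + (θ / N) ^ 2 / 2 + log (1 - θ / N)) := by
    field_simp; ring
  rw [e, norm_mul, norm_eq_abs, norm_eq_abs, abs_neg, abs_of_pos (by positivity)]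
  have h2 : |θ / N + (θ / N) ^ 2 / 2 + log (1 - θ / N)| ≤ 2 * (|θ| ^ 3 / N ^ 3) := by
    have h3 : |θ / N| ^ 3 / (1 - |θ / N|) ≤ |θ / N| ^ 3 / (1 / 2) :=
      div_le_div_of_nonneg_left (by positivity) (by norm_num) (by linarith)
    have h4 : |θ / N| ^ 3 = |θ| ^ 3 / N ^ 3 := by rw [abs_div, abs_of_pos hN0, div_pow]
    rw [h4] at h3
    have h5 : |θ / N + (θ / N) ^ 2 / 2 + log (1 - θ / N)| ≤ |θ / N| ^ 3 / (1 - |θ / N|) := by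
      refine le_trans (le_of_eq ?_) (h.trans (le_of_eq ?_))
      · rfl
      · rw [abs_div, abs_of_pos hN0]
    rw [h4] at h5
    linarith
  calc _ ≤ (N : ℝ) ^ 2 / 2 * (2 * (|θ| ^ 3 / N ^ 3)) := by gcongr
    _ = _ := by field_simp

lemma tendsto_tilt_one_ratio (θ : ℝ) :
    Tendsto (fun N : ℕ => (∫ w, exp (θ * w) * tilt N (fun _ => 1) w) /
      ∫ w, tilt N (fun _ => 1) w) atTop (𝓝 (exp (θ ^ 2 / 4))) := by
  have h1 : Tendsto (fun N : ℕ => exp (-((N : ℝ) ^ 2 / 2) * log (1 - θ / N) - θ * N / 2) /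
      (1 - θ / N)) atTop (𝓝 (exp (θ ^ 2 / 4) / (1 - 0))) :=
    ((continuous_exp.tendsto _).comp (tendsto_sq_mul_log θ)).div
      (tendsto_const_nhds.sub (tendsto_const_nhds.div_atTop tendsto_natCast_atTop_atTop))
      (by norm_num)
  rw [sub_zero, div_one] at h1
  refine h1.congr' ?_
  filter_upwards [tendsto_natCast_atTop_atTop.eventually_gt_atTop (|θ|)] with N hN
  have hθ := abs_lt.1 hN
  have hN0 : (0 : ℝ) < N := by linarith [abs_nonneg θ]
  have hs : 0 < 2 * (N : ℝ) - 2 * θ := by linarith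
  have hs0 : 0 < 2 * (N : ℝ) - 2 * 0 := by linarith
  have hq : 0 < 1 - θ / N := by rw [sub_pos, div_lt_one hN0]; linarith
  have hB : ∀ x : Fin N → ℝ, |(fun _ => (1 : ℝ)) x| ≤ 1 := by simp
  have i1 := (integral_exp_mul_tilt (N := N) continuous_const hB hs).2
  have i0 := (integral_exp_mul_tilt (N := N) continuous_const hB hs0).2
  simp only [zero_mul, exp_zero, one_mul] at i0 i1
  rw [i1, i0, integral_gw_eq hs, integral_gw_eq hs0]
  have hG := integral_gw_pos one_pos N
  have hM : N * (N - 1) + N = N ^ 2 := by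
    cases N with
    | zero => rfl
    | succ m => simp only [Nat.add_sub_cancel]; ring
  rw [hM]
  have e1 : exp (-((N : ℝ) ^ 2 / 2) * log (1 - θ / N) - θ * N / 2) =
      exp (-(θ * N / 2)) * (√(1 - θ / N))⁻¹ ^ (N ^ 2) := by
    rw [inv_pow, ← exp_log (sqrt_pos.2 hq), ← exp_nat_mul, ← exp_neg, ← exp_add,
      log_sqrt hq.le]
    congr 1
    push_cast
    ring
  have e2 : exp ((2 * (N : ℝ) - 2 * θ) * N / 4) =
      exp ((2 * (N : ℝ) - 2 * 0) * N / 4) * exp (-(θ * N / 2)) := by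
    rw [← exp_add]; ring_nf
  have e3 : 2 * (N : ℝ) - 2 * θ = (2 * (N : ℝ) - 2 * 0) * (1 - θ / N) := by field_simp; ring
  rw [e1, e2, e3, sqrt_mul hs0.le, mul_inv, mul_pow]
  have h2 := sqrt_pos.2 hs0
  have h3 := sqrt_pos.2 hq
  clear e1 e2 e3 i0 i1 hs
  generalize (1 - θ / (N : ℝ)) = q at *
  generalize (2 * (N : ℝ) - 2 * 0) = a at *
  field_simp

section Correlation

variable {n : ℕ} {u : ℝ}

lemma abs_dens_mul_le (hu : u ∈ Set.Ioo (-1 : ℝ) 1) (N : ℕ) :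
    |(N * ((2 / π) * √(1 - u ^ 2))) * u| ≤ N := by
  have h1 : √(1 - u ^ 2) ≤ 1 := sqrt_le_one.2 (by nlinarith [sq_nonneg u])
  have h2 : 2 / π ≤ 1 := by rw [div_le_one pi_pos]; linarith [pi_gt_three]
  have h3 : |u| ≤ 1 := (abs_lt.2 hu).le
  have h4 : 0 < 2 / π := by positivity
  rw [abs_mul, abs_of_nonneg (by positivity)]
  have h5 : (2 / π) * √(1 - u ^ 2) ≤ 1 := mul_le_one₀ h2 (sqrt_nonneg _) h1
  calc (N * ((2 / π) * √(1 - u ^ 2))) * |u| ≤ (N * 1) * 1 := by gcongr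
    _ = N := by ring

lemma norm_pi_sub_le {t t' : Fin n → ℝ} {a b m : ℝ} (hm : |b| ≤ m)
    (h : ∀ i, t' i - t i = a * (t i + b)) : ‖t' - t‖ ≤ |a| * (‖t‖ + m) := by
  have hm0 : 0 ≤ m := (abs_nonneg b).trans hm
  rw [pi_norm_le_iff_of_nonneg (by positivity)]
  intro i
  rw [Pi.sub_apply, h i, norm_mul, norm_eq_abs]
  have := norm_le_pi_norm t i
  gcongr
  exact (norm_add_le _ _).trans (add_le_add this hm)

lemma sqrt_one_add_bounds {y : ℝ} (hy : |y| ≤ 3 / 4) :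
    0 < √(1 + y) ∧ |√(1 + y) - 1| ≤ |y| ∧ |(√(1 + y))⁻¹ - 1| ≤ 2 * |y| := by
  have hy' := abs_le.1 hy
  set l := √(1 + y)
  have hl2 : l ^ 2 = 1 + y := sq_sqrt (by linarith)
  have hl0 : 0 ≤ l := sqrt_nonneg _
  have hl : 1 / 2 ≤ l := by
    by_contra hc
    nlinarith [not_le.1 hc]
  have h1 : |l - 1| ≤ |y| := by
    have : y = (l - 1) * (l + 1) := by linarith [hl2, show (l - 1) * (l + 1) = l ^ 2 - 1 by ring]
    rw [this, abs_mul]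
    refine le_mul_of_one_le_right (abs_nonneg _) ?_
    rw [abs_of_nonneg (by linarith)]
    linarith
  refine ⟨by linarith, h1, ?_⟩
  have : l⁻¹ - 1 = -(l - 1) / l := by field_simp; ring
  rw [this, abs_div, abs_neg, abs_of_pos (by linarith : 0 < l), div_le_iff₀ (by linarith)]
  nlinarith [abs_nonneg y]

/-- The localized observable is stable under the small dilations. -/
lemma loc_dilate_sub_le (hu : u ∈ Set.Ioo (-1 : ℝ) 1) {f : (Fin n → ℝ) → ℝ} (hf : Continuous f)
    (hsupp : HasCompactSupport f) {R : ℝ} (hR : 0 ≤ R) (hfR : ∀ t, R < ‖t‖ → f t = 0)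
    {ε : ℝ} (hε : 0 < ε) :
    ∃ δ > 0, ∀ N : ℕ, 1 ≤ N → ∀ w : ℝ, |w| ≤ δ → |2 * w / N| ≤ 3 / 4 ∧ ∀ x : Fin n → ℝ,
      |loc u N f (√(1 + 2 * w / N) • x) - loc u N f x| ≤
        ε * loc u N (tent (R + 1)) (√(1 + 2 * w / N) • x) := by
  obtain ⟨δ', hδ', huc⟩ := Metric.uniformContinuous_iff.1
    (hsupp.uniformContinuous_of_continuous hf) ε hε
  set m := min δ' 1
  have hm : 0 < m := lt_min hδ' one_pos
  refine ⟨m / (8 * (R + 2)), by positivity, fun N hN w hw => ?_⟩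
  have hN0 : (1 : ℝ) ≤ N := by exact_mod_cast hN
  have hw1 : |w| * (8 * (R + 2)) ≤ m := (le_div_iff₀ (by positivity)).1 hw
  have hm1 : m ≤ 1 := min_le_right _ _
  have hyabs : |2 * w / N| = 2 * |w| / N := by
    rw [abs_div, abs_mul, abs_two, abs_of_pos (by linarith : (0 : ℝ) < N)]
  have hyw : |2 * w / N| ≤ 2 * |w| := by
    rw [hyabs]; exact div_le_self (by positivity) hN0
  have hy : |2 * w / N| ≤ 3 / 4 := by nlinarith [abs_nonneg w]
  refine ⟨hy, fun x => ?_⟩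
  obtain ⟨hl, h1, h2⟩ := sqrt_one_add_bounds hy
  set l := √(1 + 2 * w / N)
  have hsmall : |2 * w / N| * (R + 1 + N) ≤ m / 4 := by
    rw [hyabs, div_mul_eq_mul_div, div_le_iff₀ (by linarith)]
    have : R + 1 + N ≤ (R + 2) * N := by nlinarith
    nlinarith [mul_le_mul_of_nonneg_left this (abs_nonneg w), abs_nonneg w]
  unfold loc
  have hcu := abs_dens_mul_le hu N
  set c := N * ((2 / π) * √(1 - u ^ 2))
  set t' : Fin n → ℝ := fun i => c * ((l • x) i - u) with ht'
  set t : Fin n → ℝ := fun i => c * (x i - u) with ht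
  have d1 : ‖t' - t‖ ≤ |l - 1| * (‖t‖ + N) := norm_pi_sub_le hcu fun i => by
    simp only [ht', ht, Pi.smul_apply, smul_eq_mul]; ring
  have d2 : ‖t - t'‖ ≤ |l⁻¹ - 1| * (‖t'‖ + N) := norm_pi_sub_le hcu fun i => by
    simp only [ht', ht, Pi.smul_apply, smul_eq_mul]; field_simp; ring
  rcases le_or_gt ‖t'‖ (R + 1) with h | h
  · rw [tent_eq_one h, mul_one]
    have d3 : dist t' t < δ' := by
      rw [dist_comm, dist_eq_norm]
      calc ‖t - t'‖ ≤ |l⁻¹ - 1| * (‖t'‖ + N) := d2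
        _ ≤ (2 * |2 * w / N|) * (R + 1 + N) := by gcongr
        _ ≤ m / 2 := by linarith
        _ < δ' := by linarith [min_le_left δ' 1]
    exact (huc d3).le
  · have d3 : R < ‖t‖ := by
      by_contra hc
      rw [not_lt] at hc
      have d4 : ‖t' - t‖ ≤ 1 := by
        calc ‖t' - t‖ ≤ |l - 1| * (‖t‖ + N) := d1
          _ ≤ |2 * w / N| * (R + 1 + N) := by gcongr; linarith
          _ ≤ 1 := by linarith
      have := norm_le_norm_add_norm_sub' t' t
      linarith
    rw [hfR t d3, hfR t' (by linarith), sub_zero, abs_zero]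
    exact mul_nonneg hε.le (tent_nonneg _ _)

lemma tilt_eq_scale {N : ℕ} (F : (Fin N → ℝ) → ℝ) {w : ℝ} (hN : 1 ≤ N)
    (hw : |2 * w / N| ≤ 3 / 4) :
    tilt N F w = √(1 + 2 * w / N) ^ (N * (N - 1) + N) * exp (-(N * w)) *
      ballInt N (fun x => F (√(1 + 2 * w / N) • x)) (N / 4) := by
  have hl := (sqrt_one_add_bounds hw).1
  have hN0 : (1 : ℝ) ≤ N := by exact_mod_cast hN
  have h : (N : ℝ) / 4 + w / 2 = √(1 + 2 * w / N) ^ 2 * (N / 4) := by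
    rw [sq_sqrt (by linarith [(abs_le.1 hw).1])]
    field_simp; ring
  rw [tilt, h, ballInt_scale hl]
  ring

/-- The unnormalized, tilted correlation average of the localized observable. -/
def corr (u : ℝ) (f : (Fin n → ℝ) → ℝ) (N : ℕ) (w : ℝ) : ℝ :=
  if h : n ≤ N then (N.factorial : ℝ) / (N - n).factorial *
    tilt N (fun x => loc u N f (head h x)) w else 0

lemma tilt_nonneg {N : ℕ} {F : (Fin N → ℝ) → ℝ} (h : ∀ x, 0 ≤ F x) (w : ℝ) : 0 ≤ tilt N F w :=
  mul_nonneg (ballInt_nonneg h _) (exp_pos _).le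

lemma corr_nonneg {f : (Fin n → ℝ) → ℝ} (h : ∀ x, 0 ≤ f x) (N : ℕ) (w : ℝ) :
    0 ≤ corr u f N w := by
  unfold corr
  split_ifs with hn
  · exact mul_nonneg (by positivity) (tilt_nonneg (fun x => h _) w)
  · exact le_rfl

section bounded

variable {f : (Fin n → ℝ) → ℝ} {B : ℝ}

lemma continuous_loc_head (hf : Continuous f) {N : ℕ} (h : n ≤ N) :
    Continuous fun x : Fin N → ℝ => loc u N f (head h x) :=
  (continuous_loc hf N).comp (continuous_head h)

lemma integrable_exp_mul_corr (hf : Continuous f) (hB : ∀ x, |f x| ≤ B) {N : ℕ} {θ : ℝ}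
    (hs : 0 < 2 * N - 2 * θ) : Integrable fun w => exp (θ * w) * corr u f N w := by
  unfold corr
  split_ifs with h
  · refine ((integral_exp_mul_tilt (continuous_loc_head (u := u) hf h)
      (fun x => hB _) hs).1.const_mul ((N.factorial : ℝ) / (N - n).factorial)).congr
      (ae_of_all _ fun w => ?_)
    simp only
    ring
  · simp

lemma corr_ratio (hf : Continuous f) (hB : ∀ x, |f x| ≤ B) {N : ℕ} (h : n ≤ N) {θ : ℝ}
    (hs : 0 < 2 * N - 2 * θ) :
    (∫ w, exp (θ * w) * corr u f N w) / ∫ w, exp (θ * w) * tilt N (fun _ => 1) w =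
      ∫ x, loc u N f ((√(2 * N - 2 * θ))⁻¹ • x) * kdet N x := by
  rw [← gue_ratio h hs (continuous_loc hf N) (fun x => hB _)]
  have i1 := (integral_exp_mul_tilt (continuous_loc_head (u := u) hf h) (fun x => hB _) hs).2
  have i0 := (integral_exp_mul_tilt (N := N) (F := fun _ => 1) continuous_const (B := 1)
    (by simp) hs).2
  simp only [one_mul] at i0
  have e : ∫ w, exp (θ * w) * corr u f N w = (N.factorial : ℝ) / (N - n).factorial *
      ∫ w, exp (θ * w) * tilt N (fun x => loc u N f (head h x)) w := by
    rw [← integral_const_mul]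
    refine integral_congr_ae (ae_of_all _ fun w => ?_)
    simp only [corr, dif_pos h]
    ring
  rw [e, i1, i0]
  have := integral_gw_pos hs N
  have := exp_pos ((2 * N - 2 * θ) * N / 4)
  rw [mul_div_assoc, mul_div_mul_left _ _ (by positivity)]

lemma tendsto_corr_ratio (hu : u ∈ Set.Ioo (-1 : ℝ) 1) (hf : Continuous f)
    (hsupp : HasCompactSupport f) (θ : ℝ) :
    Tendsto (fun N : ℕ => (∫ w, exp (θ * w) * corr u f N w) /
      ∫ w, exp (θ * w) * tilt N (fun _ => 1) w) atTop
      (𝓝 (∫ t, f t * Matrix.det (Matrix.of fun j k => Ksine (t j) (t k)))) := by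
  obtain ⟨B, hB⟩ := hf.bounded_above_of_compact_support hsupp
  refine (tendsto_gue hu θ hf hsupp).congr' ?_
  filter_upwards [eventually_ge_atTop n, tendsto_natCast_atTop_atTop.eventually_gt_atTop θ]
    with N h1 h2
  exact (corr_ratio hf hB h1 (by linarith)).symm

/-- The localized correlation average is nearly constant for small `w`. -/
lemma abs_corr_sub_le (hf : Continuous f) (hB : ∀ x, |f x| ≤ B) {g : (Fin n → ℝ) → ℝ}
    (hg : Continuous g) {B' : ℝ} (hB' : ∀ x, |g x| ≤ B') {N : ℕ} (hN : 1 ≤ N) {w ε : ℝ}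
    (hw : |2 * w / N| ≤ 3 / 4)
    (hfg : ∀ x : Fin n → ℝ, |loc u N f (√(1 + 2 * w / N) • x) - loc u N f x| ≤
        ε * loc u N g (√(1 + 2 * w / N) • x)) :
    |corr u f N w - corr u f N 0 / tilt N (fun _ => 1) 0 * tilt N (fun _ => 1) w| ≤
      ε * corr u g N w := by
  unfold corr
  split_ifs with h
  · set C := (N.factorial : ℝ) / (N - n).factorial
    have hC : 0 ≤ C := by positivity
    set F : (Fin N → ℝ) → ℝ := fun x => loc u N f (head h x)
    set G : (Fin N → ℝ) → ℝ := fun x => loc u N g (head h x)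
    have hFc : Continuous F := continuous_loc_head hf h
    have hGc : Continuous G := continuous_loc_head hg h
    rw [tilt_eq_scale F hN hw, tilt_eq_scale G hN hw, tilt_eq_scale (fun _ => 1) hN hw]
    set l := √(1 + 2 * w / N)
    have hl : 0 < l := (sqrt_one_add_bounds hw).1
    set A := l ^ (N * (N - 1) + N) * exp (-(N * w))
    have hA : 0 < A := by positivity
    have hsm : Continuous fun x : Fin N → ℝ => l • x := continuous_const_smul l
    have e0 : C * tilt N F 0 / tilt N (fun _ => 1) 0 * (A * ballInt N (fun _ => 1) (N / 4)) =
        C * A * ballInt N F (N / 4) := by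
      rw [← ballInt_div_mul hFc (fun x => hB _) (N / 4 : ℝ)]
      simp only [tilt, zero_div, add_zero, mul_zero, neg_zero, exp_zero, mul_one]
      ring
    rw [e0]
    have hbF : ∀ x, |F (l • x)| ≤ B := fun x => hB _
    have hbG : ∀ x, |G (l • x)| ≤ B' := fun x => hB' _
    have hbF0 : ∀ x, |F x| ≤ B := fun x => hB _
    have e1 : |ballInt N (fun x => F (l • x)) (N / 4) - ballInt N F (N / 4)| ≤
        ε * ballInt N (fun x => G (l • x)) (N / 4) := by
      rw [← ballInt_sub (F := fun x => F (l • x)) (hFc.comp hsm) hbF hFc hbF0, ← ballInt_const_mul]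
      have hd : Continuous fun x => F (l • x) - F x := (hFc.comp hsm).sub hFc
      have hdb : ∀ x, |F (l • x) - F x| ≤ B + B := fun x =>
        (abs_sub _ _).trans (add_le_add (hbF x) (hbF0 x))
      have hGd : Continuous fun x => ε * G (l • x) := continuous_const.mul (hGc.comp hsm)
      have hGb : ∀ x, |ε * G (l • x)| ≤ |ε| * B' := fun x => by
        rw [abs_mul]; gcongr; exact hbG x
      have hpt : ∀ x, |F (l • x) - F x| ≤ ε * G (l • x) := fun x => hfg (head h x)
      rw [abs_le]
      constructor
      · have := ballInt_mono (F := fun x => (-1) * (ε * G (l • x))) (B := |ε| * B')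
          (continuous_const.mul hGd) (fun x => by simpa using hGb x) hd hdb
          (fun x => by linarith [(abs_le.1 (hpt x)).1]) (N / 4 : ℝ)
        rw [ballInt_const_mul] at this
        linarith
      · exact ballInt_mono hd hdb hGd hGb (fun x => (abs_le.1 (hpt x)).2) _
    rw [show C * (A * ballInt N (fun x => F (l • x)) (N / 4)) - C * A * ballInt N F (N / 4) =
      (C * A) * (ballInt N (fun x => F (l • x)) (N / 4) - ballInt N F (N / 4)) by ring,
      abs_mul, abs_of_nonneg (by positivity)]
    calc _ ≤ (C * A) * (ε * ballInt N (fun x => G (l • x)) (N / 4)) := by gcongr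
      _ = _ := by ring
  · simp

end bounded

lemma eventually_integral_tilt_pos (θ : ℝ) :
    ∀ᶠ N : ℕ in atTop, 0 < ∫ w, exp (θ * w) * tilt N (fun _ => 1) w := by
  filter_upwards [tendsto_natCast_atTop_atTop.eventually_gt_atTop θ] with N hN
  have hs : 0 < 2 * (N : ℝ) - 2 * θ := by linarith
  rw [(integral_exp_mul_tilt (N := N) (F := fun _ => 1) continuous_const (B := 1) (by simp) hs).2]
  simp only [one_mul]
  have := integral_gw_pos hs N
  positivity

lemma tendsto_corr_test (hu : u ∈ Set.Ioo (-1 : ℝ) 1) {f : (Fin n → ℝ) → ℝ} (hf : Continuous f)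
    (hsupp : HasCompactSupport f) (h0 : ∀ t, 0 ≤ f t) (φ : BoundedContinuousFunction ℝ ℝ) :
    Tendsto (fun N : ℕ => (∫ w, φ w * corr u f N w) / ∫ w, tilt N (fun _ => 1) w) atTop
      (𝓝 ((∫ t, f t * Matrix.det (Matrix.of fun j k => Ksine (t j) (t k))) *
        ∫ x, φ x ∂(halfGaussian : Measure ℝ))) := by
  obtain ⟨B, hB⟩ := hf.bounded_above_of_compact_support hsupp
  refine tendsto_integral_test (corr_nonneg h0) (fun N => tilt_nonneg fun _ => zero_le_one)
    eventually_integral_tilt_pos (fun θ => ?_) tendsto_tilt_one_ratio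
    (tendsto_corr_ratio hu hf hsupp) φ
  filter_upwards [tendsto_natCast_atTop_atTop.eventually_gt_atTop θ] with N hN
  exact integrable_exp_mul_corr hf hB (by linarith)

/-- A bounded continuous bump with value one at the origin, supported in `[-δ, δ]`. -/
def bump (δ : ℝ) : BoundedContinuousFunction ℝ ℝ :=
  BoundedContinuousFunction.ofNormedAddCommGroup (fun w => tent 0 (w / δ))
    ((continuous_tent 0).comp (continuous_id.div_const δ)) 1 fun w => by
      rw [norm_of_nonneg (tent_nonneg _ _)]; exact tent_le_one _ _

lemma bump_nonneg (δ w : ℝ) : 0 ≤ bump δ w := tent_nonneg _ _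

lemma bump_eq_zero {δ w : ℝ} (hδ : 0 < δ) (h : δ ≤ |w|) : bump δ w = 0 := by
  refine tent_eq_zero ?_
  rw [norm_eq_abs, abs_div, abs_of_pos hδ, zero_add, le_div_iff₀ hδ]
  linarith

lemma integral_bump_pos {δ : ℝ} (hδ : 0 < δ) :
    0 < ∫ x, bump δ x ∂(halfGaussian : Measure ℝ) := by
  refine integral_halfGaussian_pos (bump δ).continuous ?_ (bump_nonneg δ) ?_
  · refine HasCompactSupport.intro (isCompact_closedBall (0 : ℝ) δ) fun w hw => ?_
    rw [mem_closedBall_zero_iff, not_le] at hw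
    exact bump_eq_zero hδ hw.le
  · have : bump δ 0 = 1 := tent_eq_one (by simp)
    rw [this]; exact one_ne_zero

lemma tendsto_corr_zero_of_nonneg (hu : u ∈ Set.Ioo (-1 : ℝ) 1) {f : (Fin n → ℝ) → ℝ}
    (hf : Continuous f) (hsupp : HasCompactSupport f) (h0 : ∀ t, 0 ≤ f t) :
    Tendsto (fun N : ℕ => corr u f N 0 / tilt N (fun _ => 1) 0) atTop
      (𝓝 (∫ t, f t * Matrix.det (Matrix.of fun j k => Ksine (t j) (t k)))) := by
  obtain ⟨B, hB⟩ := hf.bounded_above_of_compact_support hsupp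
  obtain ⟨R, hR, hfR⟩ : ∃ R : ℝ, 0 ≤ R ∧ ∀ t, R < ‖t‖ → f t = 0 := by
    obtain ⟨R, hR⟩ := hsupp.isBounded.subset_closedBall 0
    refine ⟨max R 0, le_max_right _ _, fun t ht => ?_⟩
    by_contra hc
    have := hR (subset_tsupport f hc)
    rw [mem_closedBall_zero_iff] at this
    exact absurd (this.trans (le_max_left R 0)) (not_le.2 ht)
  set g : (Fin n → ℝ) → ℝ := tent (R + 1)
  have hg : Continuous g := continuous_tent _
  have hgB : ∀ t, |g t| ≤ 1 := fun t => by
    rw [abs_of_nonneg (tent_nonneg _ _)]; exact tent_le_one _ _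
  set c := ∫ t, f t * Matrix.det (Matrix.of fun j k => Ksine (t j) (t k))
  have hgt := tendsto_corr_test hu hg (hasCompactSupport_tent _) (tent_nonneg _)
  set c' := ∫ t, g t * Matrix.det (Matrix.of fun j k => Ksine (t j) (t k))
  have hc' : 0 ≤ c' := by
    refine ge_of_tendsto' (tendsto_corr_ratio hu hg (hasCompactSupport_tent _) 0) fun N => ?_
    exact div_nonneg (integral_nonneg fun w =>
      mul_nonneg (exp_pos _).le (corr_nonneg (tent_nonneg _) N w))
      (integral_nonneg fun w => mul_nonneg (exp_pos _).le (tilt_nonneg (fun _ => zero_le_one) w))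
  rw [Metric.tendsto_nhds]
  intro ε hε
  set ε₁ := ε / (c' + 1)
  have hε₁ : 0 < ε₁ := by positivity
  obtain ⟨δ, hδ, hclose⟩ := loc_dilate_sub_le hu hf hsupp hR hfR hε₁
  have hA := integral_bump_pos hδ
  set A := ∫ x, bump δ x ∂(halfGaussian : Measure ℝ)
  have hk0 : ∀ᶠ N : ℕ in atTop, 0 < ∫ w, tilt N (fun _ => 1) w := by
    simpa using eventually_integral_tilt_pos 0
  have tk : Tendsto (fun N : ℕ => (∫ w, bump δ w * tilt N (fun _ => 1) w) /
      ∫ w, tilt N (fun _ => 1) w) atTop (𝓝 A) :=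
    tendsto_integral_density (fun N => tilt_nonneg fun _ => zero_le_one) hk0
      tendsto_tilt_one_ratio (bump δ)
  have ta := tendsto_corr_test hu hf hsupp h0 (bump δ)
  have tg := hgt (bump δ)
  have hlim := ((tg.const_mul ε₁).add (ta.sub (tk.const_mul c)).abs).div tk hA.ne'
  have hval : (ε₁ * (c' * A) + |c * A - c * A|) / A < ε := by
    rw [sub_self, abs_zero, add_zero, ← mul_assoc, mul_div_cancel_right₀ _ hA.ne']
    simp only [ε₁]
    rw [div_mul_eq_mul_div, div_lt_iff₀ (by positivity)]
    nlinarith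
  filter_upwards [hlim.eventually_lt_const hval, tk.eventually_const_lt hA, hk0,
    eventually_ge_atTop 1] with N h1 h2 h3 h4
  refine lt_of_le_of_lt ?_ h1
  have hs : 0 < 2 * (N : ℝ) - 2 * 0 := by
    have : (1 : ℝ) ≤ N := by exact_mod_cast h4
    linarith
  have ik : Integrable (tilt N fun _ => 1) := by
    simpa using (integral_exp_mul_tilt (N := N) (F := fun _ => 1) continuous_const (B := 1)
      (by simp) hs).1
  have ia : Integrable (corr u f N) := by simpa using integrable_exp_mul_corr (u := u) hf hB hs
  have ig : Integrable (corr u g N) := by simpa using integrable_exp_mul_corr (u := u) hg hgB hs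
  have bdd : ∀ {q : ℝ → ℝ}, Integrable q → Integrable fun w => bump δ w * q w := fun hq =>
    hq.bdd_mul (bump δ).continuous.aestronglyMeasurable (ae_of_all _ (bump δ).norm_coe_le_norm)
  simp only [Pi.div_apply] at h1 ⊢
  set X := corr u f N 0 / tilt N (fun _ => 1) 0
  have key : |(∫ w, bump δ w * corr u f N w) - X * ∫ w, bump δ w * tilt N (fun _ => 1) w| ≤
      ε₁ * ∫ w, bump δ w * corr u g N w := by
    rw [← integral_const_mul, ← integral_const_mul,
      ← integral_sub (bdd ia) ((bdd ik).const_mul X)]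
    refine abs_integral_le_integral_abs.trans
      (integral_mono ((bdd ia).sub ((bdd ik).const_mul X)).abs ((bdd ig).const_mul ε₁) fun w => ?_)
    simp only
    rcases lt_or_ge |w| δ with hw | hw
    · obtain ⟨hw1, hw2⟩ := hclose N h4 w hw.le
      have := abs_corr_sub_le hf hB hg hgB h4 hw1 hw2
      rw [show bump δ w * corr u f N w - X * (bump δ w * tilt N (fun _ => 1) w) =
        bump δ w * (corr u f N w - X * tilt N (fun _ => 1) w) by ring, abs_mul,
        abs_of_nonneg (bump_nonneg δ w)]
      calc _ ≤ bump δ w * (ε₁ * corr u g N w) := by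
            gcongr
            exact bump_nonneg δ w
        _ = _ := by ring
    · simp [bump_eq_zero hδ hw]
  set I := ∫ w, tilt N (fun _ => 1) w
  set k := ∫ w, bump δ w * tilt N (fun _ => 1) w
  set a := ∫ w, bump δ w * corr u f N w
  set b := ∫ w, bump δ w * corr u g N w
  rw [dist_eq_norm, norm_eq_abs, le_div_iff₀ h2, ← abs_of_pos h2, ← abs_mul, abs_of_pos h2]
  have key2 : |a / I - X * (k / I)| ≤ ε₁ * (b / I) := by
    rw [show a / I - X * (k / I) = (a - X * k) / I by ring, abs_div, abs_of_pos h3,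
      show ε₁ * (b / I) = (ε₁ * b) / I by ring]
    gcongr
  calc |(X - c) * (k / I)| = |(a / I - c * (k / I)) - (a / I - X * (k / I))| := by
        congr 1; ring
    _ ≤ |a / I - c * (k / I)| + |a / I - X * (k / I)| := abs_sub _ _
    _ ≤ _ := by linarith

lemma continuous_det_Ksine :
    Continuous fun t : Fin n → ℝ => Matrix.det (Matrix.of fun j k => Ksine (t j) (t k)) := by
  have h : ∀ x y, Ksine x y = sinc (π * (x - y)) := by
    intro x y
    unfold Ksine sinc
    simp only [mul_eq_zero, pi_ne_zero, false_or, sub_eq_zero]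
  simp only [h]
  refine Continuous.matrix_det (continuous_matrix fun j k => ?_)
  simp only [Matrix.of_apply]
  exact continuous_sinc.comp (by fun_prop)

lemma corr_sub {f g : (Fin n → ℝ) → ℝ} {B B' : ℝ} (hf : Continuous f) (hB : ∀ x, |f x| ≤ B)
    (hg : Continuous g) (hB' : ∀ x, |g x| ≤ B') (N : ℕ) (w : ℝ) :
    corr u (fun t => f t - g t) N w = corr u f N w - corr u g N w := by
  unfold corr
  split_ifs with h
  · have := ballInt_sub (continuous_loc_head (u := u) hf h) (fun x => hB _)
      (continuous_loc_head (u := u) hg h) (fun x => hB' _) (N / 4 + w / 2)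
    simp only [tilt]
    rw [show (fun x => loc u N (fun t => f t - g t) (head h x)) =
      fun x => loc u N f (head h x) - loc u N g (head h x) from rfl, this]
    ring
  · simp

lemma tendsto_corr_zero (hu : u ∈ Set.Ioo (-1 : ℝ) 1) {f : (Fin n → ℝ) → ℝ}
    (hf : Continuous f) (hsupp : HasCompactSupport f) :
    Tendsto (fun N : ℕ => corr u f N 0 / tilt N (fun _ => 1) 0) atTop
      (𝓝 (∫ t, f t * Matrix.det (Matrix.of fun j k => Ksine (t j) (t k)))) := by
  set fp : (Fin n → ℝ) → ℝ := fun t => max (f t) 0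
  set fm : (Fin n → ℝ) → ℝ := fun t => max (-f t) 0
  have hp : Continuous fp := hf.max continuous_const
  have hm : Continuous fm := hf.neg.max continuous_const
  have hps : HasCompactSupport fp :=
    hsupp.comp_left (g := fun y : ℝ => max y 0) (by simp)
  have hms : HasCompactSupport fm :=
    hsupp.comp_left (g := fun y : ℝ => max (-y) 0) (by simp)
  obtain ⟨B, hB⟩ := hp.bounded_above_of_compact_support hps
  obtain ⟨B', hB'⟩ := hm.bounded_above_of_compact_support hms
  have hsub : f = fun t => fp t - fm t := by
    ext t
    simp only [fp, fm]
    rcases le_total 0 (f t) with h | h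
    · rw [max_eq_left h, max_eq_right (by linarith)]; ring
    · rw [max_eq_right h, max_eq_left (by linarith)]; ring
  have t := (tendsto_corr_zero_of_nonneg hu hp hps fun _ => le_max_right _ _).sub
    (tendsto_corr_zero_of_nonneg hu hm hms fun _ => le_max_right _ _)
  have ip : Integrable fun t : Fin n → ℝ =>
      fp t * Matrix.det (Matrix.of fun j k => Ksine (t j) (t k)) :=
    (hp.mul continuous_det_Ksine).integrable_of_hasCompactSupport hps.mul_right
  have im : Integrable fun t : Fin n → ℝ =>
      fm t * Matrix.det (Matrix.of fun j k => Ksine (t j) (t k)) :=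
    (hm.mul continuous_det_Ksine).integrable_of_hasCompactSupport hms.mul_right
  rw [← integral_sub ip im] at t
  rw [hsub]
  convert t using 2 with N
  · rw [corr_sub hp hB hm hB', sub_div]
  · refine congrArg _ (funext fun t => ?_)
    ring

lemma integral_Rbt_eq (hu : u ∈ Set.Ioo (-1 : ℝ) 1) {f : (Fin n → ℝ) → ℝ} (hf : Continuous f)
    (hsupp : HasCompactSupport f) {N : ℕ} (h : n ≤ N) (hN : 0 < N) :
    ∫ t : Fin n → ℝ, f t * (1 / (N * ((2 / π) * √(1 - u ^ 2)))) ^ n *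
      Rbt 2 n N (√N / 2) (fun i => u + t i / (N * ((2 / π) * √(1 - u ^ 2)))) =
      corr u f N 0 / tilt N (fun _ => 1) 0 := by
  obtain ⟨B, hB⟩ := hf.bounded_above_of_compact_support hsupp
  have hN0 : (0 : ℝ) < N := by exact_mod_cast hN
  have hc : 0 < N * ((2 / π) * √(1 - u ^ 2)) := mul_pos hN0 (dens_pos hu)
  have hr : (√(N : ℝ) / 2) ^ 2 = N / 4 := by rw [div_pow, sq_sqrt hN0.le]; norm_num
  set G : (Fin N → ℝ) → ℝ := Set.indicator {z : Fin N → ℝ | ∑ i, z i ^ 2 ≤ N / 4} (vand 2 N)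
  have hball : ∀ F : (Fin N → ℝ) → ℝ, ballInt N F (N / 4) = ∫ x, F x * G x := fun F => by
    unfold ballInt
    simp only [G, Set.indicator_mul_right]
  have hint : Integrable fun x => loc u N f (head h x) * G x := by
    have := integrable_ballInt (continuous_loc_head (u := u) hf h) (fun x => hB _) (N / 4 : ℝ)
    refine this.congr (ae_of_all _ fun x => ?_)
    simp only [G, Set.indicator_mul_right]
  have hZ : Zbt 2 N (√N / 2) = ballInt N (fun _ => 1) (N / 4) := by
    rw [hball]
    simp only [one_mul, Zbt, hr, G]
  set Ψ : (Fin n → ℝ) → ℝ := fun x => loc u N f x * Rbt 2 n N (√N / 2) x with hΨ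
  have e1 : ∫ x, Ψ x = (N.factorial : ℝ) / (N - n).factorial *
      (ballInt N (fun _ => 1) (N / 4))⁻¹ *
      ballInt N (fun x => loc u N f (head h x)) (N / 4) := by
    rw [hball (fun x => loc u N f (head h x)), integral_head_mul h hint, ← integral_const_mul]
    refine integral_congr_ae (ae_of_all _ fun x => ?_)
    simp only [hΨ, Rbt, hZ, hr, G]
    ring
  set c := N * ((2 / π) * √(1 - u ^ 2)) with hcd
  have e2 : ∀ t : Fin n → ℝ, f t * (1 / c) ^ n * Rbt 2 n N (√N / 2) (fun i => u + t i / c) =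
      (1 / c) ^ n * Ψ ((fun _ => u) + c⁻¹ • t) := by
    intro t
    have e3 : loc u N f ((fun _ => u) + c⁻¹ • t) = f t := by
      unfold loc
      rw [← hcd]
      congr 1
      ext i
      simp only [Pi.add_apply, Pi.smul_apply, smul_eq_mul]
      field_simp
      ring
    have e4 : (fun i => u + t i / c) = (fun _ => u) + c⁻¹ • t := by
      ext i
      simp only [Pi.add_apply, Pi.smul_apply, smul_eq_mul]
      ring
    simp only [hΨ]
    rw [e3, e4]
    ring
  simp only [e2]
  rw [integral_const_mul, Measure.integral_comp_smul volume (fun t => Ψ ((fun _ => u) + t)),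
    integral_add_left_eq_self Ψ, e1, Module.finrank_fin_fun, smul_eq_mul, corr, dif_pos h]
  simp only [tilt, zero_div, add_zero, mul_zero, neg_zero, exp_zero, mul_one]
  rw [abs_of_pos (by positivity), inv_pow, inv_inv, one_div, inv_pow, ← mul_assoc,
    inv_mul_cancel₀ (by positivity)]
  ring

end Correlation

end BTGUE

end

/-- Sine-kernel universality in the bulk for the bounded trace GUE. -/
theorem bounded_trace_GUE_sine_in_bulk (n : ℕ) (hn : 1 ≤ n)
    (u : ℝ) (hu : u ∈ Set.Ioo (-1 : ℝ) 1)
    (f : (Fin n → ℝ) → ℝ) (hf : Continuous f) (hsupp : HasCompactSupport f) :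
    Filter.Tendsto
      (fun N : ℕ => ∫ t : Fin n → ℝ,
        f t * (1 / (N * ((2 / π) * Real.sqrt (1 - u ^ 2)))) ^ n *
          Rbt 2 n N (Real.sqrt N / 2)
            (fun i => u + t i / (N * ((2 / π) * Real.sqrt (1 - u ^ 2)))))
      atTop
      (𝓝 (∫ t : Fin n → ℝ,
        f t * Matrix.det (Matrix.of fun j k : Fin n => Ksine (t j) (t k)))) := by
  refine (BTGUE.tendsto_corr_zero hu hf hsupp).congr' ?_
  filter_upwards [eventually_ge_atTop n] with N hN
  exact (BTGUE.integral_Rbt_eq hu hf hsupp hN (by omega)).symm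
end

section
/- Let β > 0 and let n ≥ 0 be an integer. Let (α_N) be a sequence of positive reals with α_N → 0 and α_N·N/√(ln N) → ∞ as N → ∞. Set N_β = N + βN(N−1)/2, C_{Nβ} = Γ(N_β/2)·2^{N_β/2−1}·β^{−N_β/2}, and J_N = (1/C_{Nβ}) ∫_{(N/√2)(1+α_N)}^{∞} e^{−βu²/2} u^{N_β−n−1} du. Then limsup_{N→∞} (log J_N)/((N·α_N)²) ≤ −β/2; that is, J_N = O(e^{−0.5β(Nα_N)²(1+o(1))}). -/
open MeasureTheory Filter Real Topology

/-- The function `u ↦ e^{-βu²/2} u^q`. -/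
noncomputable def radialWeight (β q u : ℝ) : ℝ := Real.exp (-(β * u ^ 2 / 2)) * u ^ q

lemma radialWeight_pos (β q : ℝ) {u : ℝ} (hu : 0 < u) : 0 < radialWeight β q u :=
  mul_pos (Real.exp_pos _) (Real.rpow_pos_of_pos hu _)

lemma radialWeight_eq_exp (β q : ℝ) {u : ℝ} (hu : 0 < u) :
    radialWeight β q u = Real.exp (-(β * u ^ 2 / 2) + q * Real.log u) := by
  rw [radialWeight, Real.rpow_def_of_pos hu, ← Real.exp_add, mul_comm (Real.log u)]

lemma radialWeight_le {β q R u : ℝ} (hq : 0 ≤ q) (hR : 0 < R) (hu : 0 < u) :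
    radialWeight β q u ≤
      radialWeight β q R * Real.exp ((q / R - β * R) * (u - R) - β / 2 * (u - R) ^ 2) := by
  rw [radialWeight_eq_exp β q hu, radialWeight_eq_exp β q hR, ← Real.exp_add, Real.exp_le_exp]
  have h := Real.log_le_sub_one_of_pos (div_pos hu hR)
  rw [Real.log_div hu.ne' hR.ne'] at h
  have h2 := mul_le_mul_of_nonneg_left h hq
  have h3 : q * (u / R - 1) = q / R * (u - R) := by field_simp
  nlinarith

lemma le_radialWeight {β q R u : ℝ} (hq : 0 ≤ q) (hR : 0 < R) (hu : R ≤ u) :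
    radialWeight β q R *
        Real.exp ((q / R - β * R) * (u - R) - (β / 2 + q / R ^ 2) * (u - R) ^ 2) ≤
      radialWeight β q u := by
  have hu0 : 0 < u := hR.trans_le hu
  rw [radialWeight_eq_exp β q hu0, radialWeight_eq_exp β q hR, ← Real.exp_add, Real.exp_le_exp]
  have h := Real.one_sub_inv_le_log_of_pos (div_pos hu0 hR)
  rw [Real.log_div hu0.ne' hR.ne'] at h
  have h1 : (u - R) / R - (u - R) ^ 2 / R ^ 2 ≤ 1 - (u / R)⁻¹ := by
    have : 1 - (u / R)⁻¹ - ((u - R) / R - (u - R) ^ 2 / R ^ 2) = (u - R) ^ 3 / (u * R ^ 2) := by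
      field_simp
      ring
    have h4 : 0 ≤ (u - R) ^ 3 / (u * R ^ 2) := by
      have := sub_nonneg.2 hu
      positivity
    linarith
  have h2 := mul_le_mul_of_nonneg_left (h1.trans h) hq
  have h3 : q * ((u - R) / R - (u - R) ^ 2 / R ^ 2) =
      q / R * (u - R) - q / R ^ 2 * (u - R) ^ 2 := by
    field_simp
  nlinarith

lemma integrableOn_radialWeight {β q a : ℝ} (hβ : 0 < β) (hq : 0 ≤ q) (ha : 0 ≤ a) :
    IntegrableOn (radialWeight β q) (Set.Ioi a) := by
  have h := integrableOn_rpow_mul_exp_neg_mul_sq (half_pos hβ) (show -1 < q by linarith)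
  refine (h.congr_fun (fun x _ => ?_) measurableSet_Ioi).mono_set (Set.Ioi_subset_Ioi ha)
  simp only [radialWeight]
  rw [mul_comm]
  congr 2
  ring

lemma integral_radialWeight_Ioi_pos {β q a : ℝ} (hβ : 0 < β) (hq : 0 ≤ q) (ha : 0 ≤ a) :
    0 < ∫ u in Set.Ioi a, radialWeight β q u := by
  have hpos : ∀ u ∈ Set.Ioi a, 0 < radialWeight β q u := fun u hu =>
    radialWeight_pos β q (ha.trans_lt hu)
  rw [setIntegral_pos_iff_support_of_nonneg_ae ?_ (integrableOn_radialWeight hβ hq ha)]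
  · have hsub : Set.Ioi a ⊆ Function.support (radialWeight β q) ∩ Set.Ioi a := fun u hu =>
      ⟨(hpos u hu).ne', hu⟩
    exact lt_of_lt_of_le (by simp) (measure_mono hsub)
  · filter_upwards [ae_restrict_mem measurableSet_Ioi] with u hu
    exact (hpos u hu).le

lemma integral_radialWeight_tail_le {β q R : ℝ} (hβ : 0 < β) (hq : 0 ≤ q) (hR : 0 < R)
    (hs : q / R - β * R ≤ -1) :
    ∫ u in Set.Ioi R, radialWeight β q u ≤ radialWeight β q R := by
  have hi : IntegrableOn (fun u => radialWeight β q R * (Real.exp R * Real.exp (-u)))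
      (Set.Ioi R) :=
    ((integrableOn_exp_neg_Ioi R).const_mul _).const_mul _
  calc ∫ u in Set.Ioi R, radialWeight β q u
      ≤ ∫ u in Set.Ioi R, radialWeight β q R * (Real.exp R * Real.exp (-u)) := by
        refine setIntegral_mono_on (integrableOn_radialWeight hβ hq hR.le) hi
          measurableSet_Ioi fun u hu => ?_
        have hu' : R < u := hu
        refine (radialWeight_le hq hR (hR.trans hu')).trans ?_
        refine mul_le_mul_of_nonneg_left ?_ (radialWeight_pos β q hR).le
        rw [← Real.exp_add, Real.exp_le_exp]
        nlinarith [sq_nonneg (u - R)]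
    _ = radialWeight β q R := by
        rw [integral_const_mul, integral_const_mul, integral_exp_neg_Ioi, ← Real.exp_add]
        simp

lemma integral_radialWeight_le {β q R K : ℝ} (hβ : 0 < β) (hq : 0 ≤ q) (hR : 0 < R)
    (hK : |q / R - β * R| ≤ K) :
    ∫ u in Set.Ioi 0, radialWeight β q u ≤
      radialWeight β q R * (Real.exp (K ^ 2 / β) * Real.sqrt (π / (β / 4))) := by
  have hg : Integrable fun u : ℝ =>
      radialWeight β q R * (Real.exp (K ^ 2 / β) * Real.exp (-(β / 4) * (u - R) ^ 2)) :=
    (((integrable_exp_neg_mul_sq (show 0 < β / 4 by positivity)).comp_sub_right R).const_mul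
      _).const_mul _
  calc ∫ u in Set.Ioi 0, radialWeight β q u
      ≤ ∫ u in Set.Ioi 0,
          radialWeight β q R * (Real.exp (K ^ 2 / β) * Real.exp (-(β / 4) * (u - R) ^ 2)) := by
        refine setIntegral_mono_on (integrableOn_radialWeight hβ hq le_rfl) hg.integrableOn
          measurableSet_Ioi fun u hu => ?_
        refine (radialWeight_le hq hR hu).trans ?_
        refine mul_le_mul_of_nonneg_left ?_ (radialWeight_pos β q hR).le
        rw [← Real.exp_add, Real.exp_le_exp]
        have hb : (q / R - β * R) ^ 2 / β ≤ K ^ 2 / β := by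
          have := sq_le_sq' (neg_le_of_abs_le hK) (le_of_abs_le hK)
          gcongr
        have hsq : 0 ≤ ((q / R - β * R) - β / 2 * (u - R)) ^ 2 / β := by positivity
        have he : ((q / R - β * R) - β / 2 * (u - R)) ^ 2 / β =
            (q / R - β * R) ^ 2 / β - (q / R - β * R) * (u - R) + β / 4 * (u - R) ^ 2 := by
          generalize q / R - β * R = b
          field_simp
          ring
        linarith
    _ ≤ ∫ u : ℝ,
          radialWeight β q R * (Real.exp (K ^ 2 / β) * Real.exp (-(β / 4) * (u - R) ^ 2)) := by
        refine setIntegral_le_integral hg (Eventually.of_forall fun u => ?_)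
        have := (radialWeight_pos β q hR).le
        simp only [Pi.zero_apply]
        positivity
    _ = _ := by
        rw [integral_const_mul, integral_const_mul,
          integral_sub_right_eq_self (fun u : ℝ => Real.exp (-(β / 4) * u ^ 2)) R,
          integral_gaussian]

lemma le_integral_radialWeight_tail {β q R K a : ℝ} (hβ : 0 < β) (hq : 0 ≤ q) (hR : 0 < R)
    (ha : R ≤ a) (hK0 : 0 ≤ K) (hK : -K ≤ q / R - β * R) :
    radialWeight β q R *
        Real.exp (-(K * (a - R + 1) + (β / 2 + q / R ^ 2) * (a - R + 1) ^ 2)) ≤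
      ∫ u in Set.Ioi a, radialWeight β q u := by
  have hi := integrableOn_radialWeight hβ hq (hR.le.trans ha)
  have hc : 0 ≤ β / 2 + q / R ^ 2 := by positivity
  calc _ = ∫ _ in Set.Ioc a (a + 1), radialWeight β q R *
        Real.exp (-(K * (a - R + 1) + (β / 2 + q / R ^ 2) * (a - R + 1) ^ 2)) := by
        simp
    _ ≤ ∫ u in Set.Ioc a (a + 1), radialWeight β q u := by
        refine setIntegral_mono_on (integrableOn_const (by simp))
          (hi.mono_set Set.Ioc_subset_Ioi_self) measurableSet_Ioc fun u hu => ?_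
        have hRu : R ≤ u := ha.trans hu.1.le
        refine le_trans ?_ (le_radialWeight hq hR hRu)
        refine mul_le_mul_of_nonneg_left ?_ (radialWeight_pos β q hR).le
        rw [Real.exp_le_exp]
        have hs : u - R ≤ a - R + 1 := by linarith [hu.2]
        have hs0 : 0 ≤ u - R := by linarith
        have h1 : (u - R) ^ 2 ≤ (a - R + 1) ^ 2 := by gcongr
        have h2 := mul_le_mul_of_nonneg_left h1 hc
        have h3 := mul_le_mul_of_nonneg_left hs hK0
        have h4 := mul_le_mul_of_nonneg_right hK hs0
        linarith
    _ ≤ ∫ u in Set.Ioi a, radialWeight β q u := by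
        refine setIntegral_mono_set hi ?_ Set.Ioc_subset_Ioi_self.eventuallyLE
        filter_upwards [ae_restrict_mem measurableSet_Ioi] with u hu
        exact (radialWeight_pos β q ((hR.trans_le ha).trans hu)).le

lemma log_one_add_le_cubic {x : ℝ} (hx : 0 ≤ x) (hx2 : x ≤ 1 / 2) :
    Real.log (1 + x) ≤ x - x ^ 2 / 2 + 2 * x ^ 3 := by
  have h := Real.abs_log_sub_add_sum_range_le (x := -x)
    (by rw [abs_neg, abs_of_nonneg hx]; linarith) 2
  rw [abs_neg, abs_of_nonneg hx, sub_neg_eq_add] at h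
  have h1 := le_of_abs_le h
  have h2 : x ^ (2 + 1) / (1 - x) ≤ 2 * x ^ 3 := by
    rw [div_le_iff₀ (by linarith)]
    have : 0 ≤ x ^ 3 * (1 - 2 * x) := mul_nonneg (pow_nonneg hx 3) (by linarith)
    rw [show 2 + 1 = 3 from rfl]
    linarith
  norm_num [Finset.sum_range_succ] at h1 h2
  linarith

lemma radialWeight_dilate_le {β q R K x : ℝ} (hq : 0 ≤ q) (hR : 0 < R)
    (hK : |q / R - β * R| ≤ K) (hx : 0 ≤ x) (hx2 : x ≤ 1 / 2) :
    radialWeight β q (R * (1 + x)) ≤ radialWeight β q R *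
      Real.exp (-(β * (R * x) ^ 2) + 2 * β * x * (R * x) ^ 2 + 2 * K * (R * x)) := by
  have hx1 : 0 < 1 + x := by linarith
  rw [radialWeight_eq_exp β q (mul_pos hR hx1), radialWeight_eq_exp β q hR, ← Real.exp_add,
    Real.exp_le_exp, Real.log_mul hR.ne' hx1.ne']
  have h1 := mul_le_mul_of_nonneg_left (log_one_add_le_cubic hx hx2) hq
  obtain ⟨b, hb⟩ : ∃ b, b = q / R - β * R := ⟨_, rfl⟩
  have hqb : q = β * R ^ 2 + b * R := by
    rw [hb]
    field_simp
    ring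
  have hbK : b ≤ K := hb ▸ le_of_abs_le hK
  have hK0 : 0 ≤ K := (abs_nonneg _).trans hK
  have hc0 : 0 ≤ x - x ^ 2 / 2 + 2 * x ^ 3 := by nlinarith [pow_nonneg hx 3]
  have hc : x - x ^ 2 / 2 + 2 * x ^ 3 ≤ 2 * x := by nlinarith [sq_nonneg x]
  have h2 : b * R * (x - x ^ 2 / 2 + 2 * x ^ 3) ≤ K * R * (2 * x) := by gcongr
  have h3 : q * (x - x ^ 2 / 2 + 2 * x ^ 3) =
      β * R ^ 2 * (x - x ^ 2 / 2 + 2 * x ^ 3) + b * R * (x - x ^ 2 / 2 + 2 * x ^ 3) := by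
    rw [hqb]
    ring
  nlinarith

lemma Cnb_eq_integral {β : ℝ} (hβ : 0 < β) {N : ℕ} (hN : 0 ≤ Nbeta β N - 1) :
    Cnb β N = ∫ u in Set.Ioi 0, radialWeight β (Nbeta β N - 1) u := by
  have h := integral_rpow_mul_exp_neg_mul_rpow (p := 2) (q := Nbeta β N - 1) (b := β / 2)
    two_pos (by linarith) (by positivity)
  have h2 : ∫ u in Set.Ioi 0, radialWeight β (Nbeta β N - 1) u =
      ∫ x in Set.Ioi (0 : ℝ), x ^ (Nbeta β N - 1) * Real.exp (-(β / 2) * x ^ (2 : ℝ)) := by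
    refine setIntegral_congr_fun measurableSet_Ioi fun x _ => ?_
    simp only [radialWeight]
    rw [mul_comm, Real.rpow_two]
    congr 2
    ring
  rw [h2, h, Cnb, sub_add_cancel, Real.div_rpow hβ.le two_pos.le, Real.rpow_sub two_pos,
    neg_div, Real.rpow_neg two_pos.le, Real.rpow_one]
  field_simp

lemma div_sq_le_of_abs_slope_le {β q R K : ℝ} (hR : 1 ≤ R) (hK : |q / R - β * R| ≤ K) :
    q / R ^ 2 ≤ β + K := by
  have hR0 : 0 < R := by linarith
  have h1 : q / R ^ 2 = β + (q / R - β * R) / R := by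
    field_simp
    ring
  have h2 : (q / R - β * R) / R ≤ K := by
    rw [div_le_iff₀ hR0]
    nlinarith [le_of_abs_le hK, (abs_nonneg _).trans hK]
  linarith

lemma log_radial_tail_quotient_le {β p q R K x : ℝ} (hβ : 0 < β) (hp : 0 ≤ p) (hpq : p ≤ q)
    (hR : 1 ≤ R) (hK : |q / R - β * R| ≤ K) (hx : 0 ≤ x) (hx2 : x ≤ 1 / 2)
    (hslope : K + 2 ≤ 2 * β * (R * x)) :
    Real.log ((∫ u in Set.Ioi 0, radialWeight β q u)⁻¹ *
        ∫ u in Set.Ioi (R * (1 + x)), radialWeight β p u) ≤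
      -(β * (R * x) ^ 2) + 2 * β * x * (R * x) ^ 2 + 2 * K * (R * x) + (2 * K + 3 * β / 2) := by
  have hR0 : 0 < R := by linarith
  have hq : 0 ≤ q := hp.trans hpq
  have hK0 : 0 ≤ K := (abs_nonneg _).trans hK
  have hA1 : 1 ≤ R * (1 + x) := by nlinarith
  have hA0 : 0 < R * (1 + x) := by linarith
  have hW := radialWeight_pos β q hR0
  have hIpos := integral_radialWeight_Ioi_pos hβ hp hA0.le
  have hs : p / (R * (1 + x)) - β * (R * (1 + x)) ≤ -1 := by
    have hqK : q ≤ β * R ^ 2 + K * R := by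
      have := mul_le_mul_of_nonneg_right (le_of_abs_le hK) hR0.le
      have h2 : (q / R - β * R) * R = q - β * R ^ 2 := by
        field_simp
      linarith
    rw [sub_le_iff_le_add, div_le_iff₀ hA0]
    nlinarith [mul_le_mul_of_nonneg_left hslope hR0.le, sq_nonneg (R * x)]
  have hup : ∫ u in Set.Ioi (R * (1 + x)), radialWeight β p u ≤ radialWeight β q R *
      Real.exp (-(β * (R * x) ^ 2) + 2 * β * x * (R * x) ^ 2 + 2 * K * (R * x)) := by
    refine (integral_radialWeight_tail_le hβ hp hA0 hs).trans ?_
    refine le_trans ?_ (radialWeight_dilate_le hq hR0 hK hx hx2)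
    exact mul_le_mul_of_nonneg_left (Real.rpow_le_rpow_of_exponent_le hA1 hpq)
      (Real.exp_pos _).le
  have hlow : radialWeight β q R * Real.exp (-(2 * K + 3 * β / 2)) ≤
      ∫ u in Set.Ioi 0, radialWeight β q u := by
    have h := le_integral_radialWeight_tail hβ hq hR0 le_rfl hK0 (neg_le_of_abs_le hK)
    have h1 := div_sq_le_of_abs_slope_le hR hK
    refine le_trans ?_ (h.trans ?_)
    · refine mul_le_mul_of_nonneg_left (Real.exp_le_exp.2 ?_) hW.le
      rw [sub_self, zero_add]
      linarith
    · refine setIntegral_mono_set (integrableOn_radialWeight hβ hq le_rfl) ?_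
        (Set.Ioi_subset_Ioi hR0.le).eventuallyLE
      filter_upwards [ae_restrict_mem measurableSet_Ioi] with u hu
      exact (radialWeight_pos β q hu).le
  have hlow0 := mul_pos hW (Real.exp_pos (-(2 * K + 3 * β / 2)))
  have hCpos := hlow0.trans_le hlow
  rw [Real.log_mul (inv_ne_zero hCpos.ne') hIpos.ne', Real.log_inv]
  have h1 := Real.log_le_log hIpos hup
  have h2 := Real.log_le_log hlow0 hlow
  rw [Real.log_mul hW.ne' (Real.exp_pos _).ne', Real.log_exp] at h1 h2
  linarith

lemma le_log_radial_tail_quotient {β p q R K x : ℝ} (hβ : 0 < β) (hp : 0 ≤ p) (hpq : p ≤ q)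
    (hR : 1 ≤ R) (hK : |q / R - β * R| ≤ K) (hx : 0 ≤ x) :
    -((q - p) * Real.log R) -
        ((K + (q - p)) * (R * x + 1) + (3 * β / 2 + K) * (R * x + 1) ^ 2) -
        (K ^ 2 / β + Real.log (Real.sqrt (π / (β / 4)))) ≤
      Real.log ((∫ u in Set.Ioi 0, radialWeight β q u)⁻¹ *
        ∫ u in Set.Ioi (R * (1 + x)), radialWeight β p u) := by
  have hR0 : 0 < R := by linarith
  have hq : 0 ≤ q := hp.trans hpq
  have hK0 : 0 ≤ K := (abs_nonneg _).trans hK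
  have hRA : R ≤ R * (1 + x) := by nlinarith
  have hW := radialWeight_pos β q hR0
  have hWp := radialWeight_pos β p hR0
  have hsqrt : 0 < Real.sqrt (π / (β / 4)) := by positivity
  have hbp : -(K + (q - p)) ≤ p / R - β * R := by
    have h1 : p / R = q / R - (q - p) / R := by ring
    have h2 : (q - p) / R ≤ q - p := div_le_self (by linarith) hR
    linarith [neg_le_of_abs_le hK]
  have hlow := le_integral_radialWeight_tail hβ hp hR0 hRA (by linarith) hbp
  have hup := integral_radialWeight_le hβ hq hR0 hK
  have hlow0 := mul_pos hWp (Real.exp_pos (-((K + (q - p)) * (R * (1 + x) - R + 1) +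
    (β / 2 + p / R ^ 2) * (R * (1 + x) - R + 1) ^ 2)))
  have hIpos := hlow0.trans_le hlow
  have hCpos := integral_radialWeight_Ioi_pos hβ hq le_rfl
  rw [Real.log_mul (inv_ne_zero hCpos.ne') hIpos.ne', Real.log_inv]
  have h1 := Real.log_le_log hCpos hup
  have h2 := Real.log_le_log hlow0 hlow
  rw [Real.log_mul hWp.ne' (Real.exp_pos _).ne', Real.log_exp] at h2
  rw [Real.log_mul hW.ne' (by positivity), Real.log_mul (Real.exp_pos _).ne' hsqrt.ne',
    Real.log_exp] at h1
  rw [radialWeight_eq_exp β q hR0, Real.log_exp] at h1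
  rw [radialWeight_eq_exp β p hR0, Real.log_exp] at h2
  have h3 : p / R ^ 2 ≤ β + K :=
    (div_le_div_of_nonneg_right hpq (sq_nonneg R)).trans (div_sq_le_of_abs_slope_le hR hK)
  have h4 : R * (1 + x) - R + 1 = R * x + 1 := by ring
  rw [h4] at h2
  have h5 : (β / 2 + p / R ^ 2) * (R * x + 1) ^ 2 ≤ (3 * β / 2 + K) * (R * x + 1) ^ 2 :=
    mul_le_mul_of_nonneg_right (by linarith) (sq_nonneg _)
  linarith

lemma abs_Nbeta_slope_le {β R : ℝ} (hβ : 0 < β) {N : ℕ} (hR : 1 ≤ R)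
    (hRN : R ^ 2 = (N : ℝ) ^ 2 / 2) :
    |(Nbeta β N - 1) / R - β * R| ≤ 3 + β := by
  have hR0 : 0 < R := by linarith
  have hN : (N : ℝ) ≤ 2 * R :=
    le_of_abs_le (abs_le_of_sq_le_sq (by nlinarith) (by linarith))
  have h1 : (Nbeta β N - 1) / R - β * R = (N * (1 - β / 2) - 1) / R := by
    rw [Nbeta]
    field_simp
    rw [hRN]
    ring
  have hN0 : (0 : ℝ) ≤ N := Nat.cast_nonneg N
  rw [h1, abs_le, le_div_iff₀ hR0, div_le_iff₀ hR0]
  constructor <;> nlinarith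

/-- Lemma 1, second estimate: the upper tail of the radial integral is
`O(e^{-0.5β(Nα_N)²(1+o(1))})`. -/
theorem radial_upper_tail_estimate (β : ℝ) (hβ : 0 < β) (n : ℕ)
    (α : ℕ → ℝ) (hpos : ∀ N, 0 < α N)
    (h0 : Filter.Tendsto α atTop (𝓝 0))
    (hinf : Filter.Tendsto (fun N : ℕ => α N * N / Real.sqrt (Real.log N)) atTop atTop) :
    Filter.limsup
      (fun N : ℕ =>
        Real.log ((Cnb β N)⁻¹ *
            ∫ u in Set.Ioi (((N : ℝ) / Real.sqrt 2) * (1 + α N)),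
              Real.exp (-(β * u ^ 2 / 2)) * u ^ (Nbeta β N - n - 1)) /
          ((N * α N) ^ 2)) atTop ≤ -(β / 2) := by
  obtain ⟨K, hKdef⟩ : ∃ K, K = 3 + β := ⟨_, rfl⟩
  have hlogN : ∀ᶠ N : ℕ in atTop, Real.log N ≤ (N * α N) ^ 2 := by
    filter_upwards [hinf.eventually_ge_atTop 1, eventually_ge_atTop 2] with N h1 h2
    have hl : 0 < Real.log N := Real.log_pos (by exact_mod_cast h2)
    rw [le_div_iff₀ (Real.sqrt_pos.2 hl), one_mul] at h1
    calc Real.log N = Real.sqrt (Real.log N) ^ 2 := (Real.sq_sqrt hl.le).symm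
      _ ≤ (α N * N) ^ 2 := by gcongr
      _ = _ := by ring
  have hX : Tendsto (fun N : ℕ => (N : ℝ) * α N) atTop atTop := by
    have hl : Tendsto (fun N : ℕ => Real.log N) atTop atTop :=
      Real.tendsto_log_atTop.comp tendsto_natCast_atTop_atTop
    refine tendsto_atTop.2 fun b => ?_
    filter_upwards [hlogN, hl.eventually_ge_atTop (b ^ 2)] with N h1 h2
    have hx : 0 ≤ (N : ℝ) * α N := mul_nonneg (Nat.cast_nonneg N) (hpos N).le
    exact le_of_abs_le (abs_le_of_sq_le_sq (h2.trans h1) hx)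
  have hs0 : 0 < Real.sqrt 2 := by positivity
  have hR : Tendsto (fun N : ℕ => (N : ℝ) / Real.sqrt 2) atTop atTop :=
    tendsto_natCast_atTop_atTop.atTop_div_const hs0
  have hgood : ∀ᶠ N : ℕ in atTop,
      1 ≤ (N : ℝ) / Real.sqrt 2 ∧ 0 ≤ Nbeta β N - n - 1 ∧
      |(Nbeta β N - 1) / ((N : ℝ) / Real.sqrt 2) - β * ((N : ℝ) / Real.sqrt 2)| ≤ K := by
    filter_upwards [hR.eventually_ge_atTop 1, hR.eventually_ge_atTop ((K + n) / β)] with N h1 h2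
    have hK := abs_Nbeta_slope_le hβ (N := N) h1 (by rw [div_pow, Real.sq_sqrt two_pos.le])
    rw [← hKdef] at hK
    refine ⟨h1, ?_, hK⟩
    obtain ⟨R, hRdef⟩ : ∃ R, R = (N : ℝ) / Real.sqrt 2 := ⟨_, rfl⟩
    rw [← hRdef] at h1 h2 hK
    have hR0 : 0 < R := by linarith
    rw [div_le_iff₀ hβ] at h2
    have h3 : n ≤ (Nbeta β N - 1) / R := by linarith [neg_le_of_abs_le hK]
    rw [le_div_iff₀ hR0] at h3
    nlinarith [(Nat.cast_nonneg n : (0 : ℝ) ≤ n)]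
  have hquot : ∀ N : ℕ, 0 ≤ Nbeta β N - n - 1 →
      (Cnb β N)⁻¹ * ∫ u in Set.Ioi (((N : ℝ) / Real.sqrt 2) * (1 + α N)),
        Real.exp (-(β * u ^ 2 / 2)) * u ^ (Nbeta β N - n - 1) =
      (∫ u in Set.Ioi 0, radialWeight β (Nbeta β N - 1) u)⁻¹ *
        ∫ u in Set.Ioi (((N : ℝ) / Real.sqrt 2) * (1 + α N)),
          radialWeight β (Nbeta β N - n - 1) u := by
    intro N hN
    rw [Cnb_eq_integral hβ (by linarith [(Nat.cast_nonneg n : (0 : ℝ) ≤ n)])]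
    rfl
  have hRx : ∀ N : ℕ, ((N : ℝ) / Real.sqrt 2 * α N) ^ 2 = (N * α N) ^ 2 / 2 := by
    intro N
    rw [mul_pow, div_pow, Real.sq_sqrt two_pos.le]
    ring
  have hRx_le : ∀ N : ℕ, (N : ℝ) / Real.sqrt 2 * α N ≤ N * α N := fun N =>
    mul_le_mul_of_nonneg_right (div_le_self (Nat.cast_nonneg N)
      (Real.one_le_sqrt.2 one_le_two)) (hpos N).le
  have hRx_ge : ∀ N : ℕ, N * α N ≤ 2 * ((N : ℝ) / Real.sqrt 2 * α N) := by
    intro N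
    have hx : 0 ≤ (N : ℝ) / Real.sqrt 2 * α N :=
      mul_nonneg (div_nonneg (Nat.cast_nonneg N) hs0.le) (hpos N).le
    exact le_of_abs_le (abs_le_of_sq_le_sq (by nlinarith [hRx N]) (by linarith))
  have hupper : ∀ᶠ N : ℕ in atTop,
      Real.log ((Cnb β N)⁻¹ * ∫ u in Set.Ioi (((N : ℝ) / Real.sqrt 2) * (1 + α N)),
        Real.exp (-(β * u ^ 2 / 2)) * u ^ (Nbeta β N - n - 1)) / ((N * α N) ^ 2) ≤
      -(β / 2) + β * α N + 2 * K * (N * α N)⁻¹ + (2 * K + 3 * β / 2) * ((N * α N)⁻¹) ^ 2 := by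
    filter_upwards [hgood, h0.eventually_le_const (show (0 : ℝ) < 1 / 2 by norm_num),
      hX.eventually_ge_atTop ((K + 2) / β), hX.eventually_gt_atTop 0] with N hN hα hXN hX0
    obtain ⟨h1, hp, hK⟩ := hN
    rw [hquot N hp]
    rw [div_le_iff₀ hβ] at hXN
    have hb := log_radial_tail_quotient_le hβ hp
      (by linarith [(Nat.cast_nonneg n : (0 : ℝ) ≤ n)]) h1 hK (hpos N).le hα
      (by nlinarith [hRx_ge N])
    rw [hRx] at hb
    have hb' := mul_le_mul_of_nonneg_left (hRx_le N) (show 0 ≤ 2 * K by linarith)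
    rw [div_le_iff₀ (by positivity)]
    refine hb.trans ?_
    have he : (-(β / 2) + β * α N + 2 * K * (N * α N)⁻¹ +
        (2 * K + 3 * β / 2) * ((N * α N)⁻¹) ^ 2) * (N * α N) ^ 2 =
        -(β / 2) * (N * α N) ^ 2 + β * α N * (N * α N) ^ 2 + 2 * K * (N * α N) +
          (2 * K + 3 * β / 2) := by
      generalize (N : ℝ) * α N = X at hX0
      field_simp
    rw [he]
    linarith
  have hlower : ∃ M : ℝ, ∀ᶠ N : ℕ in atTop, M ≤
      Real.log ((Cnb β N)⁻¹ * ∫ u in Set.Ioi (((N : ℝ) / Real.sqrt 2) * (1 + α N)),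
        Real.exp (-(β * u ^ 2 / 2)) * u ^ (Nbeta β N - n - 1)) / ((N * α N) ^ 2) := by
    refine ⟨-(n + 2 * (K + n) + 4 * (3 * β / 2 + K) +
      |K ^ 2 / β + Real.log (Real.sqrt (π / (β / 4)))|), ?_⟩
    filter_upwards [hgood, hlogN, hX.eventually_ge_atTop 1] with N hN hlog hX1
    obtain ⟨h1, hp, hK⟩ := hN
    have hn : (0 : ℝ) ≤ n := Nat.cast_nonneg n
    rw [hquot N hp, le_div_iff₀ (by positivity)]
    refine le_trans ?_ (le_log_radial_tail_quotient hβ hp (by linarith) h1 hK (hpos N).le)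
    have hqp : Nbeta β N - 1 - (Nbeta β N - n - 1) = n := by ring
    rw [hqp]
    have hlogR : Real.log ((N : ℝ) / Real.sqrt 2) ≤ (N * α N) ^ 2 :=
      (Real.log_le_log (by linarith) (div_le_self (Nat.cast_nonneg N)
        (Real.one_le_sqrt.2 one_le_two))).trans hlog
    have hy := hRx_le N
    have hy0 : 0 ≤ (N : ℝ) / Real.sqrt 2 * α N := mul_nonneg (by linarith) (hpos N).le
    generalize (N : ℝ) / Real.sqrt 2 * α N = y at hy hy0 ⊢
    generalize (N : ℝ) * α N = X at hX1 hy hlogR ⊢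
    generalize K ^ 2 / β + Real.log (Real.sqrt (π / (β / 4))) = c
    have hXX : 1 ≤ X ^ 2 := one_le_pow₀ hX1
    have e1 := mul_le_mul_of_nonneg_left hlogR hn
    have e2 : (K + n) * (y + 1) ≤ (K + n) * (2 * X ^ 2) :=
      mul_le_mul_of_nonneg_left (by nlinarith) (by linarith)
    have e3 : (3 * β / 2 + K) * (y + 1) ^ 2 ≤ (3 * β / 2 + K) * (4 * X ^ 2) :=
      mul_le_mul_of_nonneg_left (by nlinarith) (by linarith)
    have e4 : c ≤ |c| * X ^ 2 := (le_abs_self c).trans (le_mul_of_one_le_right (abs_nonneg c) hXX)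
    linarith
  have hlim : Tendsto (fun N : ℕ => -(β / 2) + β * α N + 2 * K * (N * α N)⁻¹ +
      (2 * K + 3 * β / 2) * ((N * α N)⁻¹) ^ 2) atTop (𝓝 (-(β / 2))) := by
    have hXi := hX.inv_tendsto_atTop
    have h := (((h0.const_mul β).const_add (-(β / 2))).add (hXi.const_mul (2 * K))).add
      ((hXi.pow 2).const_mul (2 * K + 3 * β / 2))
    simpa using h
  obtain ⟨M, hM⟩ := hlower
  rw [← hlim.limsup_eq]
  exact limsup_le_limsup hupper
    (IsBoundedUnder.isCoboundedUnder_le ⟨M, eventually_map.2 hM⟩) hlim.isBoundedUnder_le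
end
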